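/- Let G and H be finite metacyclic groups. If ℚG and ℚH are isomorphic as ℚ-algebras, then the moduli m' computed for G and for H coincide, and Δ^G = Δ^H as subgroups of (ℤ/m'ℤ)ˣ. -/

import Mathlib

open scoped Classical

noncomputable section

namespace ArXiv230800432

/-- The `σ`-part of a natural number: product of `p ^ vₚ(n)` over primes `p ∈ σ` dividing `n`. -/
def natPart (n : ℕ) (σ : Set ℕ) : ℕ :=
  ∏ p ∈ n.primeFactors, if p ∈ σ then p ^ (n.factorization p) else 1

/-- A metacyclic factorization `G = A·B` with `A` cyclic normal and `B` cyclic. -/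
structure MetacyclicFact (G : Type*) [Group G] where
  A : Subgroup G
  B : Subgroup G
  normalA : A.Normal
  cyclicA : IsCyclic A
  cyclicB : IsCyclic B
  mul_cover : ∀ g : G, ∃ x ∈ A, ∃ y ∈ B, g = x * y

/-- A group is metacyclic if it admits a metacyclic factorization. -/
def IsMetacyclic (G : Type*) [Group G] : Prop :=
  Nonempty (MetacyclicFact G)

variable {G : Type*} [Group G]

/-- `π_G`: primes `p` dividing `|G|` such that `G` has a normal Hall `p'`-subgroup. -/
def piSet (G : Type*) [Group G] : Set ℕ :=
  {p | p.Prime ∧ p ∣ Nat.card G ∧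
    ∃ N : Subgroup G, N.Normal ∧ Nat.card N = ordCompl[p] (Nat.card G)}

/-- `π'_G = π(G) \ π_G`. -/
def piSet' (G : Type*) [Group G] : Set ℕ :=
  {p | p.Prime ∧ p ∣ Nat.card G} \ piSet G

/-- The image mod `d` of `T_G(A)`: classes `[t]_d` such that some `g ∈ G` acts on `A` by
conjugation as `x ↦ x ^ t`.  For `d = |A|` this is exactly `T_G(A)`. -/
def TGmod (A : Subgroup G) (d : ℕ) : Subgroup (ZMod d)ˣ :=
  Subgroup.closure
    {u : (ZMod d)ˣ | ∃ g : G, ∃ t : ℕ, ((t : ZMod d) = (u : ZMod d)) ∧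
      ∀ x ∈ A, g⁻¹ * x * g = x ^ t}

/-- `T_G(A)` as subgroup of `(ℤ/|A|ℤ)ˣ`. -/
def TG (A : Subgroup G) : Subgroup (ZMod (Nat.card A))ˣ :=
  TGmod A (Nat.card A)

/-- The image of `T` under `Res_q : (ℤ/dℤ)ˣ → (ℤ/qℤ)ˣ` is trivial. -/
def resTriv (d q : ℕ) (T : Subgroup (ZMod d)ˣ) : Prop :=
  ∀ u ∈ T, ∀ t : ℕ, ((t : ZMod d) = (u : ZMod d)) → (t : ZMod q) = 1

/-- The image of `T` under `Res_q` is contained in `⟨-1⟩`. -/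
def resInPMOne (d q : ℕ) (T : Subgroup (ZMod d)ˣ) : Prop :=
  ∀ u ∈ T, ∀ t : ℕ, ((t : ZMod d) = (u : ZMod d)) →
    ((t : ZMod q) = 1 ∨ (t : ZMod q) = -1)

/-- The image of `T` under `Res_q` as a set of units mod `q`. -/
def resSet (d q : ℕ) (T : Subgroup (ZMod d)ˣ) : Set (ZMod q)ˣ :=
  {v | ∃ u ∈ T, ∃ t : ℕ, ((t : ZMod d) = (u : ZMod d)) ∧ ((t : ZMod q) = (v : ZMod q))}

/-- The set of natural numbers representing elements of `T ≤ (ℤ/dℤ)ˣ`. -/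
def liftSet {d : ℕ} (T : Subgroup (ZMod d)ˣ) : Set ℕ :=
  {t | ∃ u ∈ T, (t : ZMod d) = (u : ZMod d)}

/-- `r^G(A)`: the greatest divisor `r` of `|A|` such that `Res_{r_{2'}}(T_G(A)) = 1` and
`Res_{r_2}(T_G(A)) ⊆ ⟨-1⟩`. -/
def rOfA (A : Subgroup G) : ℕ :=
  sSup {r : ℕ | r ∣ Nat.card A ∧ resTriv (Nat.card A) (ordCompl[2] r) (TG A) ∧
    resInPMOne (Nat.card A) (ordProj[2] r) (TG A)}

/-- `ε^G(A)`: `-1` if `Res_{r_2}(T_G(A)) ≠ 1`, and `1` otherwise. -/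
def epsOfA (A : Subgroup G) : ℤ :=
  if resTriv (Nat.card A) (ordProj[2] (rOfA A)) (TG A) then 1 else -1

/-- `k^G(A)`: order of the image of `T_G(A)` in `(ℤ/m_ν ℤ)ˣ`, `ν` the primes dividing `|A|`
but not `r^G(A)`. -/
def kOfA (A : Subgroup G) : ℕ :=
  (resSet (Nat.card A) (natPart (Nat.card A) {p | ¬ p ∣ rOfA A}) (TG A)).ncard

/-- The triple `(|A|, r^G(A), [G:B])` attached to a metacyclic factorization. -/
def factTriple (f : MetacyclicFact G) : ℕ × ℕ × ℕ :=
  (Nat.card f.A, rOfA f.A, f.B.index)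

/-- Lexicographic order on triples. -/
def lex3 (x y : ℕ × ℕ × ℕ) : Prop :=
  x.1 < y.1 ∨ (x.1 = y.1 ∧ (x.2.1 < y.2.1 ∨ (x.2.1 = y.2.1 ∧ x.2.2 ≤ y.2.2)))

/-- A metacyclic factorization is minimal when its triple is lexicographically minimal. -/
def IsMinimalFact (f : MetacyclicFact G) : Prop :=
  ∀ f' : MetacyclicFact G, lex3 (factTriple f) (factTriple f')

def mOf (f : MetacyclicFact G) : ℕ := Nat.card f.A
def nOf (f : MetacyclicFact G) : ℕ := f.A.index
def sOf (f : MetacyclicFact G) : ℕ := f.B.index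
def rOf (f : MetacyclicFact G) : ℕ := rOfA f.A
def epsOf (f : MetacyclicFact G) : ℤ := epsOfA f.A
def kOf (f : MetacyclicFact G) : ℕ := kOfA f.A

/-- The `σ`-part of an element of a finite group. -/
def elemPart (σ : Set ℕ) (g : G) : G :=
  g ^ ((orderOf g / natPart (orderOf g) σ) *
    (((orderOf g / natPart (orderOf g) σ : ℕ) : ZMod (natPart (orderOf g) σ))⁻¹.val))

/-- The (unique, for `N` cyclic) Hall `σ`-subgroup of a subgroup `N`. -/
def hallOf (N : Subgroup G) (σ : Set ℕ) : Subgroup G :=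
  Subgroup.closure {x : G | x ∈ N ∧ orderOf x ∣ natPart (Nat.card N) σ}

/-- `R^G = T_G(G'_{π'})`, realized as a subgroup of `(ℤ/dℤ)ˣ`. -/
def ROf (G : Type*) [Group G] (d : ℕ) : Subgroup (ZMod d)ˣ :=
  TGmod (hallOf (commutator G) (piSet' G)) d

/-- The local factor `m'_p` in the definition of the modulus `m'`. -/
def mPrimeP (p m n s r k : ℕ) (ε : ℤ) : ℕ :=
  if ε ^ (p - 1) = 1 then
    min (ordProj[p] m) (min (ordProj[p] k * ordProj[p] r)
      (max (ordProj[p] r) (max (ordProj[p] s)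
        (ordProj[p] r * ordProj[p] s * ordProj[p] k / ordProj[p] n))))
  else
    if ordProj[2] k ≤ 2 ∨ ordProj[2] m ≤ 2 * ordProj[2] r then ordProj[2] r
    else if (4 ≤ ordProj[2] k ∧ ordProj[2] k < ordProj[2] n ∧
        4 * ordProj[2] r ≤ ordProj[2] m ∧
        (ordProj[2] s = ordProj[2] n * ordProj[2] r ∨
          (2 * ordProj[2] s = ordProj[2] m ∧ ordProj[2] m < ordProj[2] n * ordProj[2] r)))
      then ordProj[2] m / 2
      else ordProj[2] m

/-- The modulus `m' = m_{π'} · ∏_{p ∈ π(r)} m'_p`. -/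
def mPrimeOf (π' : Set ℕ) (m n s r k : ℕ) (ε : ℤ) : ℕ :=
  natPart m π' * ∏ p ∈ r.primeFactors, mPrimeP p m n s r k ε

/-- `f` is the multiplicative period of `t` modulo `d`. -/
def IsPer (t d f : ℕ) : Prop := ∀ i, t ^ i ≡ 1 [MOD d] ↔ f ∣ i

/-- Elements `a`, `b` presenting a metacyclic group with invariants `m`, `n`, `s`, `t`. -/
structure Pres {G : Type*} [Group G] (a b : G) (m n s t : ℕ) : Prop where
  n_pos : 0 < n
  m_pos : 0 < m
  ord : orderOf a = m
  comm : a * b = b * a ^ t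
  pow_n : b ^ n = a ^ s
  card : Nat.card G = m * n
  cover : ∀ g : G, ∃ x y : ℕ, g = b ^ y * a ^ x
  mem : ∀ y : ℕ, b ^ y ∈ Subgroup.zpowers a ↔ n ∣ y
  s_dvd : s ∣ m
  cop : Nat.Coprime t m
  pow_t : t ^ n ≡ 1 [MOD m]
  fix : s * t ≡ s [MOD m]

/-- The weighted count of Galois-stable irreducible characters of degree `f`. -/
def W (m n s t f j : ℕ) : ℕ :=
  ∑ d ∈ m.divisors with (IsPer t d f ∧ (∃ i, j ≡ t ^ i [MOD d]) ∧
      d ∣ s * (Nat.gcd (j - 1) (m * n) / Nat.gcd (n / f) (j - 1))),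
    Nat.totient d * Nat.gcd (n / f) (j - 1)

section VonDyck

variable {M : Type*} [Monoid M]

lemma pow_mul_pow_comm {A B : M} {t : ℕ} (h : A * B = B * A ^ t) (x y : ℕ) :
    A ^ x * B ^ y = B ^ y * A ^ (x * t ^ y) := by
  have h1 : ∀ x, A ^ x * B = B * A ^ (x * t) := by
    intro x
    induction x with
    | zero => simp
    | succ k ih => rw [pow_succ, mul_assoc, h, ← mul_assoc, ih, mul_assoc, ← pow_add]; congr 2; ring
  induction y generalizing x with
  | zero => simp
  | succ k ih => rw [pow_succ, ← mul_assoc, ih, mul_assoc, h1, ← mul_assoc]; congr 2; ring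

lemma exists_hom_of_relations {G : Type*} [Group G] {a b : G} {m n s t : ℕ}
    (P : Pres a b m n s t) {A B : M} (hA : A ^ m = 1) (hB : B ^ n = A ^ s)
    (hAB : A * B = B * A ^ t) :
    ∃ φ : G →* M, ∀ x y : ℕ, φ (b ^ y * a ^ x) = B ^ y * A ^ x := by
  have hpow : ∀ x x' : ℕ, a ^ x = a ^ x' → A ^ x = A ^ x' := by
    intro x x' h
    rw [pow_inj_mod, P.ord] at h
    rw [← pow_mod_orderOf A x, ← pow_mod_orderOf A x']
    have h1 : orderOf A ∣ m := orderOf_dvd_of_pow_eq_one hA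
    have : x ≡ x' [MOD orderOf A] := Nat.ModEq.of_dvd h1 h
    rw [this]
  have aux : ∀ x y x' y' : ℕ, y ≤ y' → b ^ y * a ^ x = b ^ y' * a ^ x' →
      B ^ y * A ^ x = B ^ y' * A ^ x' := by
    intro x y x' y' hy h
    obtain ⟨e, rfl⟩ := Nat.exists_eq_add_of_le hy
    rw [pow_add, mul_assoc] at h ⊢
    have h := mul_left_cancel h
    have he : n ∣ e := by
      rw [← P.mem]
      have : b ^ e = a ^ x * (a ^ x')⁻¹ := by rw [h]; group
      rw [this]
      exact mul_mem (pow_mem (Subgroup.mem_zpowers a) _)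
        (inv_mem (pow_mem (Subgroup.mem_zpowers a) _))
    obtain ⟨q, rfl⟩ := he
    rw [pow_mul, P.pow_n, ← pow_mul, ← pow_add] at h
    rw [pow_mul, hB, ← pow_mul, ← pow_add, hpow _ _ h]
  have wd : ∀ x y x' y' : ℕ, b ^ y * a ^ x = b ^ y' * a ^ x' →
      B ^ y * A ^ x = B ^ y' * A ^ x' := by
    intro x y x' y' h
    rcases le_total y y' with h1 | h1
    · exact aux _ _ _ _ h1 h
    · exact (aux _ _ _ _ h1 h.symm).symm
  choose X Y hXY using P.cover
  have key : ∀ x y : ℕ, B ^ Y (b ^ y * a ^ x) * A ^ X (b ^ y * a ^ x) = B ^ y * A ^ x :=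
    fun x y => wd _ _ _ _ (hXY _).symm
  refine ⟨{ toFun := fun g => B ^ Y g * A ^ X g, map_one' := ?_, map_mul' := ?_ }, ?_⟩
  · have := key 0 0
    simpa using this
  · intro g g'
    have : g * g' = b ^ (Y g + Y g') * a ^ (X g * t ^ Y g' + X g') := by
      conv_lhs => rw [hXY g, hXY g']
      rw [mul_assoc, ← mul_assoc (a ^ _), pow_mul_pow_comm P.comm, pow_add, pow_add]
      simp only [mul_assoc]
    rw [this, key, mul_assoc, ← mul_assoc (A ^ _), pow_mul_pow_comm hAB, pow_add, pow_add]
    simp only [mul_assoc]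
  · intro x y
    exact key x y

end VonDyck

section Rep

variable {G : Type*} [Group G] {K : Type*} [Field K] {V : Type*} [AddCommGroup V] [Module K V]

/-- A representation without proper nonzero invariant subspaces. -/
def Irred (ρ : G →* Module.End K V) : Prop :=
  ∀ U : Submodule K V, (∀ g, ∀ v ∈ U, ρ g v ∈ U) → U = ⊥ ∨ U = ⊤

/-- The shape of the character attached to the pair `(α, η)`. -/
def IsCh (a b : G) (t f : ℕ) (α η : K) (χ : G → K) : Prop :=
  ∀ x y : ℕ, χ (b ^ y * a ^ x) =
    if f ∣ y then η ^ (y / f) * ∑ i ∈ Finset.range f, α ^ (x * t ^ i) else 0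

/-- The pairs `(α, η)` parametrizing irreducible representations of degree `f`. -/
structure IsAdm (m n s t f : ℕ) (α η : K) : Prop where
  pow_m : α ^ m = 1
  per : ∀ i, α ^ (t ^ i) = α ↔ f ∣ i
  pow_eta : η ^ (n / f) = α ^ s

/-- A cyclic chain of eigenvectors for `A`, shifted by `B`. -/
structure IsChain (A B : Module.End K V) (t f : ℕ) (α η : K) (E : ℕ → V) : Prop where
  actA : ∀ i, A (E i) = α ^ (t ^ i) • E i
  actB : ∀ i, B (E i) = E (i + 1)
  wrap : ∀ i, E (i + f) = η • E i

variable {A B : Module.End K V} {m n s t f : ℕ} {α η : K} {E : ℕ → V}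

lemma IsChain.actA_pow (h : IsChain A B t f α η E) (x i : ℕ) :
    (A ^ x) (E i) = α ^ (x * t ^ i) • E i := by
  induction x with
  | zero => simp
  | succ k ih => rw [pow_succ', Module.End.mul_apply, ih, map_smul, h.actA, smul_smul, ← pow_add]
                 congr 2; ring

lemma IsChain.actB_pow (h : IsChain A B t f α η E) (y i : ℕ) :
    (B ^ y) (E i) = E (i + y) := by
  induction y with
  | zero => simp
  | succ k ih => rw [pow_succ', Module.End.mul_apply, ih, h.actB, add_assoc]

lemma IsChain.wrap_mul (h : IsChain A B t f α η E) (q i : ℕ) :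
    E (i + f * q) = η ^ q • E i := by
  induction q with
  | zero => simp
  | succ k ih => rw [mul_add, mul_one, ← add_assoc, h.wrap, ih, smul_smul, pow_succ']

lemma IsChain.reduce (h : IsChain A B t f α η E) (i : ℕ) :
    E i = η ^ (i / f) • E (i % f) := by
  conv_lhs => rw [← Nat.mod_add_div i f]
  exact h.wrap_mul _ _

lemma IsChain.isCh {ρ : G →* Module.End K V} {a b : G} (h : IsChain (ρ a) (ρ b) t f α η E)
    (bs : Module.Basis (Fin f) K V) (hbs : ∀ i : Fin f, bs i = E i) :
    IsCh a b t f α η (fun g => LinearMap.trace K V (ρ g)) := by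
  intro x y
  simp only
  rw [LinearMap.trace_eq_matrix_trace K bs, Matrix.trace]
  have hd : ∀ i : Fin f, (LinearMap.toMatrix bs bs (ρ (b ^ y * a ^ x))).diag i =
      if f ∣ y then η ^ (y / f) * α ^ (x * t ^ (i : ℕ)) else 0 := by
    intro i
    have hf : 0 < f := i.pos
    rw [Matrix.diag_apply, LinearMap.toMatrix_apply, hbs, map_mul, map_pow, map_pow,
      Module.End.mul_apply, h.actA_pow, map_smul, h.actB_pow, h.reduce (i + y)]
    have : E ((i + y) % f) = bs ⟨(i + y) % f, Nat.mod_lt _ hf⟩ := (hbs ⟨_, Nat.mod_lt _ hf⟩).symm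
    rw [this, map_smul, map_smul, Module.Basis.repr_self]
    simp only [Finsupp.smul_apply, Finsupp.single_apply, smul_eq_mul]
    by_cases hy : f ∣ y
    · obtain ⟨q, rfl⟩ := hy
      have e1 : (⟨(i + f * q) % f, Nat.mod_lt _ hf⟩ : Fin f) = i := by
        ext; simp [Nat.mod_eq_of_lt i.2]
      have e2 : (i + f * q) / f = q := by
        rw [Nat.add_mul_div_left _ _ hf, Nat.div_eq_of_lt i.2, zero_add]
      rw [e1, e2, if_pos rfl, if_pos (dvd_mul_right _ _), Nat.mul_div_cancel_left _ hf]
      ring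
    · rw [if_neg hy, if_neg]
      · simp
      · intro hc
        apply hy
        have h1 : (i + y) % f = i := congrArg Fin.val hc
        have h2 : (i + y) ≡ i + 0 [MOD f] := by
          rw [Nat.ModEq, h1, add_zero, Nat.mod_eq_of_lt i.2]
        exact (Nat.modEq_zero_iff_dvd).1 (Nat.ModEq.add_left_cancel' _ h2)
  rw [Finset.sum_congr rfl (fun i _ => hd i)]
  split_ifs with hy
  · rw [← Finset.mul_sum, Finset.sum_range]
  · simp

/-- Distinctness of the eigenvalues of a chain. -/
lemma pow_pow_inj (ht : Nat.Coprime t m) (hm : 0 < m)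
    (hα : α ^ m = 1)
    (hper : ∀ i, α ^ (t ^ i) = α ↔ f ∣ i) {i j : ℕ} (hij : α ^ (t ^ i) = α ^ (t ^ j)) :
    i ≡ j [MOD f] := by
  have hα0 : α ≠ 0 := by rintro rfl; simp [hm.ne'] at hα
  have hord : orderOf α ∣ m := orderOf_dvd_of_pow_eq_one hα
  have hfin : IsOfFinOrder α := isOfFinOrder_iff_pow_eq_one.2 ⟨m, hm, hα⟩
  have aux : ∀ i e, α ^ (t ^ i) = α ^ (t ^ (i + e)) → f ∣ e := by
    intro i e h
    rw [← hper]
    have h1 : t ^ i * t ^ e ≡ t ^ i * 1 [MOD orderOf α] := by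
      rw [← pow_add, mul_one]
      exact (hfin.pow_eq_pow_iff_modEq.1 h).symm
    have h2 : Nat.gcd (orderOf α) (t ^ i) = 1 :=
      Nat.Coprime.coprime_dvd_left hord (Nat.Coprime.pow_right _ ht.symm)
    have h3 := Nat.ModEq.cancel_left_of_coprime h2 h1
    have := hfin.pow_eq_pow_iff_modEq.2 h3
    simpa using this
  rcases le_total i j with h | h
  · obtain ⟨e, rfl⟩ := Nat.exists_eq_add_of_le h
    have := aux i e hij
    exact (Nat.modEq_iff_dvd' (by omega)).2 (by simpa using this)
  · obtain ⟨e, rfl⟩ := Nat.exists_eq_add_of_le h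
    have := aux j e hij.symm
    exact ((Nat.modEq_iff_dvd' (by omega)).2 (by simpa using this)).symm

lemma exists_eigenvector [FiniteDimensional K V] {N : ℕ} (hN : 0 < N) {ζ : K}
    (hζ : IsPrimitiveRoot ζ N) (T : Module.End K V) (hT : T ^ N = 1) (U : Submodule K V)
    (hU : ∀ v ∈ U, T v ∈ U) (hU0 : U ≠ ⊥) : ∃ v ∈ U, v ≠ 0 ∧ ∃ c : K, T v = c • v := by
  have := (Submodule.nontrivial_iff_ne_bot).2 hU0
  let T' : Module.End K U := T.restrict hU
  have hpow : ∀ k, ∀ u : U, ((T' ^ k) u : V) = (T ^ k) u := by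
    intro k
    induction k with
    | zero => simp
    | succ k ih => intro u; rw [pow_succ', pow_succ']; simp only [Module.End.mul_apply]
                   rw [← ih]; rfl
  have hT' : T' ^ N = 1 := by
    ext u
    rw [hpow, hT]; rfl
  have hsp : (minpoly K T').Splits := by
    have h1 : (Polynomial.X ^ N - 1 : Polynomial K).Splits := Polynomial.X_pow_sub_one_splits hζ
    refine Polynomial.Splits.of_dvd h1 ?_ ?_
    · exact (Polynomial.monic_X_pow_sub_C 1 hN.ne').ne_zero
    · apply minpoly.dvd
      simp [hT']
  have hdeg : (minpoly K T').degree ≠ 0 :=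
    (minpoly.degree_pos (Algebra.IsIntegral.isIntegral T')).ne'
  obtain ⟨c, hc⟩ := hsp.exists_eval_eq_zero hdeg
  have hev := Module.End.hasEigenvalue_of_isRoot (f := T') (μ := c) hc
  obtain ⟨u, hu⟩ := hev.exists_hasEigenvector
  refine ⟨u, u.2, ?_, c, ?_⟩
  · simpa using hu.2
  · have := congrArg Subtype.val hu.apply_eq_smul
    simpa [T'] using this

end Rep

section Rep

variable {G : Type*} [Group G] {K : Type*} [Field K] {V : Type*} [AddCommGroup V] [Module K V]
variable {m n s t f : ℕ} {α η : K} {a b : G}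

lemma Pres.pow_card (P : Pres a b m n s t) (g : G) : g ^ (m * n) = 1 := by
  rw [← P.card]; exact pow_card_eq_one'

lemma Pres.ord_pow (P : Pres a b m n s t) : a ^ m = 1 := by
  rw [← P.ord]; exact pow_orderOf_eq_one a

lemma Pres.N_pos (P : Pres a b m n s t) : 0 < m * n := Nat.mul_pos P.m_pos P.n_pos

lemma pow_eq_of_modEq {M : Type*} [Monoid M] {x : M} {m i j : ℕ} (hx : x ^ m = 1)
    (h : i ≡ j [MOD m]) : x ^ i = x ^ j := by
  rw [pow_eq_pow_mod i hx, pow_eq_pow_mod j hx, h]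

lemma IsAdm.alpha_ne (h : IsAdm m n s t f α η) (hm : 0 < m) : α ≠ 0 := by
  rintro rfl
  have := h.pow_m
  simp [hm.ne'] at this

lemma IsAdm.f_dvd (h : IsAdm m n s t f α η) (htn : t ^ n ≡ 1 [MOD m]) : f ∣ n := by
  rw [← h.per]
  have := pow_eq_of_modEq h.pow_m htn
  rwa [pow_one] at this

lemma IsAdm.eta_ne (h : IsAdm m n s t f α η) (hm : 0 < m) (hn : 0 < n)
    (htn : t ^ n ≡ 1 [MOD m]) : η ≠ 0 := by
  rintro rfl
  have h1 := h.pow_eta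
  have h2 : 0 < n / f := Nat.div_pos (Nat.le_of_dvd hn (h.f_dvd htn))
    (Nat.pos_of_dvd_of_pos (h.f_dvd htn) hn)
  rw [zero_pow h2.ne'] at h1
  exact pow_ne_zero s (h.alpha_ne hm) h1.symm

/-- A subspace invariant under a representation with a full chain is trivial. -/
lemma IsChain.irred {ρ : G →* Module.End K V} (P : Pres a b m n s t)
    (hadm : IsAdm m n s t f α η) {ζ : K} (hζ : IsPrimitiveRoot ζ (m * n))
    {E : ℕ → V} (h : IsChain (ρ a) (ρ b) t f α η E)
    (bs : Module.Basis (Fin f) K V) (hbs : ∀ i : Fin f, bs i = E i) : Irred ρ := by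
  intro U hU
  by_cases hU0 : U = ⊥
  · exact Or.inl hU0
  right
  have hfd : FiniteDimensional K V := Module.Basis.finiteDimensional_of_finite bs
  obtain ⟨v, hv, hv0, c, hc⟩ := exists_eigenvector P.N_pos hζ (ρ a)
    (by rw [← map_pow, P.pow_card, map_one]) U (hU a) hU0
  have hcoord : ∀ i : Fin f, α ^ (t ^ (i : ℕ)) * bs.repr v i = c * bs.repr v i := by
    intro i
    have h1 : bs.repr (ρ a v) i = c * bs.repr v i := by rw [hc]; simp
    rw [← h1]
    conv_rhs => rw [← bs.sum_repr v]
    have : ∀ j : Fin f, ρ a (bs.repr v j • bs j) = (bs.repr v j * α ^ (t ^ (j : ℕ))) • bs j := by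
      intro j; rw [map_smul, hbs, h.actA, smul_smul]
    rw [map_sum, Finset.sum_congr rfl (fun j _ => this j), Module.Basis.repr_sum_self]
    ring
  have hne : bs.repr v ≠ 0 := by simpa using hv0
  obtain ⟨i, hi⟩ := Finsupp.ne_iff.1 hne
  simp only [Finsupp.coe_zero, Pi.zero_apply] at hi
  have hci := mul_right_cancel₀ hi (hcoord i)
  have hother : ∀ j, j ≠ i → bs.repr v j = 0 := by
    intro j hj
    by_contra hj0
    have hcj := mul_right_cancel₀ hj0 (hcoord j)
    have := pow_pow_inj P.cop P.m_pos hadm.pow_m hadm.per (hcj.trans hci.symm)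
    apply hj
    ext
    rwa [Nat.ModEq, Nat.mod_eq_of_lt i.2, Nat.mod_eq_of_lt j.2] at this
  have hvE : v = bs.repr v i • E i := by
    conv_lhs => rw [← bs.sum_repr v]
    rw [Finset.sum_eq_single i, hbs]
    · intro j _ hj; rw [hother j hj, zero_smul]
    · simp
  have hEi : E i ∈ U := by
    have h1 : (bs.repr v i)⁻¹ • v = E i := by
      conv_lhs => rw [hvE]
      rw [← hbs, map_smul, Finsupp.smul_apply, Module.Basis.repr_self, Finsupp.single_eq_same,
        smul_eq_mul, mul_one, smul_smul, inv_mul_cancel₀ hi, one_smul]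
    rw [← h1]
    exact U.smul_mem _ hv
  have hEall : ∀ e, E (i + e) ∈ U := by
    intro e
    induction e with
    | zero => exact hEi
    | succ k ih => rw [← add_assoc, ← h.actB]; exact hU b _ ih
  rw [eq_top_iff, ← bs.span_eq, Submodule.span_le]
  rintro _ ⟨j, rfl⟩
  have hf : 0 < f := i.pos
  have h1 : E (j + f * i) ∈ U := by
    obtain ⟨e, he⟩ := Nat.exists_eq_add_of_le
      (show (i : ℕ) ≤ j + f * i by nlinarith [Nat.le_mul_of_pos_left (i : ℕ) hf])
    rw [he]; exact hEall e
  rw [h.wrap_mul] at h1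
  have hη := pow_ne_zero i (hadm.eta_ne P.m_pos P.n_pos P.pow_t)
  have := U.smul_mem (η ^ (i : ℕ))⁻¹ h1
  rw [smul_smul, inv_mul_cancel₀ hη, one_smul] at this
  rw [hbs]; exact this

lemma exists_chain_model (P : Pres a b m n s t) (hadm : IsAdm m n s t f α η) :
    ∃ (ρ : G →* Module.End K (Fin f → K)) (E : ℕ → Fin f → K)
      (bs : Module.Basis (Fin f) K (Fin f → K)), IsChain (ρ a) (ρ b) t f α η E ∧
      ∀ i : Fin f, bs i = E i := by
  have hfn := hadm.f_dvd P.pow_t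
  have hf : 0 < f := Nat.pos_of_dvd_of_pos hfn P.n_pos
  let bs := Pi.basisFun K (Fin f)
  let E : ℕ → Fin f → K := fun i => η ^ (i / f) • bs ⟨i % f, Nat.mod_lt _ hf⟩
  have hbs : ∀ i : Fin f, bs i = E i := by
    intro i
    have e1 : (⟨(i : ℕ) % f, Nat.mod_lt _ hf⟩ : Fin f) = i := by
      ext; simp [Nat.mod_eq_of_lt i.2]
    simp only [E, e1, Nat.div_eq_of_lt i.2, pow_zero, one_smul]
  have hE : ∀ i, E i = η ^ (i / f) • E (i % f) := by
    intro i
    simp [E, Nat.div_eq_of_lt (Nat.mod_lt i hf)]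
  have hwrap : ∀ i, E (i + f) = η • E i := by
    intro i
    simp only [E, Nat.add_mod_right, Nat.add_div_right _ hf, smul_smul, pow_succ']
  clear_value E
  have hperiod : ∀ i, α ^ (t ^ (i % f)) = α ^ (t ^ i) := by
    intro i
    have h2 : ∀ q, α ^ (t ^ (f * q)) = α := fun q => (hadm.per _).2 (dvd_mul_right _ _)
    conv_rhs => rw [← Nat.mod_add_div i f]
    rw [pow_add, mul_comm, pow_mul, h2]
  let A := bs.constr K (fun i : Fin f => α ^ (t ^ (i : ℕ)) • E i)
  let B := bs.constr K (fun i : Fin f => E (i + 1))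
  have hA : ∀ i, A (E i) = α ^ (t ^ i) • E i := by
    intro i
    have h1 : E (i % f) = bs ⟨i % f, Nat.mod_lt _ hf⟩ := (hbs ⟨i % f, Nat.mod_lt _ hf⟩).symm
    have h2 : A (bs ⟨i % f, Nat.mod_lt _ hf⟩) = _ := bs.constr_basis K _ _
    rw [hE i, map_smul, h1, h2, smul_comm]
    simp only [hperiod, h1]
  have hB : ∀ i, B (E i) = E (i + 1) := by
    intro i
    have h1 : E (i % f) = bs ⟨i % f, Nat.mod_lt _ hf⟩ := (hbs ⟨i % f, Nat.mod_lt _ hf⟩).symm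
    have h2 : B (bs ⟨i % f, Nat.mod_lt _ hf⟩) = _ := bs.constr_basis K _ _
    rw [hE i, map_smul, h1, h2]
    have h3 : ∀ q, E (i % f + 1 + f * q) = η ^ q • E (i % f + 1) := by
      intro q
      induction q with
      | zero => simp
      | succ k ih => rw [mul_add, mul_one, ← add_assoc, hwrap, ih, smul_smul, pow_succ']
    rw [← h3]
    congr 1
    have := Nat.mod_add_div i f
    omega
  have hch : IsChain A B t f α η E := ⟨hA, hB, hwrap⟩
  have hext : ∀ S T : Module.End K (Fin f → K), (∀ i, S (E i) = T (E i)) → S = T := by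
    intro S T h
    apply bs.ext
    intro i
    rw [hbs]; exact h i
  have hst : ∀ i, s * t ^ i ≡ s [MOD m] := by
    intro i
    induction i with
    | zero => simp [Nat.ModEq.refl]
    | succ k ih => rw [pow_succ, ← mul_assoc]; exact (ih.mul_right t).trans P.fix
  obtain ⟨ρ, hρ⟩ := exists_hom_of_relations P (A := A) (B := B)
    (hext _ _ fun i => by
      rw [hch.actA_pow, pow_mul, hadm.pow_m, one_pow, one_smul]; rfl)
    (hext _ _ fun i => by
      obtain ⟨q, hq⟩ := hfn
      rw [hch.actA_pow, hch.actB_pow, hq, hch.wrap_mul,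
        pow_eq_of_modEq hadm.pow_m (hst i), ← hadm.pow_eta, hq,
        Nat.mul_div_cancel_left _ hf])
    (hext _ _ fun i => by
      rw [Module.End.mul_apply, Module.End.mul_apply, hch.actA_pow, LinearMap.map_smul,
        hch.actB, hch.actA]
      congr 2; ring)
  refine ⟨ρ, E, bs, ?_, hbs⟩
  have ha : ρ a = A := by simpa using hρ 1 0
  have hb : ρ b = B := by simpa using hρ 0 1
  rw [ha, hb]
  exact hch

lemma exists_chain_of_irred [FiniteDimensional K V] [Nontrivial V] (P : Pres a b m n s t) {ζ : K}
    (hζ : IsPrimitiveRoot ζ (m * n)) (ρ : G →* Module.End K V) (hρ : Irred ρ) :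
    ∃ (f : ℕ) (α η : K) (E : ℕ → V) (bs : Module.Basis (Fin f) K V),
      IsAdm m n s t f α η ∧ IsChain (ρ a) (ρ b) t f α η E ∧ ∀ i : Fin f, bs i = E i := by
  have hN : ∀ g, (ρ g) ^ (m * n) = 1 := fun g => by rw [← map_pow, P.pow_card, map_one]
  obtain ⟨v, -, hv0, α, hα⟩ := exists_eigenvector P.N_pos hζ (ρ a) (hN a) ⊤ (by simp) top_ne_bot
  have hapow : ∀ (β : K) (w : V), ρ a w = β • w → ∀ x : ℕ, (ρ a ^ x) w = β ^ x • w := by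
    intro β w hw x
    induction x with
    | zero => simp
    | succ k ih => rw [pow_succ', Module.End.mul_apply, ih, map_smul, hw, smul_smul, pow_succ]
  have hαm : α ^ m = 1 := by
    have h1 := hapow α v hα m
    rw [← map_pow, P.ord_pow, map_one, Module.End.one_apply] at h1
    exact (smul_left_injective K hv0 (by simpa using h1)).symm
  have hα0 : α ≠ 0 := by rintro rfl; simp [P.m_pos.ne'] at hαm
  have hord : orderOf α ∣ m := orderOf_dvd_of_pow_eq_one hαm
  have htu : Nat.Coprime t (orderOf α) := Nat.Coprime.coprime_dvd_right hord P.cop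
  let f := orderOf (ZMod.unitOfCoprime t htu)
  have hper : ∀ i, α ^ (t ^ i) = α ↔ f ∣ i := by
    intro i
    rw [orderOf_dvd_iff_pow_eq_one, ← Units.val_inj]
    simp only [Units.val_pow_eq_pow_val, ZMod.coe_unitOfCoprime, Units.val_one]
    have h1 : ((t : ZMod (orderOf α)) ^ i = 1) ↔ t ^ i ≡ 1 [MOD orderOf α] := by
      rw [← ZMod.natCast_eq_natCast_iff]; simp
    have hfin : IsOfFinOrder α := isOfFinOrder_iff_pow_eq_one.2 ⟨m, P.m_pos, hαm⟩
    rw [h1, ← hfin.pow_eq_pow_iff_modEq, pow_one]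
  have hfn : f ∣ n := by
    rw [← hper]
    have := pow_eq_of_modEq hαm P.pow_t
    rwa [pow_one] at this
  have hf : 0 < f := Nat.pos_of_dvd_of_pos hfn P.n_pos
  have hcomm : ∀ y, ρ a * ρ b ^ y = ρ b ^ y * ρ a ^ (t ^ y) := by
    intro y
    have := pow_mul_pow_comm (A := ρ a) (B := ρ b) (t := t)
      (by rw [← map_mul, P.comm, map_mul, map_pow]) 1 y
    simpa using this
  let U : Submodule K V := Module.End.eigenspace (ρ a) α
  have hUmem : ∀ w, w ∈ U ↔ ρ a w = α • w := fun w => Module.End.mem_eigenspace_iff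
  obtain ⟨w, hwU, hw0, η, hη⟩ := exists_eigenvector P.N_pos hζ (ρ b ^ f)
    (by rw [← pow_mul, mul_comm, pow_mul, hN, one_pow]) U
    (by
      intro w hw
      rw [hUmem] at hw ⊢
      rw [← Module.End.mul_apply, hcomm, Module.End.mul_apply, hapow α w hw,
        (hper f).2 dvd_rfl, map_smul])
    (by
      intro h
      have : v ∈ U := (hUmem v).2 hα
      rw [h] at this
      exact hv0 (by simpa using this))
  rw [hUmem] at hwU
  let E : ℕ → V := fun i => (ρ b ^ i) w
  have hch : IsChain (ρ a) (ρ b) t f α η E := by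
    refine ⟨fun i => ?_, fun i => ?_, fun i => ?_⟩
    · simp only [E]
      rw [← Module.End.mul_apply, hcomm, Module.End.mul_apply, hapow α w hwU, map_smul]
    · simp only [E]; rw [pow_succ', Module.End.mul_apply]
    · simp only [E]; rw [pow_add, Module.End.mul_apply, hη, map_smul]
  have hE0 : ∀ i, E i ≠ 0 := by
    intro i h
    have h1 : (ρ b⁻¹ ^ i) (E i) = w := by
      simp only [E]
      rw [← Module.End.mul_apply, ← map_pow, ← map_pow, ← map_mul]; simp
    rw [h, map_zero] at h1
    exact hw0 h1.symm
  have hadm : IsAdm m n s t f α η := by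
    refine ⟨hαm, hper, ?_⟩
    have h1 := hch.wrap_mul (n / f) 0
    rw [Nat.mul_div_cancel' hfn, ← hch.actB_pow, ← map_pow, P.pow_n, map_pow, hch.actA_pow] at h1
    simp only [pow_zero, mul_one] at h1
    exact (smul_left_injective K (hE0 0) h1).symm
  have hli : LinearIndependent K (fun i : Fin f => E i) := by
    refine Module.End.eigenvectors_linearIndependent' (ρ a) (fun i : Fin f => α ^ (t ^ (i : ℕ)))
      ?_ _ ?_
    · intro i j hij
      have := pow_pow_inj P.cop P.m_pos hαm hper hij
      ext
      rwa [Nat.ModEq, Nat.mod_eq_of_lt i.2, Nat.mod_eq_of_lt j.2] at this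
    · intro i
      exact ⟨Module.End.mem_eigenspace_iff.2 (hch.actA i), hE0 i⟩
  have hspan : Submodule.span K (Set.range fun i : Fin f => E i) = ⊤ := by
    have hall : ∀ i, E i ∈ Submodule.span K (Set.range fun i : Fin f => E i) := by
      intro i
      rw [hch.reduce]
      exact Submodule.smul_mem _ _ (Submodule.subset_span ⟨⟨i % f, Nat.mod_lt _ hf⟩, rfl⟩)
    have hinv : ∀ g, ∀ u ∈ Submodule.span K (Set.range fun i : Fin f => E i),
        ρ g u ∈ Submodule.span K (Set.range fun i : Fin f => E i) := by
      intro g u hu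
      obtain ⟨x, y, rfl⟩ := P.cover g
      rw [← Submodule.mem_comap]
      revert u
      change Submodule.span K _ ≤ _
      rw [Submodule.span_le]
      rintro _ ⟨i, rfl⟩
      simp only [Submodule.comap_coe, Set.mem_preimage, SetLike.mem_coe]
      rw [map_mul, map_pow, map_pow, Module.End.mul_apply, hch.actA_pow, map_smul, hch.actB_pow]
      exact Submodule.smul_mem _ _ (hall _)
    refine (hρ _ hinv).resolve_left ?_
    intro h
    have := hall 0
    rw [h] at this
    exact hE0 0 (by simpa using this)
  refine ⟨f, α, η, E, Module.Basis.mk hli hspan.ge, hadm, hch, fun i => ?_⟩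
  simp

end Rep

section Count

variable {G : Type*} [Group G] {K : Type*} [Field K]
variable {m n s t f j : ℕ} {α η α' η' : K} {a b : G} {χ χ' : G → K}

lemma IsCh.unique (P : Pres a b m n s t) (h : IsCh a b t f α η χ) (h' : IsCh a b t f α η χ') :
    χ = χ' := by
  funext g
  obtain ⟨x, y, rfl⟩ := P.cover g
  rw [h, h']

lemma IsAdm.twist (P : Pres a b m n s t) (hadm : IsAdm m n s t f α η) (h : IsCh a b t f α η χ)
    (i : ℕ) : IsAdm m n s t f (α ^ (t ^ i)) η ∧ IsCh a b t f (α ^ (t ^ i)) η χ := by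
  induction i with
  | zero => simpa using ⟨hadm, h⟩
  | succ k ih =>
    obtain ⟨hadm, h⟩ := ih
    have e : α ^ (t ^ (k + 1)) = (α ^ (t ^ k)) ^ t := by rw [← pow_mul, pow_succ]
    rw [e]
    generalize α ^ (t ^ k) = β at *
    refine ⟨⟨?_, ?_, ?_⟩, ?_⟩
    · rw [← pow_mul, mul_comm, pow_mul, hadm.pow_m, one_pow]
    · intro i
      constructor
      · intro hi
        have h1 : β ^ (t ^ (i + 1)) = β ^ (t ^ 1) := by
          rw [← pow_mul] at hi
          rw [pow_succ', hi, pow_one]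
        have := pow_pow_inj P.cop P.m_pos hadm.pow_m hadm.per h1
        have h2 : i + 1 ≡ 0 + 1 [MOD f] := this
        exact (Nat.modEq_zero_iff_dvd).1 (Nat.ModEq.add_right_cancel' 1 h2)
      · intro hi
        rw [← pow_mul, mul_comm, pow_mul, (hadm.per i).2 hi]
    · rw [hadm.pow_eta, ← pow_mul, mul_comm]
      exact (pow_eq_of_modEq hadm.pow_m P.fix).symm
    · intro x y
      rw [h]
      congr 2
      have h1 := Finset.sum_range_succ (fun i => β ^ (x * t ^ i)) f
      rw [Finset.sum_range_succ'] at h1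
      have h2 : β ^ (x * t ^ f) = β ^ (x * t ^ 0) := by
        rw [mul_comm, pow_mul, (hadm.per f).2 dvd_rfl]; simp
      rw [h2] at h1
      rw [← add_right_cancel h1]
      refine Finset.sum_congr rfl fun i _ => ?_
      rw [← pow_mul]
      congr 1; ring

lemma sum_pow_eq (c : K) (hc : c ^ m = 1) :
    ∑ x ∈ Finset.range m, c ^ x = if c = 1 then (m : K) else 0 := by
  split_ifs with h
  · subst h; simp
  · have := geom_sum_mul c m
    rw [hc, sub_self] at this
    exact (mul_eq_zero.1 this).resolve_right (sub_ne_zero.2 h)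

lemma IsCh.inj [CharZero K] (P : Pres a b m n s t) (hadm : IsAdm m n s t f α η)
    (hadm' : IsAdm m n s t f α' η') (h : IsCh a b t f α η χ) (h' : IsCh a b t f α' η' χ) :
    η' = η ∧ ∃ i, i < f ∧ α' = α ^ (t ^ i) := by
  have hf : 0 < f := Nat.pos_of_dvd_of_pos (hadm.f_dvd P.pow_t) P.n_pos
  have hα0 := hadm.alpha_ne P.m_pos
  have hα'0 := hadm'.alpha_ne P.m_pos
  have key : ∀ (β ξ : K), IsAdm m n s t f β ξ → IsCh a b t f β ξ χ →
      ∑ x ∈ Finset.range m, (α'⁻¹) ^ x * χ (b ^ 0 * a ^ x) =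
        ∑ i ∈ Finset.range f, if β ^ (t ^ i) = α' then (m : K) else 0 := by
    intro β ξ hadmβ hβ
    have : ∀ x, (α'⁻¹) ^ x * χ (b ^ 0 * a ^ x) =
        ∑ i ∈ Finset.range f, (α'⁻¹ * β ^ (t ^ i)) ^ x := by
      intro x
      rw [hβ, if_pos (dvd_zero _), Nat.zero_div, pow_zero, one_mul, Finset.mul_sum]
      refine Finset.sum_congr rfl fun i _ => ?_
      rw [mul_pow, ← pow_mul, mul_comm x]
    rw [Finset.sum_congr rfl fun x _ => this x, Finset.sum_comm]
    refine Finset.sum_congr rfl fun i _ => ?_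
    rw [sum_pow_eq]
    · congr 1
      rw [inv_mul_eq_one₀ hα'0]
      exact propext eq_comm
    · rw [mul_pow, inv_pow, hadm'.pow_m, ← pow_mul, mul_comm (t ^ i), pow_mul, hadmβ.pow_m]; simp
  constructor
  · have h1 := h 0 f
    rw [h' 0 f] at h1
    simp only [dvd_refl, if_true, Nat.div_self hf, pow_one, zero_mul, pow_zero, Finset.sum_const,
      Finset.card_range, nsmul_eq_mul, mul_one] at h1
    exact mul_right_cancel₀ (Nat.cast_ne_zero.2 hf.ne') h1
  · have h1 := (key _ _ hadm h).symm.trans (key _ _ hadm' h')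
    by_contra hne
    push Not at hne
    have h2 : ∀ i ∈ Finset.range f, (if α ^ (t ^ i) = α' then (m : K) else 0) = 0 := by
      intro i hi
      rw [if_neg]
      exact fun h => hne i (Finset.mem_range.1 hi) h.symm
    rw [Finset.sum_eq_zero h2] at h1
    have h3 : ∀ i ∈ Finset.range f, (if α' ^ (t ^ i) = α' then (m : K) else 0) =
        ((if α' ^ (t ^ i) = α' then m else 0 : ℕ) : K) := by
      intro i _; split_ifs <;> simp
    rw [Finset.sum_congr rfl h3, ← Nat.cast_sum, eq_comm, Nat.cast_eq_zero,
      Finset.sum_eq_zero_iff] at h1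
    have := h1 0 (Finset.mem_range.2 hf)
    simp at this
    exact P.m_pos.ne' this

/-- Characters of irreducible representations of degree `f`. -/
def IrrCh (G : Type*) [Group G] (K : Type*) [Field K] (f : ℕ) : Set (G → K) :=
  {χ | ∃ ρ : G →* Module.End K (Fin f → K), Irred ρ ∧ χ = fun g => LinearMap.trace K _ (ρ g)}

lemma mem_irrCh_iff (P : Pres a b m n s t) {ζ : K} (hζ : IsPrimitiveRoot ζ (m * n)) (hf : 0 < f) :
    χ ∈ IrrCh G K f ↔ ∃ α η : K, IsAdm m n s t f α η ∧ IsCh a b t f α η χ := by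
  constructor
  · rintro ⟨ρ, hρ, rfl⟩
    have : Nonempty (Fin f) := ⟨⟨0, hf⟩⟩
    obtain ⟨f', α, η, E, bs, hadm, hch, hbs⟩ := exists_chain_of_irred P hζ ρ hρ
    have : f' = f := by
      have h1 := Module.finrank_eq_card_basis bs
      simpa using h1.symm
    subst this
    exact ⟨α, η, hadm, hch.isCh bs hbs⟩
  · rintro ⟨α, η, hadm, hch⟩
    obtain ⟨ρ, E, bs, hE, hbs⟩ := exists_chain_model P hadm
    exact ⟨ρ, hE.irred P hadm hζ bs hbs, hch.unique P (hE.isCh bs hbs)⟩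

lemma exists_isCh (P : Pres a b m n s t) (hadm : IsAdm m n s t f α η) :
    ∃ χ : G → K, IsCh a b t f α η χ := by
  obtain ⟨ρ, E, bs, hE, hbs⟩ := exists_chain_model P hadm
  exact ⟨_, hE.isCh bs hbs⟩

lemma IsAdm.pow_N (P : Pres a b m n s t) (hadm : IsAdm m n s t f α η) :
    α ^ (m * n) = 1 ∧ η ^ (m * n) = 1 := by
  constructor
  · rw [pow_mul, hadm.pow_m, one_pow]
  · obtain ⟨q, hq⟩ := hadm.f_dvd P.pow_t
    have hf : 0 < f := Nat.pos_of_dvd_of_pos (hadm.f_dvd P.pow_t) P.n_pos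
    have h := hadm.pow_eta
    rw [hq, Nat.mul_div_cancel_left _ hf] at h
    rw [hq, show m * (f * q) = q * (m * f) by ring, pow_mul, h, ← pow_mul,
      show s * (m * f) = m * (s * f) by ring, pow_mul, hadm.pow_m, one_pow]

lemma conj_fixed_iff [CharZero K] (P : Pres a b m n s t) {ζ : K}
    (hζ : IsPrimitiveRoot ζ (m * n)) (σ : K ≃+* K) (hσ : σ ζ = ζ ^ j)
    (hadm : IsAdm m n s t f α η) (h : IsCh a b t f α η χ) :
    (fun g => σ (χ g)) = χ ↔ (∃ i, α ^ j = α ^ (t ^ i)) ∧ η ^ j = η := by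
  have := NeZero.mk P.N_pos.ne'
  have hσ' : ∀ β : K, β ^ (m * n) = 1 → σ β = β ^ j := by
    intro β hβ
    obtain ⟨k, -, rfl⟩ := hζ.eq_pow_of_pow_eq_one hβ
    rw [map_pow, hσ, ← pow_mul, ← pow_mul, mul_comm]
  have h1 : IsCh a b t f (σ α) (σ η) (fun g => σ (χ g)) := by
    intro x y
    simp only
    rw [h]
    split_ifs <;> simp
  have h2 : IsAdm m n s t f (σ α) (σ η) := by
    refine ⟨?_, ?_, ?_⟩
    · rw [← map_pow, hadm.pow_m, map_one]
    · intro i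
      rw [← map_pow, σ.injective.eq_iff, hadm.per]
    · rw [← map_pow, hadm.pow_eta, map_pow]
  rw [← hσ' _ (hadm.pow_N P).1, ← hσ' _ (hadm.pow_N P).2]
  constructor
  · intro heq
    rw [heq] at h1
    obtain ⟨h3, i, -, h4⟩ := h.inj P hadm h2 h1
    exact ⟨⟨i, h4⟩, h3⟩
  · rintro ⟨⟨i, hi⟩, hη⟩
    rw [hi, hη] at h1
    exact h1.unique P (hadm.twist P h i).2

/-- The admissible pairs whose character is stable under raising roots of unity to the `j`. -/
def fixedPairs (K : Type*) [Field K] (m n s t f j : ℕ) : Finset (K × K) :=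
  (Polynomial.nthRootsFinset m (1 : K) ×ˢ Polynomial.nthRootsFinset (m * n) (1 : K)).filter
    fun p => (∀ i, p.1 ^ (t ^ i) = p.1 ↔ f ∣ i) ∧ (∃ i, p.1 ^ j = p.1 ^ (t ^ i)) ∧
      p.2 ^ (n / f) = p.1 ^ s ∧ p.2 ^ j = p.2

lemma mem_fixedPairs (P : Pres a b m n s t) {p : K × K} :
    p ∈ fixedPairs K m n s t f j ↔
      IsAdm m n s t f p.1 p.2 ∧ (∃ i, p.1 ^ j = p.1 ^ (t ^ i)) ∧ p.2 ^ j = p.2 := by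
  rw [fixedPairs, Finset.mem_filter, Finset.mem_product, Polynomial.mem_nthRootsFinset P.m_pos,
    Polynomial.mem_nthRootsFinset P.N_pos]
  constructor
  · rintro ⟨⟨h1, h2⟩, h3, h4, h5, h6⟩
    exact ⟨⟨h1, h3, h5⟩, h4, h6⟩
  · rintro ⟨h, h4, h6⟩
    exact ⟨⟨h.pow_m, (h.pow_N P).2⟩, h.per, h4, h.pow_eta, h6⟩

lemma card_fixedPairs [CharZero K] (P : Pres a b m n s t) {ζ : K}
    (hζ : IsPrimitiveRoot ζ (m * n)) (σ : K ≃+* K) (hσ : σ ζ = ζ ^ j) (hf : 0 < f) :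
    (fixedPairs K m n s t f j).card =
      {χ | χ ∈ IrrCh G K f ∧ (fun g => σ (χ g)) = χ}.ncard * f := by
  have hex : ∀ p : K × K, ∃ χ : G → K, p ∈ fixedPairs K m n s t f j →
      IsCh a b t f p.1 p.2 χ := by
    intro p
    by_cases hp : p ∈ fixedPairs K m n s t f j
    · obtain ⟨χ, h⟩ := exists_isCh P ((mem_fixedPairs P).1 hp).1
      exact ⟨χ, fun _ => h⟩
    · exact ⟨fun _ => 0, fun h => absurd h hp⟩
  choose F hF using hex
  have himg : {χ | χ ∈ IrrCh G K f ∧ (fun g => σ (χ g)) = χ} =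
      (((fixedPairs K m n s t f j).image F : Finset (G → K)) : Set (G → K)) := by
    ext χ
    rw [Set.mem_ofPred_eq, mem_irrCh_iff P hζ hf, Finset.mem_coe, Finset.mem_image]
    constructor
    · rintro ⟨⟨α, η, hadm, hch⟩, hfix⟩
      have hp : (α, η) ∈ fixedPairs K m n s t f j :=
        (mem_fixedPairs P).2 ⟨hadm, (conj_fixed_iff P hζ σ hσ hadm hch).1 hfix⟩
      exact ⟨(α, η), hp, (hF _ hp).unique P hch⟩
    · rintro ⟨p, hp, rfl⟩
      obtain ⟨h1, h2⟩ := (mem_fixedPairs P).1 hp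
      exact ⟨⟨p.1, p.2, h1, hF p hp⟩, (conj_fixed_iff P hζ σ hσ h1 (hF p hp)).2 h2⟩
  rw [himg, Set.ncard_coe_finset, Finset.card_eq_sum_card_image F]
  refine Finset.sum_const_nat fun χ hχ => ?_
  obtain ⟨p, hp, rfl⟩ := Finset.mem_image.1 hχ
  obtain ⟨hadm, ⟨i0, hi0⟩, hη⟩ := (mem_fixedPairs P).1 hp
  have hfib : ((fixedPairs K m n s t f j).filter fun q => F q = F p) =
      (Finset.range f).image fun i => (p.1 ^ (t ^ i), p.2) := by
    ext q
    rw [Finset.mem_filter, Finset.mem_image]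
    constructor
    · rintro ⟨hq, hqp⟩
      have h1 := hF q hq
      rw [hqp] at h1
      obtain ⟨h2, i, hi, h3⟩ := (hF p hp).inj P hadm ((mem_fixedPairs P).1 hq).1 h1
      exact ⟨i, Finset.mem_range.2 hi, by ext <;> simp [h2, h3]⟩
    · rintro ⟨i, -, rfl⟩
      have h1 := hadm.twist P (hF p hp) i
      have h2 : (p.1 ^ (t ^ i), p.2) ∈ fixedPairs K m n s t f j := by
        refine (mem_fixedPairs P).2 ⟨h1.1, ⟨i0, ?_⟩, hη⟩
        rw [← pow_mul, mul_comm, pow_mul, hi0, ← pow_mul, mul_comm, pow_mul]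
      exact ⟨h2, (hF _ h2).unique P h1.2⟩
  rw [hfib, Finset.card_image_of_injOn, Finset.card_range]
  intro i hi i' hi' h
  have := pow_pow_inj P.cop P.m_pos hadm.pow_m hadm.per (congrArg Prod.fst h)
  rw [Finset.mem_coe, Finset.mem_range] at hi hi'
  rwa [Nat.ModEq, Nat.mod_eq_of_lt hi, Nat.mod_eq_of_lt hi'] at this

end Count

section CountW

variable {K : Type*} [Field K]

lemma card_roots_pow_eq {D e : ℕ} (hD : 0 < D) {ω : K} (hω : IsPrimitiveRoot ω D) (γ : K) :
    ((Polynomial.nthRootsFinset D (1 : K)).filter fun η => η ^ e = γ).card =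
      if γ ^ (D / Nat.gcd e D) = 1 then Nat.gcd e D else 0 := by
  have hg : 0 < Nat.gcd e D := Nat.gcd_pos_of_pos_right _ hD
  obtain ⟨D', hD'⟩ := Nat.gcd_dvd_right e D
  obtain ⟨e', he'⟩ := Nat.gcd_dvd_left e D
  generalize hgd : Nat.gcd e D = g at *
  have hdiv : D / g = D' := by rw [hD', Nat.mul_div_cancel_left _ hg]
  rw [hdiv]
  have hD'0 : 0 < D' := Nat.pos_of_ne_zero (by rintro rfl; simp at hD'; omega)
  have := NeZero.mk hD'0.ne'
  split_ifs with hγ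
  · have hω' : IsPrimitiveRoot (ω ^ g) D' := hω.pow hD (by rw [hD', mul_comm, mul_comm])
    have hω'' : IsPrimitiveRoot (ω ^ D') g := hω.pow hD (by rw [hD', mul_comm])
    obtain ⟨k, -, hk⟩ := hω'.eq_pow_of_pow_eq_one hγ
    obtain ⟨u, hu⟩ : ∃ u : ℕ, (ω ^ u) ^ e = ω ^ g := by
      have h1 : ∃ u : ℕ, e * u ≡ g [MOD D] := by
        refine ⟨((Nat.gcdA e D) % D).toNat, ?_⟩
        rw [← Int.natCast_modEq_iff]
        push_cast
        rw [Int.toNat_of_nonneg (Int.emod_nonneg _ (by omega)), ← hgd, Nat.gcd_eq_gcd_ab]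
        have h2 : (e : ℤ) * (Nat.gcdA e D % D) ≡ e * Nat.gcdA e D [ZMOD D] :=
          (Int.mod_modEq _ _).mul_left _
        refine h2.trans ?_
        rw [Int.modEq_iff_dvd]
        exact ⟨Nat.gcdB e D, by ring⟩
      obtain ⟨u, hu⟩ := h1
      exact ⟨u, by rw [← pow_mul, mul_comm]; exact pow_eq_of_modEq hω.pow_eq_one hu⟩
    let η₀ := (ω ^ u) ^ k
    have hη₀ : η₀ ^ e = γ := by
      simp only [η₀]
      rw [← pow_mul, mul_comm, pow_mul, hu, hk]
    have hη₀D : η₀ ^ D = 1 := by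
      simp only [η₀]
      rw [← pow_mul, ← pow_mul, ← mul_assoc, mul_comm (u * k), pow_mul, hω.pow_eq_one, one_pow]
    have hη₀0 : η₀ ≠ 0 := by intro h; rw [h, zero_pow hD.ne'] at hη₀D; exact zero_ne_one hη₀D
    have himg : ((Polynomial.nthRootsFinset D (1 : K)).filter fun η => η ^ e = γ) =
        (Polynomial.nthRootsFinset g (1 : K)).image fun ξ => η₀ * ξ := by
      ext η
      rw [Finset.mem_filter, Finset.mem_image, Polynomial.mem_nthRootsFinset hD]
      constructor
      · rintro ⟨h1, h2⟩
        refine ⟨η₀⁻¹ * η, ?_, by rw [mul_inv_cancel_left₀ hη₀0]⟩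
        rw [Polynomial.mem_nthRootsFinset hg, ← hgd]
        have hγ0 : γ ≠ 0 := by rw [← hη₀]; exact pow_ne_zero _ hη₀0
        exact pow_gcd_eq_one.2 ⟨by rw [mul_pow, inv_pow, hη₀, h2, inv_mul_cancel₀ hγ0],
          by rw [mul_pow, inv_pow, hη₀D, h1]; simp⟩
      · rintro ⟨ξ, hξ, rfl⟩
        rw [Polynomial.mem_nthRootsFinset hg] at hξ
        constructor
        · rw [mul_pow, hη₀D, hD', pow_mul, hξ]; simp
        · rw [mul_pow, hη₀, he', pow_mul, hξ]; simp
    rw [himg, Finset.card_image_of_injective _ (mul_right_injective₀ hη₀0)]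
    exact hω''.card_nthRootsFinset
  · rw [Finset.card_eq_zero, Finset.filter_eq_empty_iff]
    intro η hη h
    apply hγ
    rw [Polynomial.mem_nthRootsFinset hD] at hη
    rw [← h, he', ← pow_mul, show g * e' * D' = D * e' by rw [hD']; ring, pow_mul, hη, one_pow]

variable {m n s t f j : ℕ}

lemma card_fixedPairs_eq_W {ζ : K} (hζ : IsPrimitiveRoot ζ (m * n)) (hm : 0 < m) (hn : 0 < n)
    (hj : 1 ≤ j) (htn : t ^ n ≡ 1 [MOD m]) :
    (fixedPairs K m n s t f j).card = W m n s t f j := by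
  have hN : 0 < m * n := Nat.mul_pos hm hn
  set D := Nat.gcd (j - 1) (m * n) with hD
  have hD0 : 0 < D := Nat.gcd_pos_of_pos_right _ hN
  have hcond : ∀ α ∈ Polynomial.nthRootsFinset m (1 : K), ∀ i k,
      α ^ i = α ^ k ↔ i ≡ k [MOD orderOf α] := by
    intro α hα i k
    rw [Polynomial.mem_nthRootsFinset hm] at hα
    exact (isOfFinOrder_iff_pow_eq_one.2 ⟨m, hm, hα⟩).pow_eq_pow_iff_modEq
  let g : ℕ → ℕ := fun d => if IsPer t d f ∧ (∃ i, j ≡ t ^ i [MOD d]) ∧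
      d ∣ s * (D / Nat.gcd (n / f) (j - 1)) then Nat.gcd (n / f) (j - 1) else 0
  have hinner : ∀ α ∈ Polynomial.nthRootsFinset m (1 : K),
      ∑ η ∈ Polynomial.nthRootsFinset (m * n) (1 : K),
        (if (∀ i, α ^ (t ^ i) = α ↔ f ∣ i) ∧ (∃ i, α ^ j = α ^ (t ^ i)) ∧
          η ^ (n / f) = α ^ s ∧ η ^ j = η then 1 else 0) = g (orderOf α) := by
    intro α hα
    have hα' := (Polynomial.mem_nthRootsFinset hm _).1 hα
    have hper : (∀ i, α ^ (t ^ i) = α ↔ f ∣ i) ↔ IsPer t (orderOf α) f := by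
      refine forall_congr' fun i => ?_
      rw [← hcond α hα, pow_one]
    have horb : (∃ i, α ^ j = α ^ (t ^ i)) ↔ ∃ i, j ≡ t ^ i [MOD orderOf α] := by
      simp only [hcond α hα]
    rw [hper, horb]
    by_cases h1 : IsPer t (orderOf α) f
    swap
    · simp [h1, g]
    by_cases h2 : ∃ i, j ≡ t ^ i [MOD orderOf α]
    swap
    · simp only [h2, g]; simp
    have hfn : f ∣ n := (h1 n).1 (htn.of_dvd (orderOf_dvd_of_pow_eq_one hα'))
    have hgcd : Nat.gcd (n / f) D = Nat.gcd (n / f) (j - 1) := by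
      rw [hD, ← Nat.gcd_assoc]
      apply Nat.gcd_eq_left
      exact (Nat.gcd_dvd_left _ _).trans ((Nat.div_dvd_of_dvd hfn).trans (dvd_mul_left _ _))
    have hset : (Polynomial.nthRootsFinset (m * n) (1 : K)).filter
        (fun η => η ^ (n / f) = α ^ s ∧ η ^ j = η) =
        (Polynomial.nthRootsFinset D (1 : K)).filter fun η => η ^ (n / f) = α ^ s := by
      ext η
      rw [Finset.mem_filter, Finset.mem_filter, Polynomial.mem_nthRootsFinset hN,
        Polynomial.mem_nthRootsFinset hD0]
      obtain ⟨c, rfl⟩ : ∃ c, j = c + 1 := ⟨j - 1, by omega⟩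
      simp only [Nat.add_sub_cancel] at hD
      constructor
      · rintro ⟨h3, h4, h5⟩
        have hη0 : η ≠ 0 := by
          rintro rfl; rw [zero_pow hN.ne'] at h3; exact zero_ne_one h3
        refine ⟨?_, h4⟩
        rw [hD]
        refine pow_gcd_eq_one.2 ⟨?_, h3⟩
        rw [pow_succ] at h5
        exact mul_right_cancel₀ hη0 (by rw [h5, one_mul])
      · rintro ⟨h3, h4⟩
        have h6 : ∀ k, D ∣ k → η ^ k = 1 := by
          rintro k ⟨q, rfl⟩; rw [pow_mul, h3, one_pow]
        refine ⟨h6 _ (Nat.gcd_dvd_right _ _), h4, ?_⟩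
        rw [pow_succ, h6 _ (hD ▸ Nat.gcd_dvd_left _ _), one_mul]
    simp only [h1, h2, true_and]
    rw [← Finset.card_filter, hset,
      card_roots_pow_eq hD0 (hζ.pow hN (Nat.div_mul_cancel (Nat.gcd_dvd_right _ _)).symm) (α ^ s),
      hgcd]
    simp only [g, h1, h2, true_and]
    congr 1
    rw [← pow_mul, ← orderOf_dvd_iff_pow_eq_one]
  rw [fixedPairs, Finset.card_filter, Finset.sum_product, Finset.sum_congr rfl hinner,
    ← Finset.sum_fiberwise_of_maps_to (t := m.divisors) (g := fun α => orderOf α), W,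
    Finset.sum_filter]
  · refine Finset.sum_congr rfl fun d hd => ?_
    have hdm := Nat.dvd_of_mem_divisors hd
    have hd0 : 0 < d := Nat.pos_of_dvd_of_pos hdm hm
    have h1 : (Polynomial.nthRootsFinset m (1 : K)).filter (fun α => orderOf α = d) =
        primitiveRoots d K := by
      ext α
      rw [Finset.mem_filter, Polynomial.mem_nthRootsFinset hm, mem_primitiveRoots hd0]
      constructor
      · rintro ⟨-, rfl⟩; exact IsPrimitiveRoot.orderOf α
      · intro h
        refine ⟨?_, h.eq_orderOf.symm⟩
        obtain ⟨q, rfl⟩ := hdm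
        rw [pow_mul, h.pow_eq_one, one_pow]
    rw [h1, Finset.sum_congr rfl (g := fun _ => g d)]
    · rw [Finset.sum_const, smul_eq_mul]
      obtain ⟨q, hq⟩ := hdm
      have hpr : IsPrimitiveRoot (ζ ^ (q * n)) d := hζ.pow hN (by rw [hq]; ring)
      rw [hpr.card_primitiveRoots]
      simp only [g]
      split_ifs <;> simp_all
    · intro α hα
      rw [(isPrimitiveRoot_of_mem_primitiveRoots hα).eq_orderOf]
  · intro α hα
    rw [Polynomial.mem_nthRootsFinset hm] at hα
    exact Nat.mem_divisors.2 ⟨orderOf_dvd_of_pow_eq_one hα, hm.ne'⟩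

end CountW

section Alg

lemma exists_galois_aut {K : Type*} [Field K] [Algebra ℚ K] {N : ℕ} [NeZero N] [IsCyclotomicExtension {N} ℚ K] {j : ℕ}
    (hj : Nat.Coprime j N) : ∃ (ζ : K) (σ : K ≃+* K), IsPrimitiveRoot ζ N ∧ σ ζ = ζ ^ j := by
  have hζ := IsCyclotomicExtension.zeta_spec N ℚ K
  have hirr := Polynomial.cyclotomic.irreducible_rat (NeZero.pos N)
  let e := IsCyclotomicExtension.autEquivPow K hirr
  refine ⟨_, (e.symm (ZMod.unitOfCoprime j hj)).toRingEquiv, hζ, ?_⟩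
  have h1 := hζ.autToPow_spec ℚ (e.symm (ZMod.unitOfCoprime j hj))
  have h2 : hζ.autToPow ℚ (e.symm (ZMod.unitOfCoprime j hj)) = ZMod.unitOfCoprime j hj :=
    e.apply_symm_apply _
  rw [h2] at h1
  refine h1.symm.trans ?_
  rw [ZMod.coe_unitOfCoprime, ZMod.val_natCast]
  exact pow_eq_of_modEq hζ.pow_eq_one (Nat.mod_modEq _ _)

lemma exists_galois_field {N : ℕ} (hN : 0 < N) {j : ℕ} (hj : Nat.Coprime j N) :
    ∃ (K : Type) (_ : Field K) (_ : CharZero K) (ζ : K) (σ : K ≃+* K),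
      IsPrimitiveRoot ζ N ∧ σ ζ = ζ ^ j := by
  have := NeZero.mk hN.ne'
  refine ⟨CyclotomicField N ℚ, inferInstance, inferInstance, ?_⟩
  exact @exists_galois_aut (CyclotomicField N ℚ) _ (CyclotomicField.algebra N ℚ) N _
    (CyclotomicField.isCyclotomicExtension N ℚ) j hj

variable {K : Type*} [Field K] [CharZero K]

/-- Traces of degree `f` irreducible representations of a `ℚ`-algebra over `K` fixed by `σ`. -/
def IrrTr (A : Type*) [Ring A] [Algebra ℚ A] (σ : K ≃+* K) (f : ℕ) : Set (A →ₗ[ℚ] K) :=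
  {χ | (∃ ρ : A →ₐ[ℚ] Module.End K (Fin f → K),
    (∀ U : Submodule K (Fin f → K), (∀ x, ∀ v ∈ U, ρ x v ∈ U) → U = ⊥ ∨ U = ⊤) ∧
    ∀ x, χ x = LinearMap.trace K _ (ρ x)) ∧ ∀ x, σ (χ x) = χ x}

lemma ncard_irrTr_congr {A B : Type*} [Ring A] [Algebra ℚ A] [Ring B] [Algebra ℚ B]
    (e : A ≃ₐ[ℚ] B) (σ : K ≃+* K) (f : ℕ) :
    (IrrTr A σ f).ncard = (IrrTr B σ f).ncard := by
  have h : IrrTr A σ f = (fun χ : B →ₗ[ℚ] K => χ ∘ₗ e.toLinearMap) '' IrrTr B σ f := by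
    ext χ
    constructor
    · rintro ⟨⟨ρ, hρ, hχ⟩, hσ⟩
      refine ⟨χ ∘ₗ e.symm.toLinearMap, ⟨⟨ρ.comp (e.symm : B →ₐ[ℚ] A), ?_, ?_⟩, ?_⟩, ?_⟩
      · intro U hU
        refine hρ U fun x v hv => ?_
        simpa using hU (e x) v hv
      · intro x; simp [hχ]
      · intro x; simp [hσ]
      · ext x; simp
    · rintro ⟨χ, ⟨⟨ρ, hρ, hχ⟩, hσ⟩, rfl⟩
      refine ⟨⟨ρ.comp (e : A →ₐ[ℚ] B), ?_, ?_⟩, ?_⟩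
      · intro U hU
        refine hρ U fun x v hv => ?_
        simpa using hU (e.symm x) v hv
      · intro x; simp [hχ]
      · intro x; simp [hσ]
  rw [h, Set.ncard_image_of_injective]
  intro χ χ' hχ
  ext x
  simpa using LinearMap.congr_fun hχ (e.symm x)

lemma ncard_irrTr_monoidAlgebra {G : Type*} [Group G] (σ : K ≃+* K) (f : ℕ) :
    {χ | χ ∈ IrrCh G K f ∧ (fun g => σ (χ g)) = χ}.ncard =
      (IrrTr (MonoidAlgebra ℚ G) σ f).ncard := by
  have h : {χ | χ ∈ IrrCh G K f ∧ (fun g => σ (χ g)) = χ} =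
      (fun χ : MonoidAlgebra ℚ G →ₗ[ℚ] K => fun g => χ (MonoidAlgebra.of ℚ G g)) ''
        IrrTr (MonoidAlgebra ℚ G) σ f := by
    ext χ
    constructor
    · rintro ⟨⟨ρ, hρ, rfl⟩, hσ⟩
      let R := MonoidAlgebra.lift ℚ (Module.End K (Fin f → K)) G ρ
      have hR : ∀ g, R (MonoidAlgebra.of ℚ G g) = ρ g := fun g =>
        MonoidAlgebra.lift_of _ _
      let T : MonoidAlgebra ℚ G →ₗ[ℚ] K :=
        ((LinearMap.trace K (Fin f → K)).restrictScalars ℚ) ∘ₗ R.toLinearMap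
      refine ⟨T, ⟨⟨R, ?_, fun x => rfl⟩, ?_⟩, ?_⟩
      · intro U hU
        refine hρ U fun g v hv => ?_
        rw [← hR]; exact hU _ v hv
      · have : (σ : K →+ K).toRatLinearMap ∘ₗ T = T := by
          apply MonoidAlgebra.lhom_ext'
          intro g
          ext
          have := congrFun hσ g
          simp only [← hR] at this
          exact this
        exact fun x => LinearMap.congr_fun this x
      · funext g
        simp only [T, LinearMap.comp_apply, AlgHom.toLinearMap_apply, hR]
        rfl
    · rintro ⟨T, ⟨⟨R, hR, hT⟩, hσ⟩, rfl⟩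
      refine ⟨⟨(R : MonoidAlgebra ℚ G →* _).comp (MonoidAlgebra.of ℚ G), ?_, ?_⟩, ?_⟩
      · intro U hU
        refine hR U fun x v hv => ?_
        induction x using MonoidAlgebra.induction_on with
        | of g => exact hU g v hv
        | add x y hx hy => rw [map_add]; exact U.add_mem hx hy
        | smul q x hx =>
          rw [map_smul]
          have : (q • R x) v = (q : K) • R x v := by
            rw [LinearMap.smul_apply, Rat.cast_smul_eq_qsmul]
          rw [this]
          exact U.smul_mem _ hx
      · funext g; exact hT _
      · funext g; exact hσ _
  rw [h, Set.ncard_image_of_injective]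
  intro χ χ' hχ
  apply MonoidAlgebra.lhom_ext'
  intro g
  ext
  exact congrFun hχ g

lemma finrank_monoidAlgebra (G : Type*) [Group G] [Finite G] :
    Module.finrank ℚ (MonoidAlgebra ℚ G) = Nat.card G := by
  have := Fintype.ofFinite G
  rw [Nat.card_eq_fintype_card, (MonoidAlgebra.coeffLinearEquiv ℚ).finrank_eq]
  exact Module.finrank_finsupp_self ℚ

lemma W_eq_of_iso {G H : Type*} [Group G] [Group H] {a b : G} {c d : H}
    {m n s t m' n' s' t' : ℕ} (P : Pres a b m n s t) (Q : Pres c d m' n' s' t')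
    (e : MonoidAlgebra ℚ G ≃ₐ[ℚ] MonoidAlgebra ℚ H) :
    m * n = m' * n' ∧ ∀ f j, 0 < f → 1 ≤ j → Nat.Coprime j (m * n) →
      W m n s t f j = W m' n' s' t' f j := by
  have hcard : m * n = m' * n' := by
    have : Finite G := Nat.finite_of_card_ne_zero (by rw [P.card]; exact P.N_pos.ne')
    have : Finite H := Nat.finite_of_card_ne_zero (by rw [Q.card]; exact Q.N_pos.ne')
    rw [← P.card, ← Q.card, ← finrank_monoidAlgebra, ← finrank_monoidAlgebra,
      e.toLinearEquiv.finrank_eq]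
  refine ⟨hcard, fun f j hf hj hjN => ?_⟩
  obtain ⟨K, _, _, ζ, σ, hζ, hσ⟩ := exists_galois_field P.N_pos hjN
  rw [← card_fixedPairs_eq_W hζ P.m_pos P.n_pos hj P.pow_t, card_fixedPairs P hζ σ hσ hf,
    ncard_irrTr_monoidAlgebra, ncard_irrTr_congr e, ← ncard_irrTr_monoidAlgebra]
  rw [hcard] at hζ
  rw [← card_fixedPairs_eq_W hζ Q.m_pos Q.n_pos hj Q.pow_t, card_fixedPairs Q hζ σ hσ hf]

end Alg

/-- The arithmetic constraints on the invariants of a metacyclic presentation. -/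
structure Arith (m n s t : ℕ) : Prop where
  n_pos : 0 < n
  m_pos : 0 < m
  s_dvd : s ∣ m
  cop : Nat.Coprime t m
  pow_t : t ^ n ≡ 1 [MOD m]
  fix : s * t ≡ s [MOD m]
  two_le : 2 ≤ t

section Per

variable {t d f f' e : ℕ}

lemma IsPer.unique (h : IsPer t d f) (h' : IsPer t d f') : f = f' :=
  Nat.dvd_antisymm ((h f').1 ((h' f').2 dvd_rfl)) ((h' f).1 ((h f).2 dvd_rfl))

lemma exists_isPer (h : Nat.Coprime t d) : ∃ f, IsPer t d f := by
  refine ⟨orderOf (ZMod.unitOfCoprime t h), fun i => ?_⟩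
  rw [orderOf_dvd_iff_pow_eq_one, ← Units.val_inj, ← ZMod.natCast_eq_natCast_iff]
  simp

lemma IsPer.pow_modEq_pow (h : IsPer t d f) (hc : Nat.Coprime t d) {i k : ℕ} :
    t ^ i ≡ t ^ k [MOD d] ↔ i ≡ k [MOD f] := by
  have aux : ∀ i e, t ^ i ≡ t ^ (i + e) [MOD d] ↔ i ≡ i + e [MOD f] := by
    intro i e
    have h1 : i ≡ i + e [MOD f] ↔ f ∣ e := by
      rw [Nat.modEq_iff_dvd' (by omega)]; simp
    rw [h1, ← h e]
    constructor
    · intro h2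
      rw [pow_add] at h2
      have h3 : t ^ i * 1 ≡ t ^ i * t ^ e [MOD d] := by rwa [mul_one]
      exact (Nat.ModEq.cancel_left_of_coprime (Nat.Coprime.pow_right _ hc.symm) h3).symm
    · intro h2
      rw [pow_add]
      simpa using (h2.mul_left (t ^ i)).symm
  rcases le_total i k with hik | hik
  · obtain ⟨e, rfl⟩ := Nat.exists_eq_add_of_le hik
    exact aux i e
  · obtain ⟨e, rfl⟩ := Nat.exists_eq_add_of_le hik
    exact ⟨fun h => ((aux k e).1 h.symm).symm, fun h => ((aux k e).2 h.symm).symm⟩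

end Per

lemma exists_mul_modEq_of_gcd_dvd {e D i : ℕ} (hD : 0 < D) (h : Nat.gcd e D ∣ i) :
    ∃ u : ℕ, e * u ≡ i [MOD D] := by
  obtain ⟨q, rfl⟩ := h
  refine ⟨((Nat.gcdA e D) % D).toNat * q, ?_⟩
  rw [← mul_assoc]
  refine Nat.ModEq.mul_right q ?_
  rw [← Int.natCast_modEq_iff]
  push_cast
  rw [Int.toNat_of_nonneg (Int.emod_nonneg _ (by omega)), Nat.gcd_eq_gcd_ab]
  have h2 : (e : ℤ) * (Nat.gcdA e D % D) ≡ e * Nat.gcdA e D [ZMOD D] :=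
    (Int.mod_modEq _ _).mul_left _
  refine h2.trans ?_
  rw [Int.modEq_iff_dvd]
  exact ⟨Nat.gcdB e D, by ring⟩

section Decomp

lemma sum_divisors_coprime {a b : ℕ} (h : Nat.Coprime a b) (F : ℕ → ℕ) :
    ∑ d ∈ (a * b).divisors, F d = ∑ c ∈ a.divisors, ∑ e ∈ b.divisors, F (c * e) := by
  rw [← Finset.sum_product']
  symm
  refine Finset.sum_nbij (fun x => x.1 * x.2) ?_ ?_ ?_ ?_
  · rintro ⟨c, e⟩ hx
    simp only [Finset.mem_product, Nat.mem_divisors] at hx ⊢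
    exact ⟨mul_dvd_mul hx.1.1 hx.2.1, mul_ne_zero hx.1.2 hx.2.2⟩
  · rintro ⟨c, e⟩ hx ⟨c', e'⟩ hx' heq
    simp only [Finset.coe_product, Set.mem_prod, Finset.mem_coe, Nat.mem_divisors] at hx hx' heq
    have key : ∀ c e, c ∣ a → e ∣ b → Nat.gcd (c * e) a = c ∧ Nat.gcd (c * e) b = e := by
      intro c e hc he
      constructor
      · rw [Nat.Coprime.gcd_mul_right_cancel _ (Nat.Coprime.coprime_dvd_left he h.symm)]
        exact Nat.gcd_eq_left hc
      · rw [Nat.Coprime.gcd_mul_left_cancel _ (Nat.Coprime.coprime_dvd_left hc h)]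
        exact Nat.gcd_eq_left he
    obtain ⟨h1, h2⟩ := key c e hx.1.1 hx.2.1
    obtain ⟨h3, h4⟩ := key c' e' hx'.1.1 hx'.2.1
    rw [heq] at h1 h2
    rw [Prod.mk.injEq]
    exact ⟨h1.symm.trans h3, h2.symm.trans h4⟩
  · intro d hd
    rw [Finset.mem_coe, Nat.mem_divisors] at hd
    obtain ⟨c, e, hc, he, hce⟩ := exists_dvd_and_dvd_of_dvd_mul hd.1
    refine ⟨(c, e), ?_, hce.symm⟩
    simp only [Finset.coe_product, Set.mem_prod, Finset.mem_coe, Nat.mem_divisors]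
    exact ⟨⟨hc, left_ne_zero_of_mul hd.2⟩, he, right_ne_zero_of_mul hd.2⟩
  · intro x _; rfl

variable {R Q J : ℕ}

lemma gcd_eq_gcd_R (hQJ : Nat.Coprime Q J) (hRJ : R ∣ J) {x : ℕ}
    (hx : x ∣ R * Q) : Nat.gcd x J = Nat.gcd x R := by
  apply Nat.dvd_antisymm
  · apply Nat.dvd_gcd (Nat.gcd_dvd_left _ _)
    have h1 : Nat.gcd x J ∣ R * Q := (Nat.gcd_dvd_left _ _).trans hx
    exact Nat.Coprime.dvd_of_dvd_mul_right
      (Nat.Coprime.coprime_dvd_left (Nat.gcd_dvd_right _ _) hQJ.symm) h1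
  · exact Nat.gcd_dvd_gcd_of_dvd_right _ hRJ

lemma dvd_R_of_coprime {x y : ℕ} (hRQ : Nat.Coprime R Q) (hxy : x * y ∣ R * Q) (hx : x ∣ R)
    (hy : y ∣ R) : x * y ∣ R :=
  Nat.Coprime.dvd_of_dvd_mul_right (Nat.Coprime.mul_left (hRQ.coprime_dvd_left hx)
    (hRQ.coprime_dvd_left hy)) hxy

lemma gcd_mul_gcd (hRQ : Nat.Coprime R Q) (hQJ : Nat.Coprime Q J) (hRJ : R ∣ J) {x y : ℕ}
    (hxy : x * y ∣ R * Q) : Nat.gcd x J * Nat.gcd y J = Nat.gcd (x * y) J := by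
  apply Nat.dvd_antisymm
  · apply Nat.dvd_gcd (mul_dvd_mul (Nat.gcd_dvd_left _ _) (Nat.gcd_dvd_left _ _))
    rw [gcd_eq_gcd_R hQJ hRJ ((dvd_mul_right x y).trans hxy),
      gcd_eq_gcd_R hQJ hRJ ((dvd_mul_left y x).trans hxy)]
    refine (dvd_R_of_coprime hRQ ?_ (Nat.gcd_dvd_right _ _) (Nat.gcd_dvd_right _ _)).trans hRJ
    exact (mul_dvd_mul (Nat.gcd_dvd_left _ _) (Nat.gcd_dvd_left _ _)).trans hxy
  · exact Nat.gcd_mul_left_dvd_mul_gcd J x y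

end Decomp

/-- Separation of the `p`-parts of `m`, `n`, `s`, with `τ = t ^ n₁` and the `p'`-part of `m` split
into the parts `M` and `L` where `τ` acts without fixed points and trivially. -/
structure Split (p m n s t v w x M L n₁ s₁ τ : ℕ) : Prop where
  prime : p.Prime
  hm : m = p ^ v * (M * L)
  hn : n = p ^ w * n₁
  hs : s = p ^ x * s₁
  cM : Nat.Coprime p M
  cL : Nat.Coprime p L
  cn : Nat.Coprime p n₁
  cs : Nat.Coprime p s₁
  hτ : τ = t ^ n₁
  move : ∀ ℓ, ℓ.Prime → ℓ ∣ M → ¬ τ ≡ 1 [MOD ℓ]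
  triv : τ ≡ 1 [MOD L]

lemma Split.cML {p m n s t v w x M L n₁ s₁ τ : ℕ} (S : Split p m n s t v w x M L n₁ s₁ τ) :
    Nat.Coprime M L :=
  Nat.coprime_of_dvd fun ℓ hℓ h1 h2 => S.move ℓ hℓ h1 (S.triv.of_dvd h2)

section PerD

variable {p m n s t v w x M L n₁ s₁ τ j f k i c c' R Q : ℕ}

lemma Split.isPer_iff (S : Split p m n s t v w x M L n₁ s₁ τ)
    (hc : c ∣ M) (hc' : c' ∣ L) {f₁ : ℕ} (hf₁ : f₁ ∣ n₁)
    (hf : IsPer t (p ^ i * (c * c')) (p ^ k * f₁)) : IsPer τ (c * p ^ i) (p ^ k) := by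
  have hcop : Nat.Coprime (c * p ^ i) c' := Nat.Coprime.mul_left
    ((S.cML.coprime_dvd_left hc).coprime_dvd_right hc')
    (Nat.Coprime.pow_left _ (S.cL.coprime_dvd_right hc'))
  intro a
  have h1 : τ ^ a ≡ 1 [MOD c * p ^ i] ↔ τ ^ a ≡ 1 [MOD p ^ i * (c * c')] := by
    rw [show p ^ i * (c * c') = c * p ^ i * c' by ring, ← Nat.modEq_and_modEq_iff_modEq_mul hcop]
    refine ⟨fun h => ⟨h, ?_⟩, fun h => h.1⟩
    simpa using ((S.triv.of_dvd hc').pow a)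
  rw [h1, S.hτ, ← pow_mul, hf]
  constructor
  · intro h
    exact (Nat.Coprime.pow_left k S.cn).dvd_of_dvd_mul_left ((dvd_mul_right _ _).trans h)
  · intro h
    rw [mul_comm n₁]
    exact mul_dvd_mul h hf₁

lemma Split.mem_iff (S : Split p m n s t v w x M L n₁ s₁ τ) (A : Arith m n s t)
    (hd : p ^ i * (c * c') ∣ m) (hc : c ∣ M) (hc' : c' ∣ L) {f₁ : ℕ} (hf₁ : f₁ ∣ n₁)
    (hf : IsPer t (p ^ i * (c * c')) (p ^ k * f₁)) (hLj : j ≡ 1 [MOD L])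
    (hj : ∃ K, j ^ p ^ K ≡ 1 [MOD m]) :
    (∃ a, j ≡ t ^ a [MOD p ^ i * (c * c')]) ↔ ∃ a, j ≡ τ ^ a [MOD c * p ^ i] := by
  have hcop : Nat.Coprime (c * p ^ i) c' := Nat.Coprime.mul_left
    ((S.cML.coprime_dvd_left hc).coprime_dvd_right hc')
    (Nat.Coprime.pow_left _ (S.cL.coprime_dvd_right hc'))
  have hn1 : 0 < n₁ := Nat.pos_of_ne_zero fun h => by
    have := A.n_pos; rw [S.hn, h] at this; simp at this
  have hf1 : 0 < f₁ := Nat.pos_of_dvd_of_pos hf₁ hn1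
  have hp := S.prime.pos
  have hc1 : Nat.Coprime p f₁ := S.cn.coprime_dvd_right hf₁
  constructor
  · rintro ⟨a, ha⟩
    obtain ⟨K, hK⟩ := hj
    have h1 : f₁ ∣ a := by
      have h2 : t ^ (a * p ^ K) ≡ 1 [MOD p ^ i * (c * c')] := by
        rw [pow_mul]
        exact (ha.symm.pow _).trans (hK.of_dvd hd)
      exact (Nat.Coprime.pow_right K hc1.symm).dvd_of_dvd_mul_right
        ((dvd_mul_left _ _).trans ((hf _).1 h2))
    have h3 : Nat.gcd n₁ (p ^ k * f₁) ∣ a := by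
      rw [Nat.Coprime.gcd_mul_left_cancel_right _ (Nat.Coprime.pow_left k S.cn)]
      exact (Nat.gcd_dvd_right _ _).trans h1
    obtain ⟨u, hu⟩ := exists_mul_modEq_of_gcd_dvd (by positivity) h3
    refine ⟨u, ?_⟩
    have h4 : t ^ (n₁ * u) ≡ t ^ a [MOD p ^ i * (c * c')] :=
      (hf.pow_modEq_pow (A.cop.coprime_dvd_right hd)).2 hu
    rw [S.hτ, ← pow_mul]
    exact (ha.trans h4.symm).of_dvd ⟨c', by ring⟩
  · rintro ⟨a, ha⟩
    refine ⟨n₁ * a, ?_⟩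
    rw [pow_mul, ← S.hτ, show p ^ i * (c * c') = c * p ^ i * c' by ring,
      ← Nat.modEq_and_modEq_iff_modEq_mul hcop]
    refine ⟨ha, (hLj.of_dvd hc').trans ?_⟩
    simpa using ((S.triv.of_dvd hc').pow a).symm

/-- The hypotheses on `j` under which the sums localize at `p`. -/
structure Adm (p m n₁ M L j R Q : ℕ) : Prop where
  hRQ : n₁ * (M * L) = R * Q
  cRQ : Nat.Coprime R Q
  one_le : 1 ≤ j
  hR : R ∣ j - 1
  hQ : Nat.Coprime Q (j - 1)
  hL : L ∣ j - 1
  ppow : ∃ K, j ^ p ^ K ≡ 1 [MOD m]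

lemma Adm.modEq_L (h : Adm p m n₁ M L j R Q) : j ≡ 1 [MOD L] :=
  ((Nat.modEq_iff_dvd' h.one_le).2 h.hL).symm

lemma gcd_ppart {a b J : ℕ} (h : Nat.Coprime a b) : Nat.gcd (a * b) J = Nat.gcd a J * Nat.gcd b J := by
  rw [Nat.gcd_comm, Nat.Coprime.gcd_mul _ h, Nat.gcd_comm J a, Nat.gcd_comm J b]

lemma Split.cond_iff (S : Split p m n s t v w x M L n₁ s₁ τ) (A : Arith m n s t)
    (B : Adm p m n₁ M L j R Q)
    (hd : p ^ i * (c * c') ∣ m) (hc : c ∣ M) (hc' : c' ∣ L) {f₁ : ℕ} (hf₁ : f₁ ∣ n₁) (hk : k ≤ w)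
    (hj : ∃ a, j ≡ t ^ a [MOD p ^ i * (c * c')]) :
    p ^ i * (c * c') ∣ s * (Nat.gcd (j - 1) (m * n) / Nat.gcd (n / (p ^ k * f₁)) (j - 1)) ↔
      p ^ i * Nat.gcd (p ^ w / p ^ k) (j - 1) ∣ p ^ x * Nat.gcd (j - 1) (p ^ (v + w)) := by
  set J := j - 1 with hJ
  have hn1 : 0 < n₁ := Nat.pos_of_ne_zero fun h => by
    have := A.n_pos; rw [S.hn, h] at this; simp at this
  have hf1 : 0 < f₁ := Nat.pos_of_dvd_of_pos hf₁ hn1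
  have hp := S.prime.pos
  obtain ⟨g₁, hg⟩ := hf₁
  have hg1 : Nat.Coprime p g₁ := S.cn.coprime_dvd_right ⟨f₁, by rw [hg]; ring⟩
  have hnf : n / (p ^ k * f₁) = p ^ w / p ^ k * g₁ := by
    rw [S.hn, hg, Nat.pow_div hk hp]
    apply Nat.div_eq_of_eq_mul_right (by positivity)
    nth_rewrite 1 [← Nat.sub_add_cancel hk]
    ring
  have hD : Nat.gcd (n / (p ^ k * f₁)) J = Nat.gcd (p ^ w / p ^ k) J * Nat.gcd g₁ J := by
    rw [hnf, gcd_ppart]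
    rw [Nat.pow_div hk hp]
    exact Nat.Coprime.pow_left _ hg1
  have hE : Nat.gcd J (m * n) = Nat.gcd J (p ^ (v + w)) * Nat.gcd J (R * Q) := by
    rw [← Nat.Coprime.gcd_mul]
    · congr 1
      rw [S.hm, S.hn, ← B.hRQ]; ring
    · rw [← B.hRQ]
      exact Nat.Coprime.pow_left _ (S.cn.mul_right (S.cM.mul_right S.cL))
  have hDE : Nat.gcd (n / (p ^ k * f₁)) J ∣ Nat.gcd J (m * n) := by
    apply Nat.dvd_gcd (Nat.gcd_dvd_right _ _)
    refine (Nat.gcd_dvd_left _ _).trans ((Nat.div_dvd_of_dvd ?_).trans (dvd_mul_left _ _))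
    rw [S.hn, hg]
    exact mul_dvd_mul (pow_dvd_pow _ hk) (dvd_mul_right _ _)
  have hDpos : 0 < Nat.gcd (n / (p ^ k * f₁)) J := by
    rw [hD]
    apply Nat.mul_pos
    · exact Nat.gcd_pos_of_pos_left _ (by rw [Nat.pow_div hk hp]; positivity)
    · exact Nat.gcd_pos_of_pos_left _ (Nat.pos_of_ne_zero fun h => by rw [h] at hg; simp at hg; omega)
  have hrest : (c * c') * Nat.gcd g₁ J ∣ s₁ * Nat.gcd J (R * Q) := by
    have he : c * c' ∣ R * Q := by
      rw [← B.hRQ]; exact (mul_dvd_mul hc hc').trans (dvd_mul_left _ _)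
    obtain ⟨eR, eQ, hR, hQ, hRQ⟩ := exists_dvd_and_dvd_of_dvd_mul he
    have h1 : eQ ∣ s₁ := by
      have hcop : Nat.Coprime eQ (t - 1) := by
        apply Nat.coprime_of_dvd
        intro ℓ hℓ hl1 hl2
        obtain ⟨a, ha⟩ := hj
        have h2 : t ≡ 1 [MOD ℓ] :=
          ((Nat.modEq_iff_dvd' (by have := A.two_le; omega)).2 hl2).symm
        have h3 : j ≡ 1 [MOD ℓ] := by
          refine (ha.of_dvd ?_).trans (by simpa using h2.pow a)
          rw [hRQ]
          exact hl1.trans ((dvd_mul_left _ _).trans (dvd_mul_left _ _))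
        have h4 : ℓ ∣ J := (Nat.modEq_iff_dvd' B.one_le).1 h3.symm
        exact Nat.Prime.one_lt hℓ |>.ne' (Nat.dvd_one.1 (B.hQ ▸ Nat.dvd_gcd (hl1.trans hQ) h4))
      have h5 : m ∣ s * (t - 1) := by
        have h6 := (Nat.modEq_iff_dvd' (by nlinarith [A.two_le] : s ≤ s * t)).1 A.fix.symm
        rwa [Nat.mul_sub, mul_one]
      have h7 : eQ ∣ m := by
        refine Dvd.dvd.trans ?_ hd
        rw [hRQ]
        exact ((dvd_mul_left _ _).trans (dvd_mul_left _ _))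
      have h8 : eQ ∣ s := hcop.dvd_of_dvd_mul_right (h7.trans h5)
      rw [S.hs] at h8
      refine Nat.Coprime.dvd_of_dvd_mul_left ?_ h8
      refine Nat.Coprime.pow_right _ (Nat.Coprime.symm ?_)
      refine Nat.Coprime.coprime_dvd_right ?_ (S.cM.mul_right S.cL)
      refine Dvd.dvd.trans ?_ (mul_dvd_mul hc hc')
      rw [hRQ]; exact dvd_mul_left _ _
    have hg2 : g₁ ∣ R * Q := by
      rw [← B.hRQ, hg]; exact ((dvd_mul_left _ _).trans (dvd_mul_right _ _))
    have h2 : eR * Nat.gcd g₁ J ∣ R := by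
      apply dvd_R_of_coprime B.cRQ
      · rw [← B.hRQ, mul_comm n₁]
        refine mul_dvd_mul (Dvd.dvd.trans ?_ (mul_dvd_mul hc hc')) ?_
        · rw [hRQ]; exact dvd_mul_right _ _
        · rw [hg]; exact (Nat.gcd_dvd_left _ _).trans (dvd_mul_left _ _)
      · exact hR
      · rw [gcd_eq_gcd_R B.hQ B.hR hg2]; exact Nat.gcd_dvd_right _ _
    rw [hRQ, show eR * eQ * Nat.gcd g₁ J = eQ * (eR * Nat.gcd g₁ J) by ring]
    exact mul_dvd_mul h1 (Nat.dvd_gcd (h2.trans B.hR) (h2.trans (dvd_mul_right _ _)))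
  have hcopp : Nat.Coprime (p ^ i * Nat.gcd (p ^ w / p ^ k) J) (s₁ * Nat.gcd J (R * Q)) := by
    have h1 : Nat.Coprime p (s₁ * Nat.gcd J (R * Q)) := by
      apply S.cs.mul_right
      refine Nat.Coprime.coprime_dvd_right (Nat.gcd_dvd_right _ _) ?_
      rw [← B.hRQ]
      exact (S.cn.mul_right (S.cM.mul_right S.cL))
    refine Nat.Coprime.mul_left (Nat.Coprime.pow_left _ h1) ?_
    refine Nat.Coprime.coprime_dvd_left (Nat.gcd_dvd_left _ _) ?_
    rw [Nat.pow_div hk hp]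
    exact Nat.Coprime.pow_left _ h1
  rw [← Nat.mul_div_assoc _ hDE, Nat.dvd_div_iff_mul_dvd (hDE.trans (dvd_mul_left _ _)), hD, hE,
    S.hs, show Nat.gcd (p ^ w / p ^ k) J * Nat.gcd g₁ J * (p ^ i * (c * c')) =
      (p ^ i * Nat.gcd (p ^ w / p ^ k) J) * (c * c' * Nat.gcd g₁ J) by ring,
    show p ^ x * s₁ * (Nat.gcd J (p ^ (v + w)) * Nat.gcd J (R * Q)) =
      (p ^ x * Nat.gcd J (p ^ (v + w))) * (s₁ * Nat.gcd J (R * Q)) by ring]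
  constructor
  · intro h
    exact hcopp.dvd_of_dvd_mul_right ((dvd_mul_right _ _).trans h)
  · intro h
    exact mul_dvd_mul h hrest

end PerD

/-- The local condition at the prime `p`. -/
def ZCond (p v w x τ j P c i : ℕ) : Prop :=
  IsPer τ (c * p ^ i) P ∧ (∃ a, j ≡ τ ^ a [MOD c * p ^ i]) ∧
    p ^ i * Nat.gcd (p ^ w / P) (j - 1) ∣ p ^ x * Nat.gcd (j - 1) (p ^ (v + w))

/-- The local counting function at the prime `p`. -/
def Zs (p M v w x τ j P : ℕ) : ℕ :=
  ∑ c ∈ M.divisors, ∑ i ∈ Finset.range (v + 1),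
    if ZCond p v w x τ j P c i then Nat.totient c * Nat.totient (p ^ i) else 0

/-- The combination of the counts `w f` which localizes at `p`. -/
def pSum (p N k j : ℕ) (w : ℕ → ℕ) : ℕ :=
  ∑ f ∈ N.divisors, if f.factorization p = k then Nat.gcd (ordCompl[p] f) (j - 1) * w f else 0

section PSum

variable {p m n s t v w x M L n₁ s₁ τ j f k i c c' R Q : ℕ}

lemma Split.exists_per (S : Split p m n s t v w x M L n₁ s₁ τ) (A : Arith m n s t) {d : ℕ}
    (hd : d ∣ m) : ∃ k f₁, k ≤ w ∧ f₁ ∣ n₁ ∧ 0 < f₁ ∧ IsPer t d (p ^ k * f₁) := by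
  obtain ⟨f, hf⟩ := exists_isPer (A.cop.coprime_dvd_right hd)
  have h1 : f ∣ n := (hf n).1 (A.pow_t.of_dvd hd)
  rw [S.hn] at h1
  obtain ⟨a, b, ha, hb, rfl⟩ := exists_dvd_and_dvd_of_dvd_mul h1
  obtain ⟨k, hk, rfl⟩ := (Nat.dvd_prime_pow S.prime).1 ha
  refine ⟨k, b, hk, hb, ?_, hf⟩
  exact Nat.pos_of_dvd_of_pos hb (Nat.pos_of_ne_zero fun h => by
    have := A.n_pos; rw [S.hn, h] at this; simp at this)

lemma factorization_ppart (hp : p.Prime) {f₁ : ℕ} (h0 : 0 < f₁) (hc : Nat.Coprime p f₁) :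
    (p ^ k * f₁).factorization p = k := by
  rw [Nat.factorization_mul (by have := hp.pos; positivity) h0.ne']
  simp [hp.factorization_pow,
    Nat.factorization_eq_zero_of_not_dvd ((Nat.Prime.coprime_iff_not_dvd hp).1 hc)]

lemma Split.inner_sum (S : Split p m n s t v w x M L n₁ s₁ τ) (A : Arith m n s t)
    (B : Adm p m n₁ M L j R Q) (hc : c ∣ M) (hc' : c' ∣ L) (hi : i ≤ v) :
    (∑ f ∈ (m * n).divisors, if f.factorization p = k then Nat.gcd (ordCompl[p] f) (j - 1) *
      (if (IsPer t (p ^ i * (c * c')) f ∧ (∃ a, j ≡ t ^ a [MOD p ^ i * (c * c')]) ∧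
        p ^ i * (c * c') ∣ s * (Nat.gcd (j - 1) (m * n) / Nat.gcd (n / f) (j - 1))) then
        Nat.totient (p ^ i * (c * c')) * Nat.gcd (n / f) (j - 1) else 0) else 0) =
    Nat.gcd n₁ (j - 1) * Nat.gcd (p ^ w / p ^ k) (j - 1) * (Nat.totient c' *
      if ZCond p v w x τ j (p ^ k) c i then Nat.totient c * Nat.totient (p ^ i) else 0) := by
  have hd : p ^ i * (c * c') ∣ m := by
    rw [S.hm]; exact mul_dvd_mul (pow_dvd_pow _ hi) (mul_dvd_mul hc hc')
  have hp := S.prime.pos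
  obtain ⟨k₀, f₁, hk₀, hf₁, hf1, hper⟩ := S.exists_per A hd
  have hcf : Nat.Coprime p f₁ := S.cn.coprime_dvd_right hf₁
  have hfac : (p ^ k₀ * f₁).factorization p = k₀ := factorization_ppart S.prime hf1 hcf
  have hn0 := A.n_pos
  have hm0 := A.m_pos
  rw [Finset.sum_eq_single (p ^ k₀ * f₁)]
  · rw [hfac]
    have hτper := S.isPer_iff hc hc' hf₁ hper
    by_cases hk : k₀ = k
    · subst hk
      rw [if_pos rfl]
      have hmem := S.mem_iff A hd hc hc' hf₁ hper B.modEq_L B.ppow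
      by_cases hj : ∃ a, j ≡ t ^ a [MOD p ^ i * (c * c')]
      · have hcond := S.cond_iff A B hd hc hc' hf₁ hk₀ hj
        have hz : ZCond p v w x τ j (p ^ k₀) c i ↔
            p ^ i * Nat.gcd (p ^ w / p ^ k₀) (j - 1) ∣ p ^ x * Nat.gcd (j - 1) (p ^ (v + w)) :=
          ⟨fun h => h.2.2, fun h => ⟨hτper, hmem.1 hj, h⟩⟩
        by_cases hfin : p ^ i * Nat.gcd (p ^ w / p ^ k₀) (j - 1) ∣
            p ^ x * Nat.gcd (j - 1) (p ^ (v + w))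
        · rw [if_pos ⟨hper, hj, hcond.2 hfin⟩, if_pos (hz.2 hfin)]
          obtain ⟨g₁, hg⟩ := hf₁
          have hg1 : Nat.Coprime p g₁ := S.cn.coprime_dvd_right ⟨f₁, by rw [hg]; ring⟩
          have hnf : n / (p ^ k₀ * f₁) = p ^ w / p ^ k₀ * g₁ := by
            rw [S.hn, hg, Nat.pow_div hk₀ hp]
            apply Nat.div_eq_of_eq_mul_right (by positivity)
            nth_rewrite 1 [← Nat.sub_add_cancel hk₀]
            ring
          have hoc : ordCompl[p] (p ^ k₀ * f₁) = f₁ := by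
            rw [hfac]; exact Nat.mul_div_cancel_left _ (by positivity)
          rw [hfac] at hoc
          rw [hoc, hnf, gcd_ppart (by rw [Nat.pow_div hk₀ hp]; exact Nat.Coprime.pow_left _ hg1),
            Nat.totient_mul, Nat.totient_mul]
          · have hgg := gcd_mul_gcd (x := f₁) (y := g₁) B.cRQ B.hQ B.hR (by
              rw [← hg, ← B.hRQ]; exact dvd_mul_right _ _)
            rw [← hg] at hgg
            rw [← hgg]; ring
          · exact (S.cML.coprime_dvd_left hc).coprime_dvd_right hc'
          · exact Nat.Coprime.pow_left _
              ((S.cM.coprime_dvd_right hc).mul_right (S.cL.coprime_dvd_right hc'))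
        · rw [if_neg fun h => hfin (hcond.1 h.2.2), if_neg fun h => hfin (hz.1 h)]; simp
      · rw [if_neg fun h => hj h.2.1, if_neg fun h => hj (hmem.2 h.2.1)]; simp
    · rw [if_neg hk, if_neg]
      · simp
      · intro h
        exact hk (Nat.pow_right_injective S.prime.two_le (hτper.unique h.1))
  · intro f _ hf
    by_cases h : f.factorization p = k
    · rw [if_pos h, if_neg fun h => hf (h.1.unique hper), mul_zero]
    · rw [if_neg h]
  · intro h
    exfalso
    apply h
    rw [Nat.mem_divisors]
    refine ⟨?_, by positivity⟩
    rw [S.hn]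
    exact (mul_dvd_mul (pow_dvd_pow _ hk₀) hf₁).trans (dvd_mul_left _ _)

theorem Split.pSum_eq (S : Split p m n s t v w x M L n₁ s₁ τ) (A : Arith m n s t)
    (B : Adm p m n₁ M L j R Q) :
    pSum p (m * n) k j (fun f => W m n s t f j) =
      Nat.gcd n₁ (j - 1) * L * (Nat.gcd (p ^ w / p ^ k) (j - 1) * Zs p M v w x τ j (p ^ k)) := by
  have h1 : pSum p (m * n) k j (fun f => W m n s t f j) =
      ∑ d ∈ m.divisors, ∑ f ∈ (m * n).divisors,
        if f.factorization p = k then Nat.gcd (ordCompl[p] f) (j - 1) *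
      (if (IsPer t d f ∧ (∃ a, j ≡ t ^ a [MOD d]) ∧
        d ∣ s * (Nat.gcd (j - 1) (m * n) / Nat.gcd (n / f) (j - 1))) then
        Nat.totient d * Nat.gcd (n / f) (j - 1) else 0) else 0 := by
    rw [Finset.sum_comm]
    unfold pSum
    refine Finset.sum_congr rfl fun f _ => ?_
    split_ifs
    · simp only [W]
      rw [Finset.sum_filter, Finset.mul_sum]
    · simp
  have hc1 : Nat.Coprime (p ^ v) (M * L) := Nat.Coprime.pow_left _ (S.cM.mul_right S.cL)
  rw [h1]
  nth_rewrite 1 [S.hm]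
  rw [sum_divisors_coprime hc1]
  have h2 : ∀ F : ℕ → ℕ, ∑ d ∈ (p ^ v).divisors, F d = ∑ i ∈ Finset.range (v + 1), F (p ^ i) :=
    fun F => by rw [Nat.sum_divisors_prime_pow S.prime]
  rw [h2]
  have h3 : ∀ i ∈ Finset.range (v + 1), (∑ e ∈ (M * L).divisors, ∑ f ∈ (m * n).divisors,
        if f.factorization p = k then Nat.gcd (ordCompl[p] f) (j - 1) *
      (if (IsPer t (p ^ i * e) f ∧ (∃ a, j ≡ t ^ a [MOD p ^ i * e]) ∧
        p ^ i * e ∣ s * (Nat.gcd (j - 1) (m * n) / Nat.gcd (n / f) (j - 1))) then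
        Nat.totient (p ^ i * e) * Nat.gcd (n / f) (j - 1) else 0) else 0) =
      Nat.gcd n₁ (j - 1) * L * (Nat.gcd (p ^ w / p ^ k) (j - 1) *
        ∑ c ∈ M.divisors, if ZCond p v w x τ j (p ^ k) c i then
          Nat.totient c * Nat.totient (p ^ i) else 0) := by
    intro i hi
    rw [Finset.mem_range] at hi
    rw [sum_divisors_coprime S.cML, Finset.mul_sum, Finset.mul_sum]
    refine Finset.sum_congr rfl fun c hc => ?_
    rw [Finset.sum_congr rfl fun c' hc' => S.inner_sum A B (Nat.dvd_of_mem_divisors hc)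
      (Nat.dvd_of_mem_divisors hc') (by omega), ← Finset.mul_sum, ← Finset.sum_mul,
      Nat.sum_totient]
    ring
  rw [Finset.sum_congr rfl h3, ← Finset.mul_sum, ← Finset.mul_sum]
  unfold Zs
  rw [Finset.sum_comm]

end PSum

/-- Local data at a prime `p`. -/
structure Loc (p M v w x τ : ℕ) : Prop where
  prime : p.Prime
  M_pos : 0 < M
  cM : Nat.Coprime p M
  two_le : 2 ≤ τ
  pow_w : τ ^ p ^ w ≡ 1 [MOD M * p ^ v]
  x_le : x ≤ v
  fix : p ^ x * τ ≡ p ^ x [MOD p ^ v]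
  move : ∀ ℓ, ℓ.Prime → ℓ ∣ M → ¬ τ ≡ 1 [MOD ℓ]
  modp : v ≠ 0 → τ ≡ 1 [MOD p]

lemma modEq_one_of_pow_prime {p y k : ℕ} (hp : p.Prime) (h : y ^ p ^ k ≡ 1 [MOD p]) :
    y ≡ 1 [MOD p] := by
  have := Fact.mk hp
  rw [← ZMod.natCast_eq_natCast_iff] at h ⊢
  push_cast at h ⊢
  rwa [ZMod.pow_card_pow] at h

lemma Split.n₁_pos {p m n s t v w x M L n₁ s₁ τ : ℕ} (S : Split p m n s t v w x M L n₁ s₁ τ)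
    (A : Arith m n s t) : 0 < n₁ :=
  Nat.pos_of_ne_zero fun h => by have := A.n_pos; rw [S.hn, h] at this; simp at this

lemma Split.M_pos {p m n s t v w x M L n₁ s₁ τ : ℕ} (S : Split p m n s t v w x M L n₁ s₁ τ)
    (A : Arith m n s t) : 0 < M :=
  Nat.pos_of_ne_zero fun h => by have := A.m_pos; rw [S.hm, h] at this; simp at this

lemma Split.L_pos {p m n s t v w x M L n₁ s₁ τ : ℕ} (S : Split p m n s t v w x M L n₁ s₁ τ)
    (A : Arith m n s t) : 0 < L :=
  Nat.pos_of_ne_zero fun h => by have := A.m_pos; rw [S.hm, h] at this; simp at this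

lemma Split.loc {p m n s t v w x M L n₁ s₁ τ : ℕ} (S : Split p m n s t v w x M L n₁ s₁ τ)
    (A : Arith m n s t) : Loc p M v w x τ where
  prime := S.prime
  M_pos := S.M_pos A
  cM := S.cM
  two_le := by
    rw [S.hτ]; exact A.two_le.trans (Nat.le_self_pow (S.n₁_pos A).ne' t)
  pow_w := by
    have h := A.pow_t
    rw [S.hn, mul_comm, pow_mul, ← S.hτ] at h
    exact h.of_dvd ⟨L, by rw [S.hm]; ring⟩
  x_le := by
    have h := A.s_dvd
    rw [S.hm, S.hs] at h
    have h2 : p ^ x ∣ p ^ v := by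
      refine Nat.Coprime.dvd_of_dvd_mul_right ?_ ((dvd_mul_right _ _).trans h)
      exact Nat.Coprime.pow_left _ (S.cM.mul_right S.cL)
    exact (Nat.pow_dvd_pow_iff_le_right S.prime.one_lt).1 h2
  fix := by
    have h : ∀ i, s * t ^ i ≡ s [MOD m] := by
      intro i
      induction i with
      | zero => simp; rfl
      | succ k ih => rw [pow_succ, ← mul_assoc]; exact (ih.mul_right t).trans A.fix
    have h1 := (h n₁).of_dvd (show p ^ v ∣ m from ⟨M * L, S.hm⟩)
    rw [← S.hτ, S.hs] at h1
    refine Nat.ModEq.cancel_left_of_coprime (c := s₁) ?_ ?_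
    · exact Nat.Coprime.pow_left _ S.cs
    · convert h1 using 1 <;> ring
  move := S.move
  modp := by
    intro hv
    have h := A.pow_t
    rw [S.hn, mul_comm, pow_mul, ← S.hτ] at h
    refine modEq_one_of_pow_prime S.prime (h.of_dvd (?_ : p ∣ m))
    rw [S.hm]
    exact (dvd_pow_self p hv).trans (dvd_mul_right _ _)

lemma pred_modEq {a b d : ℕ} (ha : 1 ≤ a) (hb : 1 ≤ b) (h : a ≡ b [MOD d]) :
    a - 1 ≡ b - 1 [MOD d] := by
  have h1 : (a - 1) + 1 ≡ (b - 1) + 1 [MOD d] := by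
    rwa [Nat.sub_add_cancel ha, Nat.sub_add_cancel hb]
  exact Nat.ModEq.add_right_cancel' 1 h1

lemma modEq_one_iff_dvd {a d : ℕ} (ha : 1 ≤ a) : a ≡ 1 [MOD d] ↔ d ∣ a - 1 :=
  ⟨fun h => (Nat.modEq_iff_dvd' ha).1 h.symm, fun h => ((Nat.modEq_iff_dvd' ha).2 h).symm⟩

lemma gcd_congr_of_dvd {a b d e : ℕ} (h : a ≡ b [MOD e]) (hd : d ∣ e) :
    Nat.gcd d a = Nat.gcd d b := by
  rw [Nat.gcd_comm d a, Nat.gcd_comm d b]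
  exact Nat.ModEq.gcd_eq (h.of_dvd hd)

section ZsLemmas

variable {p M v w x τ j j' k : ℕ}

lemma Zs_congr (hj : 1 ≤ j) (hj' : 1 ≤ j')
    (h : j ≡ j' [MOD M * p ^ (v + w)]) {P : ℕ} (hP : P ∣ p ^ w) :
    Nat.gcd (p ^ w / P) (j - 1) * Zs p M v w x τ j P =
      Nat.gcd (p ^ w / P) (j' - 1) * Zs p M v w x τ j' P := by
  have h0 : j - 1 ≡ j' - 1 [MOD p ^ (v + w)] :=
    pred_modEq hj hj' (h.of_dvd (dvd_mul_left _ _))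
  have h1 : Nat.gcd (p ^ w / P) (j - 1) = Nat.gcd (p ^ w / P) (j' - 1) :=
    gcd_congr_of_dvd h0 ((Nat.div_dvd_of_dvd hP).trans (pow_dvd_pow _ (by omega)))
  have h2 : Nat.gcd (j - 1) (p ^ (v + w)) = Nat.gcd (j' - 1) (p ^ (v + w)) :=
    Nat.ModEq.gcd_eq h0
  rw [h1]
  congr 1
  unfold Zs
  refine Finset.sum_congr rfl fun c hc => Finset.sum_congr rfl fun i hi => ?_
  have hci : c * p ^ i ∣ M * p ^ (v + w) :=
    mul_dvd_mul (Nat.dvd_of_mem_divisors hc)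
      (pow_dvd_pow _ (by rw [Finset.mem_range] at hi; omega))
  have : ZCond p v w x τ j P c i ↔ ZCond p v w x τ j' P c i := by
    unfold ZCond
    rw [h1, h2]
    have h3 := h.of_dvd hci
    have h4 : (∃ a, j ≡ τ ^ a [MOD c * p ^ i]) ↔ ∃ a, j' ≡ τ ^ a [MOD c * p ^ i] :=
      exists_congr fun a => ⟨fun h => h3.symm.trans h, fun h => h3.trans h⟩
    rw [h4]
  by_cases hz : ZCond p v w x τ j P c i
  · rw [if_pos hz, if_pos (this.1 hz)]
  · rw [if_neg hz, if_neg fun h => hz (this.2 h)]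

lemma Loc.cop (H : Loc p M v w x τ) : Nat.Coprime τ (M * p ^ v) := by
  have h : Nat.Coprime (τ ^ p ^ w) (M * p ^ v) := by
    rw [Nat.coprime_iff_gcd_eq_one, H.pow_w.gcd_eq]; simp
  exact Nat.Coprime.coprime_dvd_left (dvd_pow_self τ (pow_pos H.prime.pos w).ne') h

lemma Loc.exists_per (H : Loc p M v w x τ) {d : ℕ} (hd : d ∣ M * p ^ v) :
    ∃ k ≤ w, IsPer τ d (p ^ k) := by
  obtain ⟨f, hf⟩ := exists_isPer (H.cop.coprime_dvd_right hd)
  have h1 := (hf _).1 (H.pow_w.of_dvd hd)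
  obtain ⟨k, hk, rfl⟩ := (Nat.dvd_prime_pow H.prime).1 h1
  exact ⟨k, hk, hf⟩

lemma sum_totient_dvd {X Y : ℕ} (hX : 0 < X) :
    (∑ c ∈ X.divisors, if c ∣ Y then Nat.totient c else 0) = Nat.gcd X Y := by
  rw [← Finset.sum_filter, ← Nat.sum_totient (Nat.gcd X Y)]
  refine Finset.sum_congr ?_ fun _ _ => rfl
  ext c
  simp only [Finset.mem_filter, Nat.mem_divisors, Nat.dvd_gcd_iff]
  have := Nat.gcd_pos_of_pos_left Y hX
  constructor
  · rintro ⟨⟨h1, _⟩, h2⟩; exact ⟨⟨h1, h2⟩, this.ne'⟩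
  · rintro ⟨⟨h1, h2⟩, _⟩; exact ⟨⟨h1, hX.ne'⟩, h2⟩

lemma sum_totient_pow_dvd (hp : p.Prime) {Y : ℕ} :
    (∑ i ∈ Finset.range (v + 1), if p ^ i ∣ Y then Nat.totient (p ^ i) else 0) =
      Nat.gcd (p ^ v) Y := by
  rw [← sum_totient_dvd (pow_pos hp.pos v), Nat.sum_divisors_prime_pow hp]

lemma Loc.sum_Zs_one (H : Loc p M v w x τ) (K : ℕ) :
    (∑ k ∈ Finset.range (K + 1), p ^ k * (p ^ w / p ^ k * Zs p M v w x τ 1 (p ^ k))) =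
      p ^ w * (Nat.gcd M (τ ^ p ^ K - 1) * Nat.gcd (p ^ v) (τ ^ p ^ K - 1)) := by
  have hp := H.prime.pos
  have hz : ∀ k, p ^ k * (p ^ w / p ^ k * Zs p M v w x τ 1 (p ^ k)) =
      p ^ w * ∑ c ∈ M.divisors, ∑ i ∈ Finset.range (v + 1),
        if (k ≤ w ∧ IsPer τ (c * p ^ i) (p ^ k)) then Nat.totient c * Nat.totient (p ^ i) else 0 := by
    intro k
    by_cases hk : k ≤ w
    · rw [← mul_assoc, Nat.mul_div_cancel' (pow_dvd_pow _ hk)]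
      congr 1
      unfold Zs
      refine Finset.sum_congr rfl fun c hc => Finset.sum_congr rfl fun i hi => ?_
      have : ZCond p v w x τ 1 (p ^ k) c i ↔ (k ≤ w ∧ IsPer τ (c * p ^ i) (p ^ k)) := by
        unfold ZCond
        refine ⟨fun h => ⟨hk, h.1⟩, fun h => ⟨h.2, ⟨0, by simp; rfl⟩, ?_⟩⟩
        rw [Finset.mem_range] at hi
        simp only [Nat.sub_self, Nat.gcd_zero_right, Nat.gcd_zero_left]
        refine Dvd.dvd.trans ?_ (dvd_mul_left _ _)
        rw [pow_add]
        exact mul_dvd_mul (pow_dvd_pow _ (by omega)) (Nat.div_dvd_of_dvd (pow_dvd_pow _ hk))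
      by_cases hz : ZCond p v w x τ 1 (p ^ k) c i
      · rw [if_pos hz, if_pos (this.1 hz)]
      · rw [if_neg hz, if_neg fun h => hz (this.2 h)]
    · rw [Nat.div_eq_of_lt (Nat.pow_lt_pow_right H.prime.one_lt (by omega))]
      simp [hk]
  rw [Finset.sum_congr rfl fun k _ => hz k, ← Finset.mul_sum, Finset.sum_comm]
  congr 1
  have h1 : 1 ≤ τ ^ p ^ K := Nat.one_le_pow _ _ (by have := H.two_le; omega)
  have h2 : ∀ c ∈ M.divisors, (∑ k ∈ Finset.range (K + 1), ∑ i ∈ Finset.range (v + 1),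
        if (k ≤ w ∧ IsPer τ (c * p ^ i) (p ^ k)) then Nat.totient c * Nat.totient (p ^ i) else 0) =
      (if c ∣ τ ^ p ^ K - 1 then Nat.totient c else 0) * Nat.gcd (p ^ v) (τ ^ p ^ K - 1) := by
    intro c hc
    rw [Finset.sum_comm, ← sum_totient_pow_dvd H.prime, Finset.mul_sum]
    refine Finset.sum_congr rfl fun i hi => ?_
    have hci : c * p ^ i ∣ M * p ^ v :=
      mul_dvd_mul (Nat.dvd_of_mem_divisors hc)
        (pow_dvd_pow _ (by rw [Finset.mem_range] at hi; omega))
    obtain ⟨k, hk, hper⟩ := H.exists_per hci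
    have hcp : Nat.Coprime c (p ^ i) :=
      Nat.Coprime.pow_right _ ((H.cM.coprime_dvd_right (Nat.dvd_of_mem_divisors hc)).symm)
    have h3 : (c ∣ τ ^ p ^ K - 1 ∧ p ^ i ∣ τ ^ p ^ K - 1) ↔ k ≤ K := by
      rw [← Nat.pow_dvd_pow_iff_le_right H.prime.one_lt, ← hper, modEq_one_iff_dvd h1]
      exact ⟨fun h => hcp.mul_dvd_of_dvd_of_dvd h.1 h.2,
        fun h => ⟨(dvd_mul_right _ _).trans h, (dvd_mul_left _ _).trans h⟩⟩
    have h4 : (if c ∣ τ ^ p ^ K - 1 then Nat.totient c else 0) *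
        (if p ^ i ∣ τ ^ p ^ K - 1 then Nat.totient (p ^ i) else 0) =
        if k ≤ K then Nat.totient c * Nat.totient (p ^ i) else 0 := by
      by_cases h5 : k ≤ K
      · rw [if_pos h5, if_pos (h3.2 h5).1, if_pos (h3.2 h5).2]
      · rw [if_neg h5]
        by_cases h6 : c ∣ τ ^ p ^ K - 1
        · rw [if_neg fun h => h5 (h3.1 ⟨h6, h⟩), mul_zero]
        · rw [if_neg h6, zero_mul]
    rw [h4]
    have h7 : ∀ k', (k' ≤ w ∧ IsPer τ (c * p ^ i) (p ^ k')) ↔ k' = k := by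
      intro k'
      refine ⟨fun h => Nat.pow_right_injective H.prime.two_le (h.2.unique hper), ?_⟩
      rintro rfl; exact ⟨hk, hper⟩
    simp only [h7]
    simp [Finset.sum_ite_eq']
  rw [Finset.sum_congr rfl h2, ← Finset.sum_mul, sum_totient_dvd H.M_pos]

/-- The local count for trivial action. -/
def Es (p v w x τ j : ℕ) : ℕ :=
  ∑ i ∈ Finset.range (v + 1),
    if (p ^ i ∣ τ - 1 ∧ p ^ i ∣ j - 1 ∧
      p ^ i * Nat.gcd (p ^ w) (j - 1) ∣ p ^ x * Nat.gcd (j - 1) (p ^ (v + w))) then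
      Nat.totient (p ^ i) else 0

lemma Loc.Zs_eq_Es (H : Loc p M v w x τ) (hj : 1 ≤ j) :
    Zs p M v w x τ j 1 = Es p v w x τ j := by
  have hτ : 1 ≤ τ := by have := H.two_le; omega
  unfold Zs
  rw [Finset.sum_eq_single 1]
  · unfold Es
    refine Finset.sum_congr rfl fun i _ => ?_
    have : ZCond p v w x τ j 1 1 i ↔ (p ^ i ∣ τ - 1 ∧ p ^ i ∣ j - 1 ∧
      p ^ i * Nat.gcd (p ^ w) (j - 1) ∣ p ^ x * Nat.gcd (j - 1) (p ^ (v + w))) := by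
      unfold ZCond
      rw [one_mul, Nat.div_one, ← modEq_one_iff_dvd hτ, ← modEq_one_iff_dvd hj]
      have h1 : IsPer τ (p ^ i) 1 ↔ τ ≡ 1 [MOD p ^ i] := by
        refine ⟨fun h => by simpa using (h 1).2 (one_dvd _), fun h a => ?_⟩
        simpa using h.pow a
      rw [h1]
      refine and_congr_right fun h2 => and_congr_left fun _ => ?_
      refine ⟨fun ⟨a, ha⟩ => ha.trans (by simpa using h2.pow a), fun h => ⟨0, by simpa using h⟩⟩
    by_cases hz : ZCond p v w x τ j 1 1 i
    · rw [if_pos hz, if_pos (this.1 hz)]; simp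
    · rw [if_neg hz, if_neg fun h => hz (this.2 h)]
  · intro c hc hc1
    refine Finset.sum_eq_zero fun i _ => if_neg fun h => ?_
    have h1 : τ ≡ 1 [MOD c * p ^ i] := by simpa using (h.1 1).2 (one_dvd _)
    obtain ⟨ℓ, hℓ, hℓc⟩ := Nat.exists_prime_and_dvd hc1
    exact H.move ℓ hℓ (hℓc.trans (Nat.dvd_of_mem_divisors hc))
      (h1.of_dvd (hℓc.trans (dvd_mul_right _ _)))
  · intro h
    exact absurd (Nat.mem_divisors.2 ⟨one_dvd _, H.M_pos.ne'⟩) h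

end ZsLemmas

lemma exists_coprime_part {M : ℕ} (X : ℕ) (hX : 0 < X) :
    ∃ R Q, X = R * Q ∧ Nat.Coprime R M ∧ ∀ ℓ, ℓ.Prime → ℓ ∣ Q → ℓ ∣ M := by
  induction X using Nat.strong_induction_on with
  | _ X ih =>
    by_cases h : Nat.Coprime X M
    · refine ⟨X, 1, by simp, h, fun ℓ hℓ h1 => ?_⟩
      exact absurd (Nat.dvd_one.1 h1) hℓ.one_lt.ne'
    · obtain ⟨ℓ, hℓ, ⟨Y, rfl⟩, hlM⟩ := Nat.Prime.not_coprime_iff_dvd.1 h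
      have hY : 0 < Y := Nat.pos_of_mul_pos_left hX
      obtain ⟨R, Q, rfl, h1, h2⟩ := ih Y (by nlinarith [hℓ.two_le]) hY
      refine ⟨R, ℓ * Q, by ring, h1, fun q hq hd => ?_⟩
      rcases (Nat.Prime.dvd_mul hq).1 hd with h3 | h3
      · rwa [(Nat.prime_dvd_prime_iff_eq hq hℓ).1 h3]
      · exact h2 q hq h3

/-- The arithmetic consequence of an isomorphism of rational group algebras. -/
def SameW (m n s t m' n' s' t' : ℕ) : Prop :=
  m * n = m' * n' ∧ ∀ f j, 0 < f → 1 ≤ j → Nat.Coprime j (m * n) →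
    W m n s t f j = W m' n' s' t' f j

lemma SameW.symm {m n s t m' n' s' t' : ℕ} (h : SameW m n s t m' n' s' t') :
    SameW m' n' s' t' m n s t :=
  ⟨h.1.symm, fun f j hf hj hc => (h.2 f j hf hj (by rwa [h.1])).symm⟩

lemma SameW.pSum {m n s t m' n' s' t' : ℕ} (h : SameW m n s t m' n' s' t') {p k j : ℕ}
    (hj : 1 ≤ j) (hc : Nat.Coprime j (m * n)) :
    pSum p (m * n) k j (fun f => W m n s t f j) =
      pSum p (m' * n') k j (fun f => W m' n' s' t' f j) := by
  rw [← h.1]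
  unfold ArXiv230800432.pSum
  refine Finset.sum_congr rfl fun f hf => ?_
  simp only [h.2 f j (Nat.pos_of_mem_divisors hf) hj hc]

/-- Two local data with the same local invariants. -/
structure LocEq (p M v w x τ v' w' x' τ' : ℕ) : Prop where
  left : Loc p M v w x τ
  right : Loc p M v' w' x' τ'
  sum_eq : v + w = v' + w'
  gcd_eq : ∀ k, p ^ w * Nat.gcd (p ^ v) (τ ^ p ^ k - 1) =
    p ^ w' * Nat.gcd (p ^ v') (τ' ^ p ^ k - 1)
  ord_eq : ∀ k c, c ∣ M → (τ ^ p ^ k ≡ 1 [MOD c] ↔ τ' ^ p ^ k ≡ 1 [MOD c])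
  Zs_eq : ∀ k j, 1 ≤ j → j ≡ 1 [MOD p] → (∃ K, j ^ p ^ K ≡ 1 [MOD M]) →
    (∀ ℓ, ℓ.Prime → ℓ ∣ M → ¬ ℓ ∣ j - 1) →
    Nat.gcd (p ^ w / p ^ k) (j - 1) * Zs p M v w x τ j (p ^ k) =
      Nat.gcd (p ^ w' / p ^ k) (j - 1) * Zs p M v' w' x' τ' j (p ^ k)
  Es_eq : ∀ j, 1 ≤ j → j ≡ 1 [MOD p] →
    Nat.gcd (p ^ w) (j - 1) * Es p v w x τ j = Nat.gcd (p ^ w') (j - 1) * Es p v' w' x' τ' j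

lemma LocEq.symm {p M v w x τ v' w' x' τ' : ℕ} (h : LocEq p M v w x τ v' w' x' τ') :
    LocEq p M v' w' x' τ' v w x τ where
  left := h.right
  right := h.left
  sum_eq := h.sum_eq.symm
  gcd_eq k := (h.gcd_eq k).symm
  ord_eq k c hc := (h.ord_eq k c hc).symm
  Zs_eq k j h1 h2 h3 h4 := (h.Zs_eq k j h1 h2 h3 h4).symm
  Es_eq j h1 h2 := (h.Es_eq j h1 h2).symm


lemma pow_pow_modEq_one_of_modEq {p j : ℕ} (h : j ≡ 1 [MOD p]) (v : ℕ) :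
    j ^ p ^ v ≡ 1 [MOD p ^ v] := by
  have h2 := dvd_sub_pow_of_dvd_sub (R := ℤ) (p := p) (a := 1) (b := j)
    (by have := (Nat.modEq_iff_dvd).1 h; simpa using this) v
  refine Nat.modEq_iff_dvd.2 ?_
  push_cast
  simpa using (pow_dvd_pow (p : ℤ) (Nat.le_succ v)).trans h2

lemma pow_modEq_one_mono {p j K K' d : ℕ} (h : j ^ p ^ K ≡ 1 [MOD d]) (hK : K ≤ K') :
    j ^ p ^ K' ≡ 1 [MOD d] := by
  obtain ⟨e, rfl⟩ := Nat.exists_eq_add_of_le hK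
  rw [pow_add, pow_mul]
  simpa using h.pow _

section Main

variable {p m n s t v w x M L n₁ s₁ τ m' n' s' t' v' w' x' M' L' n₁' s₁' τ' : ℕ}

lemma Split.cN (S : Split p m n s t v w x M L n₁ s₁ τ) : Nat.Coprime p (n₁ * (M * L)) :=
  S.cn.mul_right (S.cM.mul_right S.cL)

lemma Split.mn (S : Split p m n s t v w x M L n₁ s₁ τ) :
    m * n = p ^ (v + w) * (n₁ * (M * L)) := by
  rw [S.hm, S.hn]; ring

lemma pow_mul_cancel (hp : p.Prime) {a b X Y : ℕ} (hX : Nat.Coprime p X) (hY : Nat.Coprime p Y)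
    (h : p ^ a * X = p ^ b * Y) : a = b ∧ X = Y := by
  have h1 : a = b := by
    apply Nat.le_antisymm
    · rw [← Nat.pow_dvd_pow_iff_le_right hp.one_lt]
      exact (Nat.Coprime.pow_left _ hY).dvd_of_dvd_mul_right ⟨X, h.symm⟩
    · rw [← Nat.pow_dvd_pow_iff_le_right hp.one_lt]
      exact (Nat.Coprime.pow_left _ hX).dvd_of_dvd_mul_right ⟨Y, h⟩
  subst h1
  exact ⟨rfl, Nat.eq_of_mul_eq_mul_left (pow_pos hp.pos a) h⟩

lemma Split.adm_one (_ : Split p m n s t v w x M L n₁ s₁ τ) :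
    Adm p m n₁ M L 1 (n₁ * (M * L)) 1 where
  hRQ := by ring
  cRQ := by simp
  one_le := le_rfl
  hR := by simp
  hQ := by simp
  hL := by simp
  ppow := ⟨0, by simp; rfl⟩

lemma Split.sum_one (S : Split p m n s t v w x M L n₁ s₁ τ) (A : Arith m n s t) (K : ℕ) :
    (∑ k ∈ Finset.range (K + 1), p ^ k * pSum p (m * n) k 1 (fun f => W m n s t f 1)) =
      (n₁ * L * Nat.gcd M (τ ^ p ^ K - 1)) * (p ^ w * Nat.gcd (p ^ v) (τ ^ p ^ K - 1)) := by
  have h := (S.loc A).sum_Zs_one K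
  rw [show (n₁ * L * Nat.gcd M (τ ^ p ^ K - 1)) * (p ^ w * Nat.gcd (p ^ v) (τ ^ p ^ K - 1)) =
    n₁ * L * (p ^ w * (Nat.gcd M (τ ^ p ^ K - 1) * Nat.gcd (p ^ v) (τ ^ p ^ K - 1))) by ring, ← h,
    Finset.mul_sum]
  refine Finset.sum_congr rfl fun k _ => ?_
  rw [S.pSum_eq A S.adm_one]
  simp
  ring

lemma Split.gcds_eq (S : Split p m n s t v w x M L n₁ s₁ τ) (A : Arith m n s t)
    (S' : Split p m' n' s' t' v' w' x' M' L' n₁' s₁' τ') (A' : Arith m' n' s' t')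
    (h : SameW m n s t m' n' s' t') (K : ℕ) :
    n₁ * L * Nat.gcd M (τ ^ p ^ K - 1) = n₁' * L' * Nat.gcd M' (τ' ^ p ^ K - 1) ∧
    p ^ w * Nat.gcd (p ^ v) (τ ^ p ^ K - 1) = p ^ w' * Nat.gcd (p ^ v') (τ' ^ p ^ K - 1) := by
  have h1 := S.sum_one A K
  rw [Finset.sum_congr rfl fun k _ => by rw [h.pSum le_rfl (by simp)], S'.sum_one A' K] at h1
  obtain ⟨a, ha, ha'⟩ := (Nat.dvd_prime_pow S.prime).1 (Nat.gcd_dvd_left (p ^ v) (τ ^ p ^ K - 1))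
  obtain ⟨b, hb, hb'⟩ := (Nat.dvd_prime_pow S.prime).1 (Nat.gcd_dvd_left (p ^ v') (τ' ^ p ^ K - 1))
  rw [ha', hb', ← pow_add, ← pow_add] at h1 ⊢
  have c1 : Nat.Coprime p (n₁ * L * Nat.gcd M (τ ^ p ^ K - 1)) :=
    (S.cn.mul_right S.cL).mul_right (S.cM.coprime_dvd_right (Nat.gcd_dvd_left _ _))
  have c2 : Nat.Coprime p (n₁' * L' * Nat.gcd M' (τ' ^ p ^ K - 1)) :=
    (S'.cn.mul_right S'.cL).mul_right (S'.cM.coprime_dvd_right (Nat.gcd_dvd_left _ _))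
  have := pow_mul_cancel S.prime c2 c1 (by rw [mul_comm, h1, mul_comm])
  exact ⟨this.2.symm, by rw [this.1]⟩

lemma Split.gcd_move (S : Split p m n s t v w x M L n₁ s₁ τ) (A : Arith m n s t) :
    Nat.gcd M (τ - 1) = 1 := by
  by_contra h
  obtain ⟨ℓ, hℓ, hd⟩ := Nat.exists_prime_and_dvd h
  have h1 : 1 ≤ τ := by have := (S.loc A).two_le; omega
  exact S.move ℓ hℓ (hd.trans (Nat.gcd_dvd_left _ _))
    ((modEq_one_iff_dvd h1).2 (hd.trans (Nat.gcd_dvd_right _ _)))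

lemma Split.parts_eq (S : Split p m n s t v w x M L n₁ s₁ τ) (A : Arith m n s t)
    (S' : Split p m' n' s' t' v' w' x' M' L' n₁' s₁' τ') (A' : Arith m' n' s' t')
    (h : SameW m n s t m' n' s' t') :
    v + w = v' + w' ∧ n₁ * L = n₁' * L' ∧ M = M' := by
  have h1 := (S.gcds_eq A S' A' h 0).1
  rw [pow_zero, pow_one, pow_one, S.gcd_move A, S'.gcd_move A', mul_one, mul_one] at h1
  have h2 := h.1
  rw [S.mn, S'.mn] at h2
  obtain ⟨h3, h4⟩ := pow_mul_cancel S.prime S.cN S'.cN h2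
  refine ⟨h3, h1, ?_⟩
  rw [show n₁ * (M * L) = n₁ * L * M by ring, show n₁' * (M' * L') = n₁' * L' * M' by ring, h1] at h4
  exact Nat.eq_of_mul_eq_mul_left (Nat.mul_pos (S'.n₁_pos A') (S'.L_pos A')) h4

lemma Split.adm_star (S : Split p m n s t v w x M L n₁ s₁ τ) {R Q j : ℕ}
    (hRQ : n₁ * (M * L) = R * Q) (hRM : Nat.Coprime R M)
    (hQM : ∀ ℓ, ℓ.Prime → ℓ ∣ Q → ℓ ∣ M) (hj : 1 ≤ j) (hjp : j ≡ 1 [MOD p])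
    (hjM : ∃ K, j ^ p ^ K ≡ 1 [MOD M]) (hjl : ∀ ℓ, ℓ.Prime → ℓ ∣ M → ¬ ℓ ∣ j - 1)
    (hjR : j ≡ 1 [MOD R]) :
    Adm p m n₁ M L j R Q ∧ Nat.gcd n₁ (j - 1) * L = R ∧ Nat.Coprime j (m * n) := by
  have hLQ : Nat.Coprime L Q := Nat.coprime_of_dvd fun ℓ hℓ h1 h2 =>
    hℓ.one_lt.ne' (Nat.dvd_one.1 (S.cML ▸ Nat.dvd_gcd (hQM ℓ hℓ h2) h1))
  have hLR : L ∣ R := hLQ.dvd_of_dvd_mul_right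
    (by rw [← hRQ]; exact (dvd_mul_left _ _).trans (dvd_mul_left _ _))
  have B : Adm p m n₁ M L j R Q :=
    { hRQ := hRQ
      cRQ := Nat.coprime_of_dvd fun ℓ hℓ h1 h2 =>
        hℓ.one_lt.ne' (Nat.dvd_one.1 (hRM ▸ Nat.dvd_gcd h1 (hQM ℓ hℓ h2)))
      one_le := hj
      hR := (modEq_one_iff_dvd hj).1 hjR
      hQ := Nat.coprime_of_dvd fun ℓ hℓ h1 h2 => hjl ℓ hℓ (hQM ℓ hℓ h1) h2
      hL := hLR.trans ((modEq_one_iff_dvd hj).1 hjR)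
      ppow := by
        obtain ⟨K, hK⟩ := hjM
        refine ⟨K + v, ?_⟩
        rw [S.hm, ← Nat.modEq_and_modEq_iff_modEq_mul
          (Nat.Coprime.pow_left _ (S.cM.mul_right S.cL)),
          ← Nat.modEq_and_modEq_iff_modEq_mul S.cML]
        refine ⟨pow_modEq_one_mono (pow_pow_modEq_one_of_modEq hjp v) (by omega),
          pow_modEq_one_mono hK (by omega), ?_⟩
        simpa using (hjR.of_dvd hLR).pow (p ^ (K + v)) }
  refine ⟨B, ?_, ?_⟩
  · have h1 := gcd_mul_gcd (x := n₁) (y := M * L) B.cRQ B.hQ B.hR (dvd_of_eq hRQ)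
    rw [gcd_eq_gcd_R B.hQ B.hR (x := n₁ * (M * L)) (dvd_of_eq hRQ), hRQ,
      Nat.gcd_eq_right (dvd_mul_right R Q), gcd_eq_gcd_R B.hQ B.hR (x := M * L)
        (by rw [← hRQ]; exact dvd_mul_left _ _),
      Nat.Coprime.gcd_mul_left_cancel _ hRM.symm, Nat.gcd_eq_left hLR] at h1
    exact h1
  · apply Nat.coprime_of_dvd
    intro ℓ hℓ h1 h2
    have key : ∀ d i, ℓ ∣ d → ¬ j ^ i ≡ 1 [MOD d] ∨ i = 0 := by
      intro d i hd
      by_contra! h3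
      have h4 : j ^ i ≡ 1 [MOD ℓ] := h3.1.of_dvd hd
      have h5 : j ^ i ≡ 0 [MOD ℓ] := (Nat.modEq_zero_iff_dvd).2 (dvd_pow h1 h3.2)
      exact hℓ.one_lt.ne' (Nat.dvd_one.1 ((Nat.modEq_zero_iff_dvd).1 (h4.symm.trans h5)))
    rw [S.mn, hRQ] at h2
    rcases (Nat.Prime.dvd_mul hℓ).1 h2 with h3 | h3
    · rcases key p 1 (hℓ.dvd_of_dvd_pow h3) with h4 | h4
      · exact h4 (by simpa using hjp)
      · omega
    · rcases (Nat.Prime.dvd_mul hℓ).1 h3 with h4 | h4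
      · rcases key R 1 h4 with h4 | h4
        · exact h4 (by simpa using hjR)
        · omega
      · obtain ⟨K, hK⟩ := hjM
        rcases key M (p ^ K) (hQM ℓ hℓ h4) with h4 | h4
        · exact h4 hK
        · exact (pow_pos S.prime.pos K).ne' h4

lemma exists_modEq_pair {a b j : ℕ} (h : Nat.Coprime a b) (ha : 0 < a) (hb : 0 < b) :
    ∃ j', 1 ≤ j' ∧ j ≡ j' [MOD a] ∧ j' ≡ 1 [MOD b] := by
  obtain ⟨z, hz1, hz2⟩ := Nat.chineseRemainder h j 1
  refine ⟨z + a * b, ?_, ?_, ?_⟩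
  · have := Nat.mul_pos ha hb; omega
  · refine hz1.symm.trans ?_
    simp [Nat.ModEq]
  · refine Nat.ModEq.trans ?_ hz2
    simp [Nat.ModEq]

lemma Loc.one (H : Loc p M v w x τ) : Loc p 1 v w x τ where
  prime := H.prime
  M_pos := one_pos
  cM := by simp
  two_le := H.two_le
  pow_w := H.pow_w.of_dvd ⟨M, by ring⟩
  x_le := H.x_le
  fix := H.fix
  move ℓ hℓ h := absurd (Nat.dvd_one.1 h) hℓ.one_lt.ne'
  modp := H.modp

lemma Loc.Zs_eq_zero (H : Loc p M v w x τ) {j k : ℕ} (hk : w < k) :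
    Zs p M v w x τ j (p ^ k) = 0 := by
  refine Finset.sum_eq_zero fun c hc => Finset.sum_eq_zero fun i hi => if_neg fun h => ?_
  have hci : c * p ^ i ∣ M * p ^ v :=
    mul_dvd_mul (Nat.dvd_of_mem_divisors hc)
      (pow_dvd_pow _ (by rw [Finset.mem_range] at hi; omega))
  obtain ⟨k', hk', hper⟩ := H.exists_per hci
  have := Nat.pow_right_injective H.prime.two_le (h.1.unique hper)
  omega

lemma Loc.Zs_congr (H : Loc p M v w x τ) {j j' k : ℕ} (hj : 1 ≤ j) (hj' : 1 ≤ j')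
    (h : j ≡ j' [MOD M * p ^ (v + w)]) :
    Nat.gcd (p ^ w / p ^ k) (j - 1) * Zs p M v w x τ j (p ^ k) =
      Nat.gcd (p ^ w / p ^ k) (j' - 1) * Zs p M v w x τ j' (p ^ k) := by
  rcases le_or_gt k w with hk | hk
  · exact ArXiv230800432.Zs_congr hj hj' h (pow_dvd_pow _ hk)
  · rw [H.Zs_eq_zero hk, H.Zs_eq_zero hk]; simp

theorem Split.locEq (S : Split p m n s t v w x M L n₁ s₁ τ) (A : Arith m n s t)
    (S' : Split p m' n' s' t' v' w' x' M' L' n₁' s₁' τ') (A' : Arith m' n' s' t')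
    (h : SameW m n s t m' n' s' t') : M = M' ∧ LocEq p M v w x τ v' w' x' τ' := by
  obtain ⟨hvw, hnL, rfl⟩ := S.parts_eq A S' A' h
  have hp := S.prime.pos
  have hM := S.M_pos A
  have hNp : n₁ * (M * L) = n₁' * (M * L') := by
    rw [show n₁ * (M * L) = n₁ * L * M by ring, hnL]; ring
  have hNpos : 0 < n₁ * (M * L) := Nat.mul_pos (S.n₁_pos A) (Nat.mul_pos hM (S.L_pos A))
  have H := S.loc A
  have H' := S'.loc A'
  have hcop := H.cop
  have hcop' := H'.cop
  refine ⟨rfl, H, H', hvw, fun K => (S.gcds_eq A S' A' h K).2, ?_, ?_, ?_⟩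
  · intro K c hc
    have h1 := (S.gcds_eq A S' A' h K).1
    rw [hnL] at h1
    have h2 := Nat.eq_of_mul_eq_mul_left (Nat.mul_pos (S'.n₁_pos A') (S'.L_pos A')) h1
    rw [modEq_one_iff_dvd (Nat.one_le_pow _ _ (by have := H.two_le; omega)),
      modEq_one_iff_dvd (Nat.one_le_pow _ _ (by have := H'.two_le; omega))]
    constructor
    · intro h3
      exact ((h2 ▸ Nat.dvd_gcd hc h3 : c ∣ _)).trans (Nat.gcd_dvd_right _ _)
    · intro h3
      exact ((h2.symm ▸ Nat.dvd_gcd hc h3 : c ∣ _)).trans (Nat.gcd_dvd_right _ _)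
  · intro k j hj hjp hjM hjl
    obtain ⟨R, Q, hRQ, hRM, hQM⟩ := exists_coprime_part (M := M) _ hNpos
    have hRpos : 0 < R := Nat.pos_of_mul_pos_right (by rw [← hRQ]; exact hNpos)
    have hRp : Nat.Coprime p R := S.cN.coprime_dvd_right ⟨Q, hRQ⟩
    obtain ⟨j', hj1, hjj, hjR⟩ := exists_modEq_pair (j := j) (a := M * p ^ (v + w + 1)) (b := R)
      (Nat.Coprime.mul_left hRM.symm (Nat.Coprime.pow_left _ hRp)) (by positivity) hRpos
    have hjj1 : j ≡ j' [MOD M * p ^ (v + w)] :=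
      hjj.of_dvd (mul_dvd_mul dvd_rfl (pow_dvd_pow _ (by omega)))
    have hjj2 : j ≡ j' [MOD p] :=
      hjj.of_dvd ((dvd_pow_self p (by omega)).trans (dvd_mul_left _ _))
    have hjj3 : j ≡ j' [MOD M] := hjj.of_dvd (dvd_mul_right _ _)
    have hjM' : ∃ K, j' ^ p ^ K ≡ 1 [MOD M] :=
      hjM.imp fun K hK => (hjj3.symm.pow _).trans hK
    have hjl' : ∀ ℓ, ℓ.Prime → ℓ ∣ M → ¬ ℓ ∣ j' - 1 := fun ℓ hℓ h1 h2 => hjl ℓ hℓ h1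
      (((pred_modEq hj hj1 hjj3).of_dvd h1).dvd_iff dvd_rfl |>.2 h2)
    have hjp' : j' ≡ 1 [MOD p] := hjj2.symm.trans hjp
    obtain ⟨B, hB, hBc⟩ := S.adm_star hRQ hRM hQM hj1 hjp' hjM' hjl' hjR
    obtain ⟨B', hB', -⟩ := S'.adm_star (hNp ▸ hRQ) hRM hQM hj1 hjp' hjM' hjl' hjR
    have h1 := h.pSum (p := p) (k := k) hj1 hBc
    rw [S.pSum_eq A B, S'.pSum_eq A' B', hB, hB'] at h1
    have h2 := Nat.eq_of_mul_eq_mul_left hRpos h1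
    rw [H.Zs_congr hj hj1 hjj1, h2, H'.Zs_congr hj hj1 (by rw [← hvw]; exact hjj1)]
  · intro j hj hjp
    obtain ⟨j', hj1, hjj, hjR⟩ := exists_modEq_pair (j := j) (a := p ^ (v + w + 1))
      (b := n₁ * (M * L)) (Nat.Coprime.pow_left _ S.cN) (by positivity) hNpos
    have hjp' : j' ≡ 1 [MOD p] := 
      (hjj.of_dvd (dvd_pow_self p (by omega))).symm.trans hjp
    have hadm : ∀ {m n s t v w x L n₁ s₁ τ : ℕ} (S : Split p m n s t v w x M L n₁ s₁ τ),
        j' ≡ 1 [MOD n₁ * (M * L)] → Adm p m n₁ M L j' (n₁ * (M * L)) 1 := by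
      intro m n s t v w x L n₁ s₁ τ S hjR
      have h1 := (modEq_one_iff_dvd hj1).1 hjR
      refine ⟨by ring, by simp, hj1, h1, by simp,
        ((dvd_mul_left _ _).trans (dvd_mul_left _ _)).trans h1, v, ?_⟩
      rw [S.hm, ← Nat.modEq_and_modEq_iff_modEq_mul
          (Nat.Coprime.pow_left _ (S.cM.mul_right S.cL))]
      refine ⟨pow_pow_modEq_one_of_modEq hjp' v, ?_⟩
      simpa using (hjR.of_dvd (dvd_mul_left _ _)).pow (p ^ v)
    have B := hadm S hjR
    have B' := hadm S' (hNp ▸ hjR)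
    have hc : Nat.Coprime j' (m * n) := by
      rw [S.mn]
      refine Nat.Coprime.mul_right (Nat.Coprime.pow_right _ ?_) ?_
      · rw [Nat.coprime_iff_gcd_eq_one, hjp'.gcd_eq]; simp
      · rw [Nat.coprime_iff_gcd_eq_one, hjR.gcd_eq]; simp
    have h1 := h.pSum (p := p) (k := 0) hj1 hc
    rw [S.pSum_eq A B, S'.pSum_eq A' B', Nat.gcd_eq_left ((dvd_mul_right _ _).trans B.hR),
      Nat.gcd_eq_left ((dvd_mul_right _ _).trans B'.hR), hnL, pow_zero, Nat.div_one, Nat.div_one,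
      H.Zs_eq_Es hj1, H'.Zs_eq_Es hj1] at h1
    have h2 := Nat.eq_of_mul_eq_mul_left (Nat.mul_pos (S'.n₁_pos A') (S'.L_pos A')) h1
    have h3 : j ≡ j' [MOD 1 * p ^ (v + w)] :=
      hjj.of_dvd (by rw [one_mul]; exact pow_dvd_pow _ (by omega))
    have e1 := H.one.Zs_congr (k := 0) hj hj1 h3
    have e2 := H'.one.Zs_congr (k := 0) hj hj1 (by rw [← hvw]; exact h3)
    rw [pow_zero, Nat.div_one, H.one.Zs_eq_Es hj, H.one.Zs_eq_Es hj1] at e1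
    rw [pow_zero, Nat.div_one, H'.one.Zs_eq_Es hj, H'.one.Zs_eq_Es hj1] at e2
    rw [e1, h2, e2]

end Main

/-- `p ^ e` exactly divides `J`. -/
def ExactDvd (p e J : ℕ) : Prop := ∀ i, p ^ i ∣ J ↔ i ≤ e

lemma ExactDvd.gcd_eq {p e J : ℕ} (h : ExactDvd p e J) (hp : p.Prime) (a : ℕ) :
    Nat.gcd (p ^ a) J = p ^ min a e := by
  obtain ⟨b, hb, hb'⟩ := (Nat.dvd_prime_pow hp).1 (Nat.gcd_dvd_left (p ^ a) J)
  rw [hb']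
  congr 1
  apply le_antisymm
  · refine le_min hb ((h b).1 ?_)
    rw [← hb']; exact Nat.gcd_dvd_right _ _
  · rw [← Nat.pow_dvd_pow_iff_le_right hp.one_lt, ← hb']
    exact Nat.dvd_gcd (pow_dvd_pow _ (min_le_left _ _)) ((h _).2 (min_le_right _ _))

lemma ExactDvd.of_modEq {p e j j' : ℕ} (h : ExactDvd p e (j - 1)) (hj : 1 ≤ j) (hj' : 1 ≤ j')
    (hjj : j ≡ j' [MOD p ^ (e + 1)]) : ExactDvd p e (j' - 1) := by
  have h1 := pred_modEq hj hj' hjj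
  have key : ∀ i ≤ e + 1, (p ^ i ∣ j' - 1 ↔ i ≤ e) := by
    intro i hi
    rw [← h i]
    exact ((h1.of_dvd (pow_dvd_pow p hi)).dvd_iff dvd_rfl).symm
  intro i
  rcases le_or_gt i (e + 1) with hi | hi
  · exact key i hi
  · refine ⟨fun h2 => ?_, fun h2 => by omega⟩
    have := (key (e + 1) le_rfl).1 ((pow_dvd_pow p hi.le).trans h2)
    omega

section Max

variable {p M v w x τ x' τ' e π c i j : ℕ}

lemma zcond_exp (hp : p.Prime) (hJ : ExactDvd p e (j - 1)) (hπ : π ≤ w) :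
    p ^ i * Nat.gcd (p ^ w / p ^ π) (j - 1) ∣ p ^ x * Nat.gcd (j - 1) (p ^ (v + w)) ↔
      i + min (w - π) e ≤ x + min e (v + w) := by
  rw [Nat.pow_div hπ hp.pos, hJ.gcd_eq hp, Nat.gcd_comm, hJ.gcd_eq hp, ← pow_add, ← pow_add,
    Nat.pow_dvd_pow_iff_le_right hp.one_lt, min_comm (v + w)]

/-- The index set of the local sum at its maximal value. -/
def TCond (p v w x τ e π c i : ℕ) : Prop :=
  IsPer τ (c * p ^ i) (p ^ π) ∧ i + min (w - π) e ≤ x + min e (v + w)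

/-- The maximal value of the local sum. -/
def TSum (p M v w x τ e π : ℕ) : ℕ :=
  ∑ c ∈ M.divisors, ∑ i ∈ Finset.range (v + 1),
    if TCond p v w x τ e π c i then Nat.totient c * Nat.totient (p ^ i) else 0

lemma zcond_iff (hp : p.Prime) (hJ : ExactDvd p e (j - 1)) (hπ : π ≤ w) :
    ZCond p v w x τ j (p ^ π) c i ↔ TCond p v w x τ e π c i ∧ ∃ a, j ≡ τ ^ a [MOD c * p ^ i] := by
  unfold ZCond TCond
  rw [zcond_exp hp hJ hπ]
  tauto

lemma Zs_le_TSum (hp : p.Prime) (hJ : ExactDvd p e (j - 1)) (hπ : π ≤ w) :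
    Zs p M v w x τ j (p ^ π) ≤ TSum p M v w x τ e π := by
  unfold Zs TSum
  refine Finset.sum_le_sum fun c hc => Finset.sum_le_sum fun i hi => ?_
  have := zcond_iff (v := v) (x := x) (τ := τ) (c := c) (i := i) hp hJ hπ
  by_cases h : ZCond p v w x τ j (p ^ π) c i
  · rw [if_pos h, if_pos (this.1 h).1]
  · rw [if_neg h]; exact Nat.zero_le _

lemma Zs_eq_TSum (hp : p.Prime) (hJ : ExactDvd p e (j - 1)) (hπ : π ≤ w)
    (hj : j ≡ τ [MOD M * p ^ v]) :
    Zs p M v w x τ j (p ^ π) = TSum p M v w x τ e π := by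
  unfold Zs TSum
  refine Finset.sum_congr rfl fun c hc => Finset.sum_congr rfl fun i hi => ?_
  have := zcond_iff (v := v) (x := x) (τ := τ) (c := c) (i := i) hp hJ hπ
  have h1 : ∃ a, j ≡ τ ^ a [MOD c * p ^ i] := ⟨1, by
    rw [pow_one]
    exact hj.of_dvd (mul_dvd_mul (Nat.dvd_of_mem_divisors hc)
      (pow_dvd_pow _ (by rw [Finset.mem_range] at hi; omega)))⟩
  by_cases h : ZCond p v w x τ j (p ^ π) c i
  · rw [if_pos h, if_pos (this.1 h).1]
  · rw [if_neg h, if_neg fun h2 => h (this.2 ⟨h2, h1⟩)]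

lemma term_le_of_sum_le {s : Finset ℕ} {r : Finset ℕ} {f g : ℕ → ℕ → ℕ}
    (hfg : ∀ c ∈ s, ∀ i ∈ r, f c i ≤ g c i)
    (h : ∑ c ∈ s, ∑ i ∈ r, g c i ≤ ∑ c ∈ s, ∑ i ∈ r, f c i) {c i : ℕ} (hc : c ∈ s) (hi : i ∈ r) :
    g c i ≤ f c i := by
  by_contra! hlt
  have h1 : ∑ c ∈ s, ∑ i ∈ r, f c i < ∑ c ∈ s, ∑ i ∈ r, g c i := by
    refine Finset.sum_lt_sum (fun c hc => Finset.sum_le_sum fun i hi => hfg c hc i hi) ⟨c, hc, ?_⟩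
    exact Finset.sum_lt_sum (fun i hi => hfg c hc i hi) ⟨i, hi, hlt⟩
  omega

lemma mem_of_TSum_le (hp : p.Prime) (hJ : ExactDvd p e (j - 1)) (hπ : π ≤ w)
    (h : TSum p M v w x τ e π ≤ Zs p M v w x τ j (p ^ π)) (hM : 0 < M) (hc : c ∣ M) (hi : i ≤ v)
    (hT : TCond p v w x τ e π c i) : ∃ a, j ≡ τ ^ a [MOD c * p ^ i] := by
  have := term_le_of_sum_le (fun c _ i _ => ?_) h (Nat.mem_divisors.2 ⟨hc, hM.ne'⟩)
    (Finset.mem_range.2 (Nat.lt_succ_of_le hi))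
  · rw [if_pos hT] at this
    by_contra hne
    rw [if_neg fun h => hne ((zcond_iff hp hJ hπ).1 h).2] at this
    have h1 := Nat.totient_pos.2 (Nat.pos_of_dvd_of_pos hc hM)
    have h2 := Nat.totient_pos.2 (pow_pos hp.pos i)
    have h3 := Nat.mul_pos h1 h2
    omega
  · have := zcond_iff (v := v) (x := x) (τ := τ) (c := c) (i := i) hp hJ hπ
    by_cases h : ZCond p v w x τ j (p ^ π) c i
    · rw [if_pos h, if_pos (this.1 h).1]
    · rw [if_neg h]; exact Nat.zero_le _

lemma TSum_strict (hp : p.Prime) (hM : 0 < M) (hx : x ≤ x')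
    (hper : ∀ c, c ∣ M → ∀ i ≤ v, (IsPer τ (c * p ^ i) (p ^ π) ↔ IsPer τ' (c * p ^ i) (p ^ π)))
    (h : TSum p M v w x' τ' e π ≤ TSum p M v w x τ e π) (hc : c ∣ M) (hi : i ≤ v) :
    TCond p v w x τ e π c i ↔ TCond p v w x' τ' e π c i := by
  have mono : ∀ c, c ∣ M → ∀ i ≤ v, TCond p v w x τ e π c i → TCond p v w x' τ' e π c i :=
    fun c hc i hi ⟨h1, h2⟩ => ⟨(hper c hc i hi).1 h1, by omega⟩
  refine ⟨mono c hc i hi, fun hT => ?_⟩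
  have := term_le_of_sum_le (fun c hc i hi => ?_) h (Nat.mem_divisors.2 ⟨hc, hM.ne'⟩)
    (Finset.mem_range.2 (Nat.lt_succ_of_le hi))
  · rw [if_pos hT] at this
    by_contra hne
    rw [if_neg hne] at this
    have h1 := Nat.totient_pos.2 (Nat.pos_of_dvd_of_pos hc hM)
    have h2 := Nat.totient_pos.2 (pow_pos hp.pos i)
    have h3 := Nat.mul_pos h1 h2
    omega
  · by_cases hT : TCond p v w x τ e π c i
    · rw [if_pos hT, if_pos (mono c (Nat.dvd_of_mem_divisors hc) i
        (by rw [Finset.mem_range] at hi; omega) hT)]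
    · rw [if_neg hT]; exact Nat.zero_le _

lemma isPer_congr (h : ∀ K, τ ^ p ^ K ≡ 1 [MOD c] ↔ τ' ^ p ^ K ≡ 1 [MOD c]) (hp : p.Prime)
    (hper : IsPer τ c (p ^ π)) (hper' : ∃ k, IsPer τ' c (p ^ k)) : IsPer τ' c (p ^ π) := by
  obtain ⟨k, hk⟩ := hper'
  have h1 : ∀ K, π ≤ K ↔ k ≤ K := fun K => by
    rw [← Nat.pow_dvd_pow_iff_le_right hp.one_lt, ← Nat.pow_dvd_pow_iff_le_right hp.one_lt,
      ← hper, ← hk, h]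
  have : π = k := le_antisymm ((h1 k).2 le_rfl) ((h1 π).1 le_rfl)
  rwa [this]

lemma dvd_gcd_pow_iff (hi : i ≤ v) (hτ : 2 ≤ τ) (K : ℕ) :
    τ ^ p ^ K ≡ 1 [MOD p ^ i] ↔ p ^ i ∣ Nat.gcd (p ^ v) (τ ^ p ^ K - 1) := by
  rw [modEq_one_iff_dvd (Nat.one_le_pow _ _ (by omega)), Nat.dvd_gcd_iff]
  exact ⟨fun h => ⟨pow_dvd_pow _ hi, h⟩, fun h => h.2⟩

lemma LocEq.modEq_iff (H : LocEq p M v w x τ v w x' τ') (hc : c ∣ M) (hi : i ≤ v) (K : ℕ) :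
    τ ^ p ^ K ≡ 1 [MOD c * p ^ i] ↔ τ' ^ p ^ K ≡ 1 [MOD c * p ^ i] := by
  have hcp : Nat.Coprime c (p ^ i) :=
    Nat.Coprime.pow_right _ (H.left.cM.coprime_dvd_right hc).symm
  rw [← Nat.modEq_and_modEq_iff_modEq_mul hcp, ← Nat.modEq_and_modEq_iff_modEq_mul hcp,
    H.ord_eq K c hc, dvd_gcd_pow_iff hi H.left.two_le, dvd_gcd_pow_iff hi H.right.two_le,
    Nat.eq_of_mul_eq_mul_left (pow_pos H.left.prime.pos w) (H.gcd_eq K)]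

lemma LocEq.isPer_imp (H : LocEq p M v w x τ v w x' τ') (hc : c ∣ M) (hi : i ≤ v)
    (h : IsPer τ (c * p ^ i) (p ^ π)) : IsPer τ' (c * p ^ i) (p ^ π) :=
  isPer_congr (H.modEq_iff hc hi) H.left.prime h
    ((H.right.exists_per (mul_dvd_mul hc (pow_dvd_pow _ hi))).imp fun _ h => h.2)

lemma LocEq.isPer_iff (H : LocEq p M v w x τ v w x' τ') (hc : c ∣ M) (hi : i ≤ v) :
    IsPer τ (c * p ^ i) (p ^ π) ↔ IsPer τ' (c * p ^ i) (p ^ π) :=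
  ⟨H.isPer_imp hc hi, H.symm.isPer_imp hc hi⟩

lemma LocEq.Zs_eq_of_lift {v' w' : ℕ} (H : LocEq p M v w x τ v' w' x' τ')
    (hj : 1 ≤ j) (he : 1 ≤ e) (hJ : ExactDvd p e (j - 1)) (hjτ : j ≡ τ [MOD M]) (π : ℕ) :
    Nat.gcd (p ^ w / p ^ π) (j - 1) * Zs p M v w x τ j (p ^ π) =
      Nat.gcd (p ^ w' / p ^ π) (j - 1) * Zs p M v' w' x' τ' j (p ^ π) := by
  refine H.Zs_eq π j hj ((modEq_one_iff_dvd hj).2 (by simpa using (hJ 1).2 he))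
    ⟨w, (hjτ.pow _).trans (H.left.pow_w.of_dvd (dvd_mul_right _ _))⟩ fun ℓ hℓ h1 h2 => ?_
  exact H.left.move ℓ hℓ h1 ((hjτ.of_dvd h1).symm.trans ((modEq_one_iff_dvd hj).2 h2))

theorem LocEq.maximal (H : LocEq p M v w x τ v w x' τ') (he : 1 ≤ e) (hπ : π ≤ w) {j j' : ℕ}
    (hj : 1 ≤ j) (hJ : ExactDvd p e (j - 1)) (hjτ : j ≡ τ [MOD M * p ^ v])
    (hj' : 1 ≤ j') (hJ' : ExactDvd p e (j' - 1)) (hjτ' : j' ≡ τ' [MOD M * p ^ v])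
    (hc : c ∣ M) (hi : i ≤ v) (hper : IsPer τ (c * p ^ i) (p ^ π)) :
    (i + min (w - π) e ≤ x + min e (v + w) ↔ i + min (w - π) e ≤ x' + min e (v + w)) ∧
    (i + min (w - π) e ≤ x + min e (v + w) → ∃ a, τ ≡ τ' ^ a [MOD c * p ^ i]) := by
  have hp := H.left.prime
  have hM := H.left.M_pos
  have hpos : ∀ J, 0 < Nat.gcd (p ^ w / p ^ π) J := fun J =>
    Nat.gcd_pos_of_pos_left _ (by rw [Nat.pow_div hπ hp.pos]; exact pow_pos hp.pos _)
  have e1 := Nat.eq_of_mul_eq_mul_left (hpos _)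
    (H.Zs_eq_of_lift hj he hJ (hjτ.of_dvd (dvd_mul_right _ _)) π)
  have e2 := Nat.eq_of_mul_eq_mul_left (hpos _)
    (H.symm.Zs_eq_of_lift hj' he hJ' (hjτ'.of_dvd (dvd_mul_right _ _)) π)
  rw [Zs_eq_TSum hp hJ hπ hjτ] at e1
  rw [Zs_eq_TSum hp hJ' hπ hjτ'] at e2
  have l1 := Zs_le_TSum (M := M) (v := v) (x := x') (τ := τ') hp hJ hπ
  have l2 := Zs_le_TSum (M := M) (v := v) (x := x) (τ := τ) hp hJ' hπ
  have hT : TCond p v w x τ e π c i ↔ TCond p v w x' τ' e π c i := by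
    rcases le_total x x' with hx | hx
    · exact TSum_strict hp hM hx (fun c hc i hi => H.isPer_iff hc hi) (by omega) hc hi
    · exact (TSum_strict hp hM hx (fun c hc i hi => H.symm.isPer_iff hc hi) (by omega) hc hi).symm
  have hper' := H.isPer_imp hc hi hper
  have h1 : i + min (w - π) e ≤ x + min e (v + w) ↔ i + min (w - π) e ≤ x' + min e (v + w) :=
    ⟨fun h => (hT.1 ⟨hper, h⟩).2, fun h => (hT.2 ⟨hper', h⟩).2⟩
  refine ⟨h1, fun h => ?_⟩
  obtain ⟨a, ha⟩ := mem_of_TSum_le hp hJ hπ (by omega) hM hc hi ⟨hper', h1.1 h⟩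
  exact ⟨a, (hjτ.of_dvd (mul_dvd_mul hc (pow_dvd_pow _ hi))).symm.trans ha⟩

end Max

/-- One step of lifting membership in a cyclic group of units along powers of `p`. -/
lemma exists_lift_step {p M i e τ y z : ℕ} (hp : p.Prime) (hM : Nat.Coprime p M) (hi : 1 ≤ i)
    (hτ : Nat.Coprime τ p) (h1 : τ ^ e ≡ 1 [MOD M * p ^ i]) (h2 : ¬ τ ^ e ≡ 1 [MOD p ^ (i + 1)])
    (hy : y ≡ τ ^ z [MOD M * p ^ i]) : ∃ z', y ≡ τ ^ z' [MOD M * p ^ (i + 1)] := by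
  have hτ0 : 1 ≤ τ ^ e := Nat.one_le_pow _ _ (Nat.pos_of_ne_zero fun h => by
    rw [h] at hτ; simp at hτ; exact hp.one_lt.ne' hτ)
  obtain ⟨u, hu⟩ := (modEq_one_iff_dvd hτ0).1 (h1.of_dvd (dvd_mul_left _ _))
  have hpu : ¬ p ∣ u := by
    rintro ⟨u', rfl⟩
    exact h2 ((modEq_one_iff_dvd hτ0).2 ⟨u', by rw [hu]; ring⟩)
  have hu' : τ ^ e = 1 + p ^ i * u := by omega
  have hbin : ∀ b, (1 + p ^ i * u) ^ b ≡ 1 + p ^ i * (u * b) [MOD p ^ (i + 1)] := by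
    intro b
    induction b with
    | zero => simp; rfl
    | succ b ih =>
      rw [pow_succ]
      refine (ih.mul_right _).trans ?_
      have h3 : (1 + p ^ i * (u * b)) * (1 + p ^ i * u) =
          (1 + p ^ i * (u * (b + 1))) + p ^ (i + 1) * (p ^ (i - 1) * (u * u * b)) := by
        obtain ⟨i, rfl⟩ := Nat.exists_eq_add_of_le' hi
        simp only [Nat.add_sub_cancel]
        ring
      rw [h3]
      simp [Nat.ModEq]
  -- the difference between `y` and `τ ^ z`
  have hy1 : y + p ^ (i + 1) * τ ^ z ≡ τ ^ z [MOD p ^ i] := by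
    have h4 : p ^ (i + 1) * τ ^ z ≡ 0 [MOD p ^ i] :=
      (Nat.modEq_zero_iff_dvd).2 ((pow_dvd_pow _ (by omega)).trans (dvd_mul_right _ _))
    simpa using (hy.of_dvd (dvd_mul_left _ _)).add h4
  have hle : τ ^ z ≤ y + p ^ (i + 1) * τ ^ z := by
    have := Nat.one_le_pow (i + 1) p hp.pos
    nlinarith [Nat.zero_le (τ ^ z)]
  obtain ⟨c, hc⟩ := (Nat.modEq_iff_dvd' hle).1 hy1.symm
  have hcop : Nat.gcd (u * τ ^ z) p = 1 :=
    Nat.Coprime.mul_left ((Nat.Prime.coprime_iff_not_dvd hp).2 hpu).symm (Nat.Coprime.pow_left _ hτ)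
  obtain ⟨b, hb⟩ := exists_mul_modEq_of_gcd_dvd (e := u * τ ^ z) (D := p) (i := c) hp.pos
    (by rw [hcop]; exact one_dvd _)
  have hMc : Nat.Coprime M (p ^ (i + 1)) := Nat.Coprime.pow_right _ hM.symm
  refine ⟨z + e * b, ?_⟩
  rw [← Nat.modEq_and_modEq_iff_modEq_mul hMc, pow_add, pow_mul]
  constructor
  · refine (hy.of_dvd (dvd_mul_right _ _)).trans ?_
    simpa using (((h1.of_dvd (dvd_mul_right _ _)).pow b).mul_left (τ ^ z)).symm
  · have h5 : τ ^ z * (τ ^ e) ^ b ≡ τ ^ z * (1 + p ^ i * (u * b)) [MOD p ^ (i + 1)] := by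
      rw [hu']; exact (hbin b).mul_left _
    refine Nat.ModEq.trans ?_ h5.symm
    have h6 : p ^ i * c ≡ p ^ i * (u * τ ^ z * b) [MOD p ^ (i + 1)] := by
      rw [pow_succ]; exact (hb.symm).mul_left' _
    have h7 : y + p ^ (i + 1) * τ ^ z = τ ^ z + p ^ i * c := by omega
    have h8 : y + p ^ (i + 1) * τ ^ z ≡ y [MOD p ^ (i + 1)] := by simp [Nat.ModEq]
    refine h8.symm.trans ?_
    rw [h7, show τ ^ z * (1 + p ^ i * (u * b)) = τ ^ z + p ^ i * (u * τ ^ z * b) by ring]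
    exact h6.add_left _

section TypeOne

variable {p M v w x τ v' w' x' τ' ρ ρ' κ a e j : ℕ}

/-- The `p`-adic valuations of `τ ^ p ^ K - 1` grow linearly from `ρ` on. -/
structure E1 (p v τ ρ : ℕ) : Prop where
  le : ρ ≤ v
  pos : v ≠ 0 → ρ ≠ 0
  iff : ∀ K i, i ≤ v → (τ ^ p ^ K ≡ 1 [MOD p ^ i] ↔ i ≤ ρ + K)

lemma E1.gcd_eq (E : E1 p v τ ρ) (hp : p.Prime) (hτ : 2 ≤ τ) (K : ℕ) :
    Nat.gcd (p ^ v) (τ ^ p ^ K - 1) = p ^ min v (ρ + K) := by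
  obtain ⟨b, hb, hb'⟩ := (Nat.dvd_prime_pow hp).1 (Nat.gcd_dvd_left (p ^ v) (τ ^ p ^ K - 1))
  rw [hb']
  have key : ∀ i ≤ v, i ≤ b ↔ i ≤ ρ + K := fun i hi => by
    rw [← E.iff K i hi, dvd_gcd_pow_iff hi hτ, hb', Nat.pow_dvd_pow_iff_le_right hp.one_lt]
  have h1 := (key b hb).1 le_rfl
  have h2 := (key (min v (ρ + K)) (min_le_left _ _)).2 (min_le_right _ _)
  congr 1
  omega

lemma exactDvd_one_add (hp : p.Prime) (a : ℕ) : ExactDvd p a (1 + p ^ a - 1) := fun i => by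
  rw [Nat.add_sub_cancel_left, Nat.pow_dvd_pow_iff_le_right hp.one_lt]

lemma E1.Es_eq (E : E1 p v τ ρ) (hp : p.Prime) (hτ : 2 ≤ τ) (hJ : ExactDvd p a (j - 1)) :
    Nat.gcd (p ^ w) (j - 1) * Es p v w x τ j =
      p ^ (min w a + min v (min ρ (min a (x + min a (v + w) - min w a)))) := by
  have h1 : Es p v w x τ j =
      Nat.gcd (p ^ v) (p ^ min v (min ρ (min a (x + min a (v + w) - min w a)))) := by
    rw [← sum_totient_pow_dvd hp]
    unfold Es
    refine Finset.sum_congr rfl fun i hi => ?_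
    rw [Finset.mem_range] at hi
    have hc : (p ^ i ∣ τ - 1 ∧ p ^ i ∣ j - 1 ∧
        p ^ i * Nat.gcd (p ^ w) (j - 1) ∣ p ^ x * Nat.gcd (j - 1) (p ^ (v + w))) ↔
        p ^ i ∣ p ^ min v (min ρ (min a (x + min a (v + w) - min w a))) := by
      have hr := E.iff 0 i (by omega)
      rw [pow_zero, pow_one, modEq_one_iff_dvd (by omega)] at hr
      rw [hr, hJ i, Nat.pow_dvd_pow_iff_le_right hp.one_lt, hJ.gcd_eq hp, Nat.gcd_comm (j - 1),
        hJ.gcd_eq hp, ← pow_add, ← pow_add, Nat.pow_dvd_pow_iff_le_right hp.one_lt]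
      omega
    by_cases h : p ^ i ∣ p ^ min v (min ρ (min a (x + min a (v + w) - min w a)))
    · rw [if_pos h, if_pos (hc.2 h)]
    · rw [if_neg h, if_neg fun h' => h (hc.1 h')]
  rw [h1, Nat.gcd_eq_right (pow_dvd_pow _ (min_le_left _ _)), hJ.gcd_eq hp, ← pow_add]

lemma LocEq.E1_gcd (H : LocEq p M v w x τ v' w' x' τ') (E : E1 p v τ ρ) (E' : E1 p v' τ' ρ') :
    w + ρ = w' + ρ' ∧ v + ρ' = v' + ρ := by
  have hp := H.left.prime
  have h1 := H.gcd_eq 0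
  have h3 := H.sum_eq
  rw [E.gcd_eq hp H.left.two_le, E'.gcd_eq hp H.right.two_le, ← pow_add, ← pow_add] at h1
  have h1 := Nat.pow_right_injective hp.two_le h1
  have := E.le
  have := E'.le
  simp only [add_zero] at h1
  omega

lemma LocEq.E1_beta_le (H : LocEq p M v w x τ v' w' x' τ') (E : E1 p v τ ρ) (E' : E1 p v' τ' ρ')
    (hx' : x' ≤ w') : min ρ' x' ≤ min ρ x := by
  by_contra! hlt
  have hp := H.left.prime
  obtain ⟨a, ha⟩ : ∃ a, a = min ρ x + 1 := ⟨_, rfl⟩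
  have ha1 : a ≤ ρ' := by omega
  have ha2 : a ≤ x' := by omega
  have ha3 : min ρ x < a := by omega
  clear hlt ha
  have hJ := exactDvd_one_add hp a
  have hρ := E.le
  have hρ' := E'.le
  have hs := H.sum_eq
  have e1 : min w' a = a := by omega
  have e2 : min a (v' + w') = a := by omega
  have e3 : min v' (min ρ' (min a (x' + a - a))) = a := by omega
  have h1 := H.Es_eq (1 + p ^ a) (by omega) ((modEq_one_iff_dvd (by omega)).2 (by
    rw [Nat.add_sub_cancel_left]; exact dvd_pow_self p (by omega)))
  rw [E.Es_eq hp H.left.two_le hJ, E'.Es_eq hp H.right.two_le hJ, e1, e2, e3, hs, e2] at h1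
  have h2 := Nat.pow_right_injective hp.two_le h1
  have h4 : min v (min ρ (min a (x + a - min w a))) ≤ min ρ (min a (x + a - min w a)) :=
    min_le_right _ _
  clear h1 e1 e2 e3 hJ
  rcases le_total w a with hwa | hwa
  · rw [min_eq_left hwa] at h2 h4; omega
  · rw [min_eq_right hwa, Nat.add_sub_cancel] at h2 h4; omega

lemma LocEq.E1_beta (H : LocEq p M v w x τ v' w' x' τ') (E : E1 p v τ ρ) (E' : E1 p v' τ' ρ')
    (hx : x ≤ w) (hx' : x' ≤ w') : min ρ x = min ρ' x' :=
  le_antisymm (H.symm.E1_beta_le E' E hx) (H.E1_beta_le E E' hx')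

lemma isPer_mul_of_modEq_one {c d : ℕ} (hcd : Nat.Coprime c d) (hτ : τ ≡ 1 [MOD d]) {P : ℕ} :
    IsPer τ (c * d) P ↔ IsPer τ c P := by
  refine forall_congr' fun i => ?_
  rw [← Nat.modEq_and_modEq_iff_modEq_mul hcd]
  have : τ ^ i ≡ 1 [MOD d] := by simpa using hτ.pow i
  tauto

lemma LocEq.isPer_iff_left (H : LocEq p M v w x τ v' w' x' τ') {c k : ℕ} (hc : c ∣ M) :
    IsPer τ c (p ^ k) ↔ IsPer τ' c (p ^ k) := by
  have hp := H.left.prime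
  refine ⟨fun h => isPer_congr (fun K => H.ord_eq K c hc) hp h ?_,
    fun h => isPer_congr (fun K => (H.ord_eq K c hc).symm) hp h ?_⟩
  · exact (H.right.exists_per (hc.trans (dvd_mul_right _ _))).imp fun _ h => h.2
  · exact (H.left.exists_per (hc.trans (dvd_mul_right _ _))).imp fun _ h => h.2

lemma Loc.per_le (H : Loc p M v w x τ) {d k : ℕ} (hd : d ∣ M * p ^ v) (h : IsPer τ d (p ^ k)) :
    k ≤ w := by
  obtain ⟨k', hk', h'⟩ := H.exists_per hd
  have := Nat.pow_right_injective H.prime.two_le (h.unique h')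
  omega

/-- A lift of `τ` mod `M` with prescribed exact valuation of `j - 1`. -/
lemma Loc.exists_lift (H : Loc p M v w x τ) (a : ℕ) :
    ∃ j, 1 ≤ j ∧ j ≡ τ [MOD M] ∧ ExactDvd p a (j - 1) := by
  have hp := H.prime
  have hcop : Nat.Coprime M (p ^ (a + 1)) := Nat.Coprime.pow_right _ H.cM.symm
  obtain ⟨z, hz1, hz2⟩ := Nat.chineseRemainder hcop τ (1 + p ^ a)
  have hpos : 1 ≤ M * p ^ (a + 1) := Nat.mul_pos H.M_pos (pow_pos hp.pos _)
  refine ⟨z + M * p ^ (a + 1), by omega, Nat.ModEq.trans ?_ hz1, ?_⟩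
  · simp [Nat.ModEq]
  · refine (exactDvd_one_add hp a).of_modEq (by omega) (by omega) (hz2.symm.trans ?_)
    simp [Nat.ModEq]

theorem LocEq.E1_not_lt (H : LocEq p M v w x τ v' w' x' τ') (E : E1 p v τ ρ) (E' : E1 p v' τ' ρ')
    (hx : x ≤ w) (hx' : x' ≤ w') (h2' : ρ' ≤ x' ∨ w' < x' + κ)
    (hκ : IsPer τ M (p ^ κ)) : ρ' ≤ ρ := by
  by_contra! hlt
  have hp := H.left.prime
  have hM := H.left.M_pos
  have hβ := H.E1_beta E E' hx hx'
  obtain ⟨hg1, hg2⟩ := H.E1_gcd E E'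
  have hκw := H.left.per_le (dvd_mul_right _ _) hκ
  have hκw' := H.right.per_le (dvd_mul_right _ _) ((H.isPer_iff_left dvd_rfl).1 hκ)
  have hρ := E.le
  have hρ' := E'.le
  obtain ⟨a, ha⟩ : ∃ a, a = w' - κ + 1 := ⟨_, rfl⟩
  obtain ⟨j, hj, hjτ, hJ⟩ := H.left.exists_lift a
  have hmain := H.Zs_eq_of_lift hj (by omega) hJ hjτ κ
  rw [Nat.pow_div hκw hp.pos, Nat.pow_div hκw' hp.pos, hJ.gcd_eq hp, hJ.gcd_eq hp,
    show min (w - κ) a = a by omega, show min (w' - κ) a = a - 1 by omega] at hmain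
  set D := ∑ c ∈ M.divisors, ∑ i ∈ Finset.range (a + 1),
    if IsPer τ c (p ^ κ) then Nat.totient c * Nat.totient (p ^ i) else 0 with hD
  have hτ1 : ∀ i ≤ ρ, τ ≡ 1 [MOD p ^ i] := fun i hi => by
    simpa using (E.iff 0 i (by omega)).2 (by omega)
  have hτ1' : ∀ i ≤ ρ', τ' ≡ 1 [MOD p ^ i] := fun i hi => by
    simpa using (E'.iff 0 i (by omega)).2 (by omega)
  have hcM : ∀ c ∈ M.divisors, ∀ i, Nat.Coprime c (p ^ i) := fun c hc i =>
    Nat.Coprime.pow_right _ (H.left.cM.coprime_dvd_right (Nat.dvd_of_mem_divisors hc)).symm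
  have hj1 : j ≡ 1 [MOD p ^ a] := (modEq_one_iff_dvd hj).2 ((hJ a).2 le_rfl)
  have hGD : D ≤ Zs p M v w x τ j (p ^ κ) := by
    unfold Zs
    refine Finset.sum_le_sum fun c hc => ?_
    refine le_trans ?_ (Finset.sum_le_sum_of_subset
      (Finset.range_mono (show a + 1 ≤ v + 1 by omega)))
    refine Finset.sum_le_sum fun i hi => ?_
    rw [Finset.mem_range] at hi
    by_cases h : IsPer τ c (p ^ κ)
    · rw [if_pos h, if_pos]
      rw [zcond_iff hp hJ hκw]
      refine ⟨⟨(isPer_mul_of_modEq_one (hcM c hc i) (hτ1 i (by omega))).2 h, by omega⟩, 1, ?_⟩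
      rw [pow_one, ← Nat.modEq_and_modEq_iff_modEq_mul (hcM c hc i)]
      exact ⟨hjτ.of_dvd (Nat.dvd_of_mem_divisors hc),
        (hj1.of_dvd (pow_dvd_pow _ (by omega))).trans (hτ1 i (by omega)).symm⟩
    · rw [if_neg h]; exact Nat.zero_le _
  have hHD : Zs p M v' w' x' τ' j (p ^ κ) ≤ D := by
    unfold Zs
    refine Finset.sum_le_sum fun c hc => ?_
    have key : ∀ i, ZCond p v' w' x' τ' j (p ^ κ) c i → i ∈ Finset.range (a + 1) ∧
        IsPer τ c (p ^ κ) := by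
      rintro i ⟨hper, ⟨b, hb⟩, -⟩
      have hi : i ≤ a := by
        by_contra! hi
        have h1 : j ≡ τ' ^ b [MOD p ^ (a + 1)] :=
          hb.of_dvd ((pow_dvd_pow _ (by omega)).trans (dvd_mul_left _ _))
        have h2 : τ' ^ b ≡ 1 [MOD p ^ (a + 1)] := by simpa using (hτ1' (a + 1) (by omega)).pow b
        have := (hJ (a + 1)).1 ((modEq_one_iff_dvd hj).1 (h1.trans h2))
        omega
      refine ⟨Finset.mem_range.2 (by omega), ?_⟩
      rw [isPer_mul_of_modEq_one (hcM c hc i) (hτ1' i (by omega))] at hper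
      exact (H.isPer_iff_left (Nat.dvd_of_mem_divisors hc)).2 hper
    rw [← Finset.sum_filter, ← Finset.sum_filter (fun _ => IsPer τ c (p ^ κ))]
    refine Finset.sum_le_sum_of_subset fun i hi => ?_
    exact Finset.mem_filter.2 (key i (Finset.mem_filter.1 hi).2)
  have hD0 : 0 < D := by
    refine lt_of_lt_of_le ?_ (Finset.single_le_sum (fun _ _ => Nat.zero_le _)
      (Nat.mem_divisors.2 ⟨dvd_rfl, hM.ne'⟩))
    refine lt_of_lt_of_le ?_ (Finset.single_le_sum (fun _ _ => Nat.zero_le _)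
      (Finset.mem_range.2 (Nat.succ_pos a)))
    rw [if_pos hκ]
    simpa using hM
  have h1 : p ^ a * D ≤ p ^ (a - 1) * D := by
    calc p ^ a * D ≤ _ := Nat.mul_le_mul_left _ hGD
      _ = _ := hmain
      _ ≤ _ := Nat.mul_le_mul_left _ hHD
  have h2 := Nat.le_of_mul_le_mul_right h1 hD0
  have h3 := (Nat.pow_le_pow_iff_right hp.one_lt).1 h2
  omega

theorem LocEq.E1_rho (H : LocEq p M v w x τ v' w' x' τ') (E : E1 p v τ ρ) (E' : E1 p v' τ' ρ')
    (hx : x ≤ w) (hx' : x' ≤ w') (h2 : ρ ≤ x ∨ w < x + κ) (h2' : ρ' ≤ x' ∨ w' < x' + κ)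
    (hκ : IsPer τ M (p ^ κ)) : ρ = ρ' ∧ v = v' ∧ w = w' := by
  have h3 := H.E1_not_lt E E' hx hx' h2' hκ
  have h4 := H.symm.E1_not_lt E' E hx' hx h2 ((H.isPer_iff_left dvd_rfl).1 hκ)
  have := H.E1_gcd E E'
  omega

end TypeOne

section TypeOne

variable {p M v w x τ v' w' x' τ' ρ ρ' κ a e j i : ℕ}

lemma E1.modEq_one (E : E1 p v τ ρ) (hi : i ≤ ρ) : τ ≡ 1 [MOD p ^ i] := by
  have := E.le
  simpa using (E.iff 0 i (by omega)).2 (by omega)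

lemma Loc.E1_lift (H : Loc p M v w x τ) (E : E1 p v τ ρ) :
    ∃ j, 1 ≤ j ∧ j ≡ τ [MOD M * p ^ v] ∧ ExactDvd p (max ρ 1) (j - 1) := by
  have hp := H.prime
  have hτ := H.two_le
  have hle := E.le
  by_cases hρ : ρ < v
  · refine ⟨τ, by omega, rfl, ?_⟩
    have hpos : ρ ≠ 0 := E.pos (by omega)
    rw [show max ρ 1 = ρ by omega]
    have key : ∀ i ≤ v, (p ^ i ∣ τ - 1 ↔ i ≤ ρ) := fun i hi => by
      have := E.iff 0 i hi
      rwa [pow_zero, pow_one, modEq_one_iff_dvd (by omega)] at this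
    intro i
    rcases le_or_gt i v with hi | hi
    · exact key i hi
    · refine ⟨fun h => ?_, fun h => by omega⟩
      have := (key v le_rfl).1 ((pow_dvd_pow p hi.le).trans h)
      omega
  · obtain ⟨j, hj, hjτ, hJ⟩ := H.exists_lift (max ρ 1)
    refine ⟨j, hj, ?_, hJ⟩
    rw [← Nat.modEq_and_modEq_iff_modEq_mul (Nat.Coprime.pow_right _ H.cM.symm)]
    exact ⟨hjτ, ((modEq_one_iff_dvd hj).2 ((hJ v).2 (by omega))).trans
      (E.modEq_one (by omega)).symm⟩

lemma E1.isPer (E : E1 p v τ ρ) (hM : Nat.Coprime p M) (hκ : IsPer τ M (p ^ κ)) (hi : i ≤ v)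
    (hi' : i ≤ ρ + κ) : IsPer τ (M * p ^ i) (p ^ κ) := by
  intro n
  rw [← Nat.modEq_and_modEq_iff_modEq_mul (Nat.Coprime.pow_right _ hM.symm), ← hκ n]
  refine ⟨fun h => h.1, fun h => ⟨h, ?_⟩⟩
  obtain ⟨q, rfl⟩ := (hκ n).1 h
  rw [pow_mul]
  simpa using ((E.iff κ i hi).2 hi').pow q

theorem LocEq.E1_max (H : LocEq p M v w x τ v w x' τ') (E : E1 p v τ ρ) (E' : E1 p v τ' ρ)
    (hκ : IsPer τ M (p ^ κ)) (hi : i ≤ v) (hi' : i ≤ ρ + κ) :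
    (i + min (w - κ) (max ρ 1) ≤ x + min (max ρ 1) (v + w) ↔
      i + min (w - κ) (max ρ 1) ≤ x' + min (max ρ 1) (v + w)) ∧
    (i + min (w - κ) (max ρ 1) ≤ x + min (max ρ 1) (v + w) →
      ∃ z, τ ≡ τ' ^ z [MOD M * p ^ i]) := by
  obtain ⟨j, hj, hjτ, hJ⟩ := H.left.E1_lift E
  obtain ⟨j', hj', hjτ', hJ'⟩ := H.right.E1_lift E'
  exact H.maximal (le_max_right _ _) (H.left.per_le (dvd_mul_right _ _) hκ) hj hJ hjτ hj' hJ' hjτ'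
    dvd_rfl hi (E.isPer H.left.cM hκ hi hi')

/-- The exponent of `p` in the modulus in the linear case. -/
def expOne (v w x ρ κ : ℕ) : ℕ := min v (min (κ + ρ) (max ρ (max x (ρ + x + κ - w))))

theorem LocEq.E1_expOne_le (H : LocEq p M v w x τ v w x' τ') (E : E1 p v τ ρ) (E' : E1 p v τ' ρ)
    (hκ : IsPer τ M (p ^ κ)) : expOne v w x ρ κ ≤ expOne v w x' ρ κ := by
  have hκw := H.left.per_le (dvd_mul_right _ _) hκ
  have h1 := E.le
  have h2 := E.pos
  obtain ⟨i, hi⟩ : ∃ i, i = expOne v w x ρ κ := ⟨_, rfl⟩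
  rw [← hi]
  unfold expOne at *
  by_cases hv : v = 0
  · omega
  rw [le_min_iff, le_min_iff]
  refine ⟨by omega, by omega, ?_⟩
  by_cases hiρ : i ≤ ρ
  · omega
  have h3 := (H.E1_max E E' hκ (i := i) (by omega) (by omega)).1
  rw [show max ρ 1 = ρ by have := h2 hv; omega, show min ρ (v + w) = ρ by omega] at h3
  have h4 : i ≤ max x (ρ + x + κ - w) := by omega
  clear hi
  rcases le_total (w - κ) ρ with h5 | h5
  · rw [min_eq_left h5] at h3; omega
  · rw [min_eq_right h5] at h3; omega

theorem LocEq.E1_final (H : LocEq p M v w x τ v w x' τ') (E : E1 p v τ ρ) (E' : E1 p v τ' ρ)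
    (hκ : IsPer τ M (p ^ κ)) : expOne v w x ρ κ = expOne v w x' ρ κ ∧
      ∃ z, τ ≡ τ' ^ z [MOD M * p ^ expOne v w x ρ κ] := by
  refine ⟨le_antisymm (H.E1_expOne_le E E' hκ)
    (H.symm.E1_expOne_le E' E ((H.isPer_iff_left dvd_rfl).1 hκ)), ?_⟩
  have hκw := H.left.per_le (dvd_mul_right _ _) hκ
  have h1 := E.le
  have h2 := E.pos
  obtain ⟨i, hi⟩ : ∃ i, i = expOne v w x ρ κ := ⟨_, rfl⟩
  rw [← hi]
  unfold expOne at hi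
  by_cases hiρ : i ≤ ρ
  · obtain ⟨z, hz⟩ := (H.E1_max E E' hκ (i := 0) (by omega) (by omega)).2 (by omega)
    rw [pow_zero, mul_one] at hz
    refine ⟨z, ?_⟩
    rw [← Nat.modEq_and_modEq_iff_modEq_mul (Nat.Coprime.pow_right _ H.left.cM.symm)]
    refine ⟨hz, (E.modEq_one hiρ).trans ?_⟩
    simpa using ((E'.modEq_one hiρ).pow z).symm
  · have hv : v ≠ 0 := by omega
    refine (H.E1_max E E' hκ (i := i) (by omega) (by omega)).2 ?_
    rw [show max ρ 1 = ρ by have := h2 hv; omega, show min ρ (v + w) = ρ by omega]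
    have h4 : i ≤ max x (ρ + x + κ - w) := by omega
    clear hi
    rcases le_total (w - κ) ρ with h5 | h5
    · rw [min_eq_left h5]; omega
    · rw [min_eq_right h5]; omega

/-- Iterated lifting of membership in the cyclic group generated by `τ'`. -/
lemma lift_to_top {v i₀ τ y : ℕ} (hp : p.Prime) (hM : Nat.Coprime p M) (hi₀ : 1 ≤ i₀)
    (hτ : Nat.Coprime τ p)
    (hstep : ∀ i, i₀ ≤ i → i < v → ∃ e, τ ^ e ≡ 1 [MOD M * p ^ i] ∧ ¬ τ ^ e ≡ 1 [MOD p ^ (i + 1)])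
    (hy : ∃ z, y ≡ τ ^ z [MOD M * p ^ i₀]) (hv : i₀ ≤ v) : ∃ z, y ≡ τ ^ z [MOD M * p ^ v] := by
  induction v, hv using Nat.le_induction with
  | base => exact hy
  | succ i hi ih =>
    obtain ⟨z, hz⟩ := ih fun k hk hk' => hstep k hk (by omega)
    obtain ⟨e, h1, h2⟩ := hstep i hi (by omega)
    exact exists_lift_step hp hM (by omega) hτ h1 h2 hz

theorem LocEq.E1_full (H : LocEq p M v w x τ v w x' τ') (E : E1 p v τ ρ) (E' : E1 p v τ' ρ)
    (hκ : IsPer τ M (p ^ κ)) (hx : x = v) : ∃ z, τ ≡ τ' ^ z [MOD M * p ^ v] := by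
  have hp := H.left.prime
  have h1 := E.le
  have h2 := E.pos
  have hmin : min (w - κ) (max ρ 1) ≤ min (max ρ 1) (v + w) := by
    have := H.left.per_le (dvd_mul_right _ _) hκ
    omega
  by_cases hv : v = 0
  · subst hv
    exact (H.E1_max E E' hκ (i := 0) (by omega) (by omega)).2 (by omega)
  have hκ' := (H.isPer_iff_left dvd_rfl).1 hκ
  obtain ⟨i₀, hi⟩ : ∃ i, i = min v (ρ + κ) := ⟨_, rfl⟩
  have hρ := h2 hv
  refine lift_to_top (i₀ := i₀) hp H.left.cM (by omega) ?_ ?_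
    ((H.E1_max E E' hκ (i := i₀) (by omega) (by omega)).2 (by omega)) (by omega)
  · exact H.right.cop.coprime_dvd_right ((dvd_pow_self p hv).trans (dvd_mul_left _ _))
  · intro i hi1 hi2
    refine ⟨p ^ (i - ρ), ?_, ?_⟩
    · rw [← Nat.modEq_and_modEq_iff_modEq_mul (Nat.Coprime.pow_right _ H.left.cM.symm)]
      exact ⟨(hκ' _).2 (pow_dvd_pow _ (by omega)), (E'.iff _ _ (by omega)).2 (by omega)⟩
    · rw [E'.iff _ _ (by omega)]; omega

end TypeOne

section TypeTwo

variable {p M v w x τ v' w' x' τ' ρ ρ' κ a e j i : ℕ}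

lemma IsPer.mul {c d b : ℕ} (hcd : Nat.Coprime c d) (hc : IsPer τ c (p ^ a))
    (hd : IsPer τ d (p ^ b)) : IsPer τ (c * d) (p ^ max a b) := by
  intro n
  rw [← Nat.modEq_and_modEq_iff_modEq_mul hcd, hc n, hd n]
  constructor
  · rintro ⟨h1, h2⟩
    rcases le_total a b with h | h
    · rwa [max_eq_right h]
    · rwa [max_eq_left h]
  · intro h
    exact ⟨(pow_dvd_pow _ (le_max_left _ _)).trans h, (pow_dvd_pow _ (le_max_right _ _)).trans h⟩

lemma isPer_of_le_iff (hp : p.Prime) {k : ℕ} (h : ∃ k, IsPer τ a (p ^ k))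
    (hk : ∀ K, τ ^ p ^ K ≡ 1 [MOD a] ↔ k ≤ K) : IsPer τ a (p ^ k) := by
  obtain ⟨k', hk'⟩ := h
  have : ∀ K, k' ≤ K ↔ k ≤ K := fun K => by
    rw [← hk, hk', Nat.pow_dvd_pow_iff_le_right hp.one_lt]
  have : k' = k := le_antisymm ((this k).2 le_rfl) ((this k').1 le_rfl)
  rwa [← this]

/-- `τ` acts on the `2`-part as `-1` modulo exactly `2 ^ ρ`. -/
structure E2 (v τ ρ : ℕ) : Prop where
  two_le : 2 ≤ ρ
  le : ρ ≤ v
  dvd : 2 ^ ρ ∣ τ + 1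
  ndvd : ρ < v → ¬ 2 ^ (ρ + 1) ∣ τ + 1

lemma two_pow_succ_dvd_mul_iff {x y i : ℕ} (hy : y % 4 = 2) : 2 ^ (i + 1) ∣ x * y ↔ 2 ^ i ∣ x := by
  obtain ⟨u, rfl⟩ : ∃ u, y = 2 * u := ⟨y / 2, by omega⟩
  have hu : Nat.Coprime (2 ^ i) u := Nat.Coprime.pow_left _
    ((Nat.coprime_two_left).2 (Nat.odd_iff.2 (by omega)))
  rw [show x * (2 * u) = 2 * (x * u) by ring, pow_succ', Nat.mul_dvd_mul_iff_left two_pos,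
    Nat.Coprime.dvd_mul_right hu]

lemma sq_pow_sub_one (K : ℕ) (τ : ℕ) :
    τ ^ 2 ^ (K + 1) - 1 = (τ ^ 2 ^ K - 1) * (τ ^ 2 ^ K + 1) := by
  rw [pow_succ, pow_mul, show (τ ^ 2 ^ K) ^ 2 - 1 = (τ ^ 2 ^ K) ^ 2 - 1 ^ 2 by norm_num,
    Nat.sq_sub_sq, mul_comm]

lemma two_pow_dvd_iff_of_three (h : τ % 4 = 3) (K i : ℕ) :
    2 ^ (i + (K + 1)) ∣ τ ^ 2 ^ (K + 1) - 1 ↔ 2 ^ i ∣ τ + 1 := by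
  induction K with
  | zero =>
    rw [sq_pow_sub_one, pow_zero, pow_one, mul_comm, two_pow_succ_dvd_mul_iff (by omega)]
  | succ K ih =>
    rw [sq_pow_sub_one, ← add_assoc, two_pow_succ_dvd_mul_iff, ih]
    have h4 : τ ^ 2 ^ (K + 1) % 4 = 1 := by
      rw [pow_succ', pow_mul, Nat.pow_mod, Nat.pow_mod τ, h]
      norm_num
    omega

lemma E2.mod_four (E : E2 v τ ρ) : τ % 4 = 3 := by
  have h : 2 ^ 2 ∣ τ + 1 := (pow_dvd_pow _ E.two_le).trans E.dvd
  omega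

lemma E2.dvd_iff (E : E2 v τ ρ) (hi : i ≤ v) : 2 ^ i ∣ τ + 1 ↔ i ≤ ρ := by
  refine ⟨fun h => ?_, fun h => (pow_dvd_pow _ h).trans E.dvd⟩
  by_contra! hlt
  exact E.ndvd (by omega) ((pow_dvd_pow _ (by omega)).trans h)

lemma E2.iff (E : E2 v τ ρ) {K : ℕ} (hK : 1 ≤ K) (hi : i ≤ v) :
    τ ^ 2 ^ K ≡ 1 [MOD 2 ^ i] ↔ i ≤ ρ + K := by
  have h4 := E.mod_four
  obtain ⟨K, rfl⟩ := Nat.exists_eq_add_of_le' hK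
  rw [modEq_one_iff_dvd (Nat.one_le_pow _ _ (by omega))]
  rcases le_total i (K + 1) with h | h
  · refine ⟨fun _ => by omega, fun _ => ?_⟩
    exact (pow_dvd_pow 2 (by omega)).trans ((two_pow_dvd_iff_of_three h4 K 0).2 (by simp))
  · obtain ⟨i', rfl⟩ := Nat.exists_eq_add_of_le' h
    rw [two_pow_dvd_iff_of_three h4, E.dvd_iff (by omega)]
    omega

lemma E2.exact (E : E2 v τ ρ) : ExactDvd 2 1 (τ - 1) := by
  intro i
  have h4 := E.mod_four
  refine ⟨fun h => ?_, fun h => ?_⟩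
  · by_contra! hlt
    have : 2 ^ 2 ∣ τ - 1 := (pow_dvd_pow 2 hlt).trans h
    omega
  · refine (pow_dvd_pow 2 h).trans ?_
    omega

lemma E2.not_modEq_one (E : E2 v τ ρ) (hi : 2 ≤ i) : ¬ τ ≡ 1 [MOD 2 ^ i] := by
  have h4 := E.mod_four
  rw [modEq_one_iff_dvd (by omega), E.exact i]
  omega

lemma E2.gcd_zero (E : E2 v τ ρ) : Nat.gcd (2 ^ v) (τ - 1) = 2 := by
  have := E.two_le
  have := E.le
  rw [E.exact.gcd_eq Nat.prime_two, show min v 1 = 1 by omega, pow_one]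

lemma E2.gcd_eq (E : E2 v τ ρ) {K : ℕ} (hK : 1 ≤ K) :
    Nat.gcd (2 ^ v) (τ ^ 2 ^ K - 1) = 2 ^ min v (ρ + K) := by
  have h4 := E.mod_four
  obtain ⟨b, hb, hb'⟩ := (Nat.dvd_prime_pow Nat.prime_two).1
    (Nat.gcd_dvd_left (2 ^ v) (τ ^ 2 ^ K - 1))
  rw [hb']
  have key : ∀ i ≤ v, i ≤ b ↔ i ≤ ρ + K := fun i hi => by
    rw [← E.iff hK hi, dvd_gcd_pow_iff hi (by omega), hb', Nat.pow_dvd_pow_iff_le_right one_lt_two]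
  have h1 := (key b hb).1 le_rfl
  have h2 := (key (min v (ρ + K)) (min_le_left _ _)).2 (min_le_right _ _)
  congr 1
  omega

lemma E2.isPer (E : E2 v τ ρ) (H : Loc 2 M v w x τ) (hκ : IsPer τ M (2 ^ κ)) (hi : 2 ≤ i)
    (hiv : i ≤ v) : IsPer τ (M * 2 ^ i) (2 ^ max κ (max 1 (i - ρ))) := by
  refine IsPer.mul (Nat.Coprime.pow_right _ H.cM.symm) hκ (isPer_of_le_iff Nat.prime_two
    ((H.exists_per ((pow_dvd_pow _ hiv).trans (dvd_mul_left _ _))).imp fun _ h => h.2) fun K => ?_)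
  rcases Nat.eq_zero_or_pos K with rfl | hK
  · rw [pow_zero, pow_one]
    refine ⟨fun h => absurd h (E.not_modEq_one hi), fun h => by omega⟩
  · rw [E.iff hK hiv]; omega

lemma E2.one_le_w (E : E2 v τ ρ) (H : Loc 2 M v w x τ) : 1 ≤ w := by
  by_contra! h
  have h0 : w = 0 := by omega
  have h1 := H.pow_w
  rw [h0, pow_zero, pow_one] at h1
  exact E.not_modEq_one (E.two_le.trans E.le) (h1.of_dvd (dvd_mul_left _ _))

lemma E2.v_le (E : E2 v τ ρ) (H : Loc 2 M v w x τ) : v ≤ ρ + w :=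
  (E.iff (E.one_le_w H) le_rfl).1 (H.pow_w.of_dvd (dvd_mul_left _ _))

lemma E2.x_ge (E : E2 v τ ρ) (H : Loc 2 M v w x τ) : v ≤ x + 1 := by
  have h4 := E.mod_four
  have h1 := H.fix
  have h2 : 2 ^ v ∣ 2 ^ x * (τ - 1) := by
    have := (Nat.modEq_iff_dvd' (Nat.le_mul_of_pos_right _ (by omega))).1 h1.symm
    rwa [show 2 ^ x * τ - 2 ^ x = 2 ^ x * (τ - 1) by rw [Nat.mul_sub, mul_one]] at this
  rcases Nat.eq_zero_or_pos v with h | h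
  · omega
  · obtain ⟨v, rfl⟩ := Nat.exists_eq_add_of_le' h
    rw [two_pow_succ_dvd_mul_iff (by omega), Nat.pow_dvd_pow_iff_le_right one_lt_two] at h2
    omega

lemma LocEq.E2_vw (H : LocEq 2 M v w x τ v' w' x' τ') (E : E2 v τ ρ) (E' : E2 v' τ' ρ') :
    v = v' ∧ w = w' := by
  have h1 := H.gcd_eq 0
  rw [pow_zero, pow_one, pow_one, E.gcd_zero, E'.gcd_zero] at h1
  have h2 := Nat.pow_right_injective le_rfl (Nat.eq_of_mul_eq_mul_right two_pos h1)
  have := H.sum_eq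
  omega

theorem LocEq.E2_max (H : LocEq 2 M v w x τ v w x' τ') (E : E2 v τ ρ) (E' : E2 v τ' ρ')
    {π : ℕ} (hi : i ≤ v) (hper : IsPer τ (M * 2 ^ i) (2 ^ π)) :
    (i + min (w - π) 1 ≤ x + 1 ↔ i + min (w - π) 1 ≤ x' + 1) ∧
    (i + min (w - π) 1 ≤ x + 1 → ∃ z, τ ≡ τ' ^ z [MOD M * 2 ^ i]) := by
  have h1 := H.left.two_le
  have h2 := H.right.two_le
  have h3 := E.two_le
  have h4 := E.le
  have := H.maximal le_rfl (H.left.per_le (mul_dvd_mul_left _ (pow_dvd_pow _ hi)) hper)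
    (by omega) E.exact rfl (by omega) E'.exact rfl dvd_rfl hi hper
  rwa [show min 1 (v + w) = 1 by omega] at this

lemma E2.modEq_of_odd (E : E2 v τ ρ) (E' : E2 v τ' ρ) {z : ℕ} (hz : z % 2 = 1) :
    τ ≡ τ' ^ z [MOD 2 ^ ρ] := by
  rw [← ZMod.natCast_eq_natCast_iff]
  have h1 := (ZMod.natCast_eq_zero_iff _ _).2 E.dvd
  have h2 := (ZMod.natCast_eq_zero_iff _ _).2 E'.dvd
  push_cast at h1 h2 ⊢
  rw [eq_neg_of_add_eq_zero_left h1, eq_neg_of_add_eq_zero_left h2, Odd.neg_one_pow (Nat.odd_iff.2 hz)]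

lemma LocEq.E2_rho_not_lt (H : LocEq 2 M v w x τ v w x' τ') (E : E2 v τ ρ) (E' : E2 v τ' ρ')
    (hκ : IsPer τ M (2 ^ κ))
    (h4' : x' + 1 = v → max κ 1 + 1 ≤ w → 3 ≤ v → ρ' ≠ v) : ρ' ≤ ρ := by
  by_contra! hlt
  have h1 := H.gcd_eq 1
  rw [E.gcd_eq le_rfl, E'.gcd_eq le_rfl] at h1
  have h1 := Nat.pow_right_injective le_rfl (Nat.eq_of_mul_eq_mul_left (pow_pos two_pos _) h1)
  have h2 := E.two_le
  have h3 := E.le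
  have h5 := E'.le
  have h6 := E.x_ge H.left
  have h6' := E'.x_ge H.right
  have hper := E.isPer H.left hκ (i := v) (by omega) le_rfl
  rw [show max κ (max 1 (v - ρ)) = max κ 1 by omega] at hper
  obtain ⟨h7, h8⟩ := H.E2_max E E' le_rfl hper
  by_cases hc : v + min (w - max κ 1) 1 ≤ x + 1
  · obtain ⟨z, hz⟩ := h8 hc
    have hz := hz.of_dvd (dvd_mul_left (2 ^ v) M)
    have hd : 2 ^ v ∣ τ' + 1 := (E'.dvd_iff le_rfl).2 (by omega)
    rw [← ZMod.natCast_eq_natCast_iff] at hz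
    have hd' := (ZMod.natCast_eq_zero_iff _ _).2 hd
    push_cast at hz hd'
    rw [eq_neg_of_add_eq_zero_left hd'] at hz
    rcases Nat.even_or_odd z with he | ho
    · rw [he.neg_one_pow] at hz
      refine E.not_modEq_one (i := v) (by omega) ?_
      rw [← ZMod.natCast_eq_natCast_iff]
      simpa using hz
    · rw [ho.neg_one_pow] at hz
      have : 2 ^ v ∣ τ + 1 := by
        rw [← ZMod.natCast_eq_zero_iff]
        push_cast
        rw [hz]; ring
      have := (E.dvd_iff le_rfl).1 this
      omega
  · exact h4' (by omega) (by omega) (by omega) (by omega)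

/-- The exponent of `2` in the modulus in the dihedral-like case. -/
def expTwo (v w x ρ κ : ℕ) : ℕ :=
  if κ ≤ 1 ∨ v ≤ ρ + 1 then ρ
  else if 2 ≤ κ ∧ κ < w ∧ ρ + 2 ≤ v ∧ (x = w + ρ ∨ (x + 1 = v ∧ v < w + ρ)) then v - 1
  else v

theorem LocEq.E2_final (H : LocEq 2 M v w x τ v w x' τ') (E : E2 v τ ρ) (E' : E2 v τ' ρ)
    (hκ : IsPer τ M (2 ^ κ)) (h3 : ¬ (x = v ∧ v = w + ρ)) (h3' : ¬ (x' = v ∧ v = w + ρ)) :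
    expTwo v w x ρ κ = expTwo v w x' ρ κ ∧ ∃ z, τ ≡ τ' ^ z [MOD M * 2 ^ expTwo v w x ρ κ] := by
  have hcop : ∀ i, Nat.Coprime M (2 ^ i) := fun i => Nat.Coprime.pow_right _ H.left.cM.symm
  have hκ' := (H.isPer_iff_left dvd_rfl).1 hκ
  have hκw := H.left.per_le (dvd_mul_right _ _) hκ
  have g1 := E.two_le
  have g2 := E.le
  have g3 := E.x_ge H.left
  have g3' := E'.x_ge H.right
  have g4 := E.v_le H.left
  have g5 := H.left.x_le
  have g5' := H.right.x_le
  by_cases hA : κ ≤ 1 ∨ v ≤ ρ + 1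
  · unfold expTwo
    rw [if_pos hA, if_pos hA]
    refine ⟨rfl, ?_⟩
    rcases Nat.eq_zero_or_pos κ with rfl | hκ0
    · have hM : M = 1 := by
        by_contra hM
        obtain ⟨ℓ, hℓ, hd⟩ := Nat.exists_prime_and_dvd hM
        refine H.left.move ℓ hℓ hd ?_
        have := (hκ 1).2 (by simp)
        rw [pow_one] at this
        exact this.of_dvd hd
      refine ⟨1, ?_⟩
      rw [hM, one_mul]
      exact E.modEq_of_odd E' rfl
    · have hper : IsPer τ (M * 2 ^ 0) (2 ^ κ) := by simpa using hκ
      obtain ⟨z, hz⟩ := (H.E2_max E E' (Nat.zero_le _) hper).2 (by omega)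
      rw [pow_zero, mul_one] at hz
      refine ⟨z, ?_⟩
      rw [← Nat.modEq_and_modEq_iff_modEq_mul (hcop _)]
      refine ⟨hz, E.modEq_of_odd E' ?_⟩
      by_contra hz2
      obtain ⟨q, rfl⟩ : ∃ q, z = 2 * q := ⟨z / 2, by omega⟩
      have h1 : τ ^ 2 ^ (κ - 1) ≡ 1 [MOD M] := by
        refine (hz.pow _).trans ?_
        rw [← pow_mul, mul_comm 2 q, mul_assoc, ← pow_succ', Nat.sub_add_cancel hκ0, mul_comm,
          pow_mul]
        simpa using ((hκ' (2 ^ κ)).2 dvd_rfl).pow q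
      have h2 := (Nat.pow_dvd_pow_iff_le_right one_lt_two).1 ((hκ _).1 h1)
      omega
  push Not at hA
  have hkey : ∀ i, 2 ≤ i → i ≤ v → i ≤ ρ + κ → IsPer τ (M * 2 ^ i) (2 ^ κ) := by
    intro i h1 h2 h3
    have := E.isPer H.left hκ h1 h2
    rwa [show max κ (max 1 (i - ρ)) = κ by omega] at this
  by_cases hw : κ = w
  · have e1 : ∀ y, expTwo v w y ρ κ = v := fun y => by
      unfold expTwo; rw [if_neg (by omega), if_neg (by omega)]
    rw [e1, e1]
    exact ⟨rfl, (H.E2_max E E' le_rfl (hkey v (by omega) le_rfl (by omega))).2 (by omega)⟩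
  by_cases hv : v ≤ κ + ρ
  · have h1 := (H.E2_max E E' le_rfl (hkey v (by omega) le_rfl (by omega))).1
    have hx : x = x' := by omega
    subst hx
    refine ⟨rfl, ?_⟩
    have e1 : expTwo v w x ρ κ = x := by
      unfold expTwo
      rw [if_neg (by omega)]
      split_ifs <;> omega
    rw [e1]
    exact (H.E2_max E E' (by omega) (hkey x (by omega) (by omega) (by omega))).2 (by omega)
  constructor
  · by_cases hvw : v = w + ρ
    · unfold expTwo
      rw [if_neg (by omega), if_neg (by omega), if_neg (by omega), if_neg (by omega)]
    · have h1 := E.isPer H.left hκ (i := v) (by omega) le_rfl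
      have h2 := (H.E2_max E E' le_rfl h1).1
      have hx : x = x' := by omega
      rw [hx]
  · have htop : ∃ z, τ ≡ τ' ^ z [MOD M * 2 ^ v] := by
      refine lift_to_top (i₀ := κ + ρ) Nat.prime_two H.left.cM (by omega) ?_ ?_
        ((H.E2_max E E' (i := κ + ρ) (by omega) (hkey _ (by omega) (by omega) (by omega))).2
          (by omega)) (by omega)
      · exact H.right.cop.coprime_dvd_right
          ((dvd_pow_self 2 (by omega)).trans (dvd_mul_left _ _))
      · intro i hi1 hi2
        refine ⟨2 ^ (i - ρ), ?_, ?_⟩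
        · rw [← Nat.modEq_and_modEq_iff_modEq_mul (hcop _)]
          exact ⟨(hκ' _).2 (pow_dvd_pow _ (by omega)), (E'.iff (by omega) (by omega)).2 (by omega)⟩
        · rw [E'.iff (by omega) (by omega)]; omega
    obtain ⟨z, hz⟩ := htop
    refine ⟨z, hz.of_dvd (mul_dvd_mul_left _ (pow_dvd_pow _ ?_))⟩
    unfold expTwo
    split_ifs <;> omega

end TypeTwo

section Mixed

variable {M v w x τ v' w' x' τ' ρ ρ' κ π : ℕ}

lemma LocEq.mixed_data (H : LocEq 2 M v w x τ v' w' x' τ') (E : E2 v τ ρ) (E' : E1 2 v' τ' ρ')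
    (h2 : 2 ≤ v' → 2 ≤ ρ') :
    v = 2 ∧ ρ = 2 ∧ v' = ρ' + 1 ∧ w + 1 = w' + ρ' ∧ 2 ≤ ρ' ∧ 1 ≤ w' := by
  have h := H.gcd_eq 0
  rw [E'.gcd_eq Nat.prime_two H.right.two_le, ← pow_add, pow_zero, pow_one, E.gcd_zero] at h
  rw [← pow_succ] at h
  have h0 := Nat.pow_right_injective le_rfl h
  have h := H.gcd_eq 1
  rw [E.gcd_eq le_rfl, E'.gcd_eq Nat.prime_two H.right.two_le, ← pow_add, ← pow_add] at h
  have h1 := Nat.pow_right_injective le_rfl h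
  have h3 := E.two_le
  have h4 := E.le
  have h5 := E'.le
  have h6 := E'.pos
  have h7 := H.sum_eq
  simp only [add_zero] at h0
  have h8 : min v' ρ' = ρ' := min_eq_right h5
  rw [h8] at h0
  have h9 : 2 ≤ v' := by
    by_contra! hlt
    have : v' = 0 ∨ v' = 1 := by omega
    rcases this with rfl | rfl <;> omega
  have h10 := h2 h9
  have h11 : v = 2 ∧ ρ = 2 ∧ v' = ρ' + 1 := by omega
  refine ⟨h11.1, h11.2.1, h11.2.2, h0, h10, ?_⟩
  by_contra! hw
  have h12 := H.right.pow_w.of_dvd (dvd_mul_left _ _)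
  rw [show w' = 0 by omega, E'.iff 0 v' le_rfl] at h12
  omega

lemma LocEq.mixed_Zs_le (H : LocEq 2 M v w x τ v' w' x' τ') (hτ : τ % 4 = 3)
    (E' : E1 2 v' τ' ρ') (h2 : 2 ≤ ρ') :
    Zs 2 M v' w' x' τ' τ (2 ^ π) ≤ ∑ c ∈ M.divisors, ∑ i ∈ Finset.range 2,
      if IsPer τ c (2 ^ π) then Nat.totient c * Nat.totient (2 ^ i) else 0 := by
  unfold Zs
  refine Finset.sum_le_sum fun c hc => ?_
  have hcM := Nat.dvd_of_mem_divisors hc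
  have key : ∀ i, ZCond 2 v' w' x' τ' τ (2 ^ π) c i → i ∈ Finset.range 2 ∧
      IsPer τ c (2 ^ π) := by
    rintro i ⟨hper, ⟨b, hb⟩, -⟩
    have hi : i < 2 := by
      by_contra! hi
      have h1 : τ ≡ τ' ^ b [MOD 2 ^ 2] := hb.of_dvd ((pow_dvd_pow _ hi).trans (dvd_mul_left _ _))
      have h2 : τ' ^ b ≡ 1 [MOD 2 ^ 2] := by simpa using (E'.modEq_one h2).pow b
      have h3 := h1.trans h2
      unfold Nat.ModEq at h3
      omega
    refine ⟨Finset.mem_range.2 hi, ?_⟩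
    rw [isPer_mul_of_modEq_one (Nat.Coprime.pow_right _ (H.left.cM.coprime_dvd_right hcM).symm)
      (E'.modEq_one (by omega))] at hper
    exact (H.isPer_iff_left hcM).2 hper
  rw [← Finset.sum_filter, ← Finset.sum_filter (fun _ => IsPer τ c (2 ^ π))]
  refine Finset.sum_le_sum_of_subset fun i hi => ?_
  exact Finset.mem_filter.2 (key i (Finset.mem_filter.1 hi).2)

lemma Loc.mixed_le_Zs (H : Loc 2 M 2 w x τ) (E : E2 2 τ 2) (hπ : π + 1 ≤ w) (hx : 1 ≤ x) :
    (∑ c ∈ M.divisors, ∑ i ∈ Finset.range 2,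
      if IsPer τ c (2 ^ π) then Nat.totient c * Nat.totient (2 ^ i) else 0) +
        (if 2 ≤ x ∧ IsPer τ (M * 2 ^ 2) (2 ^ π) then 1 else 0) ≤ Zs 2 M 2 w x τ τ (2 ^ π) := by
  rw [Zs_eq_TSum Nat.prime_two E.exact (by omega) rfl]
  unfold TSum
  have hτ := E.mod_four
  have h1 : ∀ i < 2, τ ≡ 1 [MOD 2 ^ i] := by
    intro i hi
    interval_cases i
    · simp [Nat.modEq_one]
    · unfold Nat.ModEq; omega
  simp only [Finset.sum_range_succ (n := 2)]
  rw [Finset.sum_add_distrib]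
  refine Nat.add_le_add (Finset.sum_le_sum fun c hc => Finset.sum_le_sum fun i hi => ?_) ?_
  · rw [Finset.mem_range] at hi
    by_cases h : IsPer τ c (2 ^ π)
    · have hcM := Nat.dvd_of_mem_divisors hc
      rw [if_pos h, if_pos]
      exact ⟨(isPer_mul_of_modEq_one (Nat.Coprime.pow_right _
        (H.cM.coprime_dvd_right hcM).symm) (h1 i hi)).2 h, by omega⟩
    · rw [if_neg h]; exact Nat.zero_le _
  · by_cases h : 2 ≤ x ∧ IsPer τ (M * 2 ^ 2) (2 ^ π)
    · rw [if_pos h]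
      refine le_trans ?_ (Finset.single_le_sum (fun _ _ => Nat.zero_le _)
        (Nat.mem_divisors.2 ⟨dvd_rfl, H.M_pos.ne'⟩))
      rw [if_pos ⟨h.2, by omega⟩]
      exact Nat.mul_pos (Nat.totient_pos.2 H.M_pos) (Nat.totient_pos.2 (by norm_num))
    · rw [if_neg h]; exact Nat.zero_le _

lemma E2.Es_five (E : E2 2 τ 2) (hw : 2 ≤ w) : Es 2 2 w 1 τ 5 = 2 := by
  have hτ := E.mod_four
  have h0 : Nat.gcd (2 ^ w) 4 = 4 := Nat.gcd_eq_right (pow_dvd_pow 2 hw : 2 ^ 2 ∣ 2 ^ w)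
  have h1 : Nat.gcd 4 (2 ^ (2 + w)) = 4 :=
    Nat.gcd_eq_left (pow_dvd_pow 2 (by omega) : 2 ^ 2 ∣ 2 ^ (2 + w))
  have h2 : 2 ∣ τ - 1 := by omega
  have h3 : ¬ 4 ∣ τ - 1 := by omega
  unfold Es
  simp [Finset.sum_range_succ, h0, h1, h2, h3]

theorem LocEq.not_mixed (H : LocEq 2 M v w x τ v' w' x' τ') (E : E2 v τ ρ) (E' : E1 2 v' τ' ρ')
    (h2 : 2 ≤ v' → 2 ≤ ρ') (hκ : IsPer τ M (2 ^ κ)) (hx' : x' ≤ w')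
    (h2' : ρ' ≤ x' ∨ w' < x' + κ) : False := by
  obtain ⟨rfl, rfl, hv', hw, hρ', hw'⟩ := H.mixed_data E E' h2
  have hκw' := H.right.per_le (dvd_mul_right _ _) ((H.isPer_iff_left dvd_rfl).1 hκ)
  have hτ := E.mod_four
  have hx := E.x_ge H.left
  have hx2 := H.left.x_le
  obtain ⟨π, hπ⟩ : ∃ π, π = max κ 1 := ⟨_, rfl⟩
  have hmain := H.Zs_eq_of_lift (j := τ) (by omega) le_rfl E.exact rfl π
  rw [Nat.pow_div (by omega) two_pos, Nat.pow_div (by omega) two_pos,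
    E.exact.gcd_eq Nat.prime_two, E.exact.gcd_eq Nat.prime_two,
    show min (w - π) 1 = 1 by omega, pow_one] at hmain
  have l1 := H.mixed_Zs_le (π := π) hτ E' hρ'
  have l2 := H.left.mixed_le_Zs (π := π) E (by omega) (by omega)
  have hper := E.isPer H.left hκ le_rfl le_rfl
  rw [show max κ (max 1 (2 - 2)) = π by omega] at hper
  set C := ∑ c ∈ M.divisors, ∑ i ∈ Finset.range 2,
    if IsPer τ c (2 ^ π) then Nat.totient c * Nat.totient (2 ^ i) else 0 with hC
  have hpow : 2 ^ min (w' - π) 1 ≤ 2 ^ 1 := Nat.pow_le_pow_right two_pos (min_le_right _ _)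
  have hle : 2 ^ min (w' - π) 1 * Zs 2 M v' w' x' τ' τ (2 ^ π) ≤ 2 ^ 1 * C := Nat.mul_le_mul hpow l1
  have hx1 : x = 1 := by
    by_contra hne
    rw [if_pos ⟨by omega, hper⟩] at l2
    omega
  have hκ1 : 1 ≤ κ → κ + 1 ≤ w' := by
    intro h1
    by_contra! hlt
    have hC0 : 0 < C := by
      refine lt_of_lt_of_le ?_ (Finset.single_le_sum (fun _ _ => Nat.zero_le _)
        (Nat.mem_divisors.2 ⟨dvd_rfl, H.left.M_pos.ne'⟩))
      refine lt_of_lt_of_le ?_ (Finset.single_le_sum (fun _ _ => Nat.zero_le _)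
        (Finset.mem_range.2 two_pos))
      rw [show π = κ by omega, if_pos hκ]
      simpa using H.left.M_pos
    rw [show min (w' - π) 1 = 0 by omega, pow_zero, one_mul] at hmain
    omega
  subst hx1
  have hJ : ExactDvd 2 2 (5 - 1) := by simpa using exactDvd_one_add Nat.prime_two 2
  have hEs := H.Es_eq 5 (by omega) rfl
  rw [E.Es_five (by omega), E'.Es_eq Nat.prime_two H.right.two_le hJ, hJ.gcd_eq Nat.prime_two,
    ← pow_succ] at hEs
  have hEs := Nat.pow_right_injective le_rfl hEs
  have e1 : min 2 (v' + w') = 2 := by omega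
  have e2 : min w 2 = 2 := by omega
  rw [e1, e2] at hEs
  have hx1 : x' = 1 := by
    rcases le_total w' 2 with h | h
    · rw [min_eq_left h] at hEs
      omega
    · rw [min_eq_right h] at hEs
      omega
  omega

end Mixed

section Types

variable {p M v w x τ i K : ℕ}

lemma pow_dvd_pow_sub_one_iff (hp : p.Prime) (hodd : Odd p) (hτ : 2 ≤ τ) (h : p ∣ τ - 1) :
    p ^ (i + K) ∣ τ ^ p ^ K - 1 ↔ p ^ i ∣ τ - 1 := by
  have hn : ¬ p ∣ τ := fun h' => by
    have := (Nat.dvd_sub h' h)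
    rw [show τ - (τ - 1) = 1 by omega] at this
    exact hp.one_lt.ne' (Nat.dvd_one.1 this)
  have := Nat.emultiplicity_pow_sub_pow hp hodd (y := 1) h hn (p ^ K)
  rw [one_pow] at this
  rw [pow_dvd_iff_le_emultiplicity, pow_dvd_iff_le_emultiplicity, this,
    emultiplicity_pow_self hp.pos.ne' hp.prime.not_isUnit, Nat.cast_add,
    ENat.add_le_add_iff_right (ENat.natCast_ne_top K)]

lemma two_pow_dvd_pow_sub_one_iff (h : τ % 4 = 1) :
    2 ^ (i + K) ∣ τ ^ 2 ^ K - 1 ↔ 2 ^ i ∣ τ - 1 := by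
  induction K with
  | zero => simp
  | succ K ih =>
    rw [sq_pow_sub_one, ← add_assoc, two_pow_succ_dvd_mul_iff, ih]
    have h4 : τ ^ 2 ^ K % 4 = 1 := by
      rw [Nat.pow_mod, h]
      norm_num
    omega

lemma exists_E1_of_iff (hp : p.Prime) (hτ : 2 ≤ τ) (hmod : v ≠ 0 → p ∣ τ - 1)
    (h : ∀ K i, p ^ (i + K) ∣ τ ^ p ^ K - 1 ↔ p ^ i ∣ τ - 1) : ∃ ρ, E1 p v τ ρ := by
  obtain ⟨ρ, hρ, hρ'⟩ := (Nat.dvd_prime_pow hp).1 (Nat.gcd_dvd_left (p ^ v) (τ - 1))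
  have key : ∀ i ≤ v, p ^ i ∣ τ - 1 ↔ i ≤ ρ := fun i hi => by
    rw [← Nat.pow_dvd_pow_iff_le_right hp.one_lt, ← hρ', Nat.dvd_gcd_iff]
    exact ⟨fun h => ⟨pow_dvd_pow _ hi, h⟩, fun h => h.2⟩
  refine ⟨ρ, hρ, fun hv => ?_, fun K i hi => ?_⟩
  · have := (key 1 (by omega)).1 (by rw [pow_one]; exact hmod hv)
    omega
  · rw [modEq_one_iff_dvd (Nat.one_le_pow _ _ (by omega))]
    rcases le_total i K with hiK | hiK
    · refine ⟨fun _ => by omega, fun _ => ?_⟩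
      have := (h K 0).2 (by simp)
      rw [zero_add] at this
      exact (pow_dvd_pow _ hiK).trans this
    · obtain ⟨i', rfl⟩ := Nat.exists_eq_add_of_le' hiK
      rw [h K i', key i' (by omega)]
      omega

lemma Loc.dvd_sub_one (H : Loc p M v w x τ) (hv : v ≠ 0) : p ∣ τ - 1 :=
  (modEq_one_iff_dvd (by have := H.two_le; omega)).1 (H.modp hv)

lemma Loc.exists_E1_of_odd (H : Loc p M v w x τ) (hp2 : p ≠ 2) : ∃ ρ, E1 p v τ ρ := by
  rcases Nat.eq_zero_or_pos v with rfl | hv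
  · refine ⟨0, le_rfl, fun h => h, fun K i hi => ?_⟩
    rw [show i = 0 by omega]
    simp [Nat.modEq_one]
  · exact exists_E1_of_iff H.prime H.two_le H.dvd_sub_one fun K i =>
      pow_dvd_pow_sub_one_iff H.prime (H.prime.odd_of_ne_two hp2) H.two_le
        (H.dvd_sub_one hv.ne')

lemma Loc.exists_E1_two (H : Loc 2 M v w x τ) (h4 : 2 ≤ v → τ % 4 = 1) :
    ∃ ρ, E1 2 v τ ρ ∧ (2 ≤ v → 2 ≤ ρ) := by
  by_cases hv : 2 ≤ v
  · have h := h4 hv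
    obtain ⟨ρ, hρ⟩ := exists_E1_of_iff (v := v) Nat.prime_two H.two_le H.dvd_sub_one
      (fun K i => two_pow_dvd_pow_sub_one_iff h)
    refine ⟨ρ, hρ, fun _ => (hρ.iff 0 2 hv).1 ?_⟩
    unfold Nat.ModEq
    simpa using h
  · refine ⟨v, ⟨le_rfl, fun h => h, fun K i hi => ⟨fun _ => by omega, fun _ => ?_⟩⟩,
      fun h => absurd h hv⟩
    rcases Nat.eq_zero_or_pos i with rfl | h0
    · simp [Nat.modEq_one]
    · rw [show i = 1 by omega, pow_one]
      simpa using (H.modp (by omega)).pow (2 ^ K)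

lemma Loc.exists_E2 (H : Loc 2 M v w x τ) (hv : 2 ≤ v) (h4 : τ % 4 ≠ 1) : ∃ ρ, E2 v τ ρ := by
  have h2 : τ % 2 = 1 := H.modp (by omega)
  obtain ⟨ρ, hρ, hρ'⟩ := (Nat.dvd_prime_pow Nat.prime_two).1 (Nat.gcd_dvd_left (2 ^ v) (τ + 1))
  have key : ∀ i ≤ v, 2 ^ i ∣ τ + 1 ↔ i ≤ ρ := fun i hi => by
    rw [← Nat.pow_dvd_pow_iff_le_right one_lt_two, ← hρ', Nat.dvd_gcd_iff]
    exact ⟨fun h => ⟨pow_dvd_pow _ hi, h⟩, fun h => h.2⟩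
  refine ⟨ρ, (key 2 hv).1 (by norm_num; omega), hρ, (key ρ hρ).2 le_rfl, fun h h' => ?_⟩
  have := (key (ρ + 1) h).1 h'
  omega

end Types

lemma pow_dvd_pred_of_dvd_pow_pred {ℓ u N a : ℕ} (hℓ : ℓ.Prime) (hN : ¬ ℓ ∣ N) (hu : 1 ≤ u)
    (h1 : ℓ ∣ u - 1) (h : ℓ ^ a ∣ u ^ N - 1) : ℓ ^ a ∣ u - 1 := by
  have h2 : (∑ i ∈ Finset.range N, u ^ i) * (u - 1) = u ^ N - 1 := by
    zify [hu, Nat.one_le_pow N u hu]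
    exact geom_sum_mul _ _
  rw [← h2] at h
  refine Nat.Coprime.dvd_of_dvd_mul_left (Nat.Coprime.pow_left a ?_) h
  rw [Nat.Prime.coprime_iff_not_dvd hℓ]
  intro h3
  apply hN
  have h4 : ∑ i ∈ Finset.range N, u ^ i ≡ N [MOD ℓ] := by
    have h5 : u ≡ 1 [MOD ℓ] := (modEq_one_iff_dvd hu).2 h1
    rw [← ZMod.natCast_eq_natCast_iff] at h5 ⊢
    push_cast at h5 ⊢
    simp [h5]
  exact (Nat.modEq_zero_iff_dvd.1 (h4.symm.trans (Nat.modEq_zero_iff_dvd.2 h3)))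

lemma Arith.exists_split {p m n s t : ℕ} (hp : p.Prime) (A : Arith m n s t) :
    ∃ v w x M L n₁ s₁ τ, Split p m n s t v w x M L n₁ s₁ τ := by
  have hs : s ≠ 0 := fun h => A.m_pos.ne' (by simpa [h] using A.s_dvd)
  have hn1 : ordCompl[p] n ≠ 0 := (Nat.ordCompl_pos p A.n_pos.ne').ne'
  have hm1 : ordCompl[p] m ≠ 0 := (Nat.ordCompl_pos p A.m_pos.ne').ne'
  obtain ⟨n₁, hn₁⟩ : ∃ n₁, n₁ = ordCompl[p] n := ⟨_, rfl⟩
  obtain ⟨m₁, hm₁⟩ : ∃ m₁, m₁ = ordCompl[p] m := ⟨_, rfl⟩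
  have hn : n = p ^ n.factorization p * n₁ := by rw [hn₁, Nat.ordProj_mul_ordCompl_eq_self]
  have hm : m = p ^ m.factorization p * m₁ := by rw [hm₁, Nat.ordProj_mul_ordCompl_eq_self]
  obtain ⟨τ, hτ⟩ : ∃ τ, τ = t ^ n₁ := ⟨_, rfl⟩
  have hτ1 : 1 ≤ τ := by rw [hτ]; exact Nat.one_le_pow _ _ (by linarith [A.two_le])
  obtain ⟨M, hM⟩ := Nat.gcd_dvd_left m₁ (τ - 1)
  have hcm : Nat.Coprime p m₁ := by rw [hm₁]; exact Nat.coprime_ordCompl hp A.m_pos.ne'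
  have hm2 : m₁ = M * Nat.gcd m₁ (τ - 1) := by rw [mul_comm]; exact hM
  have hpow : τ ^ p ^ n.factorization p ≡ 1 [MOD m] := by
    rw [hτ, ← pow_mul, mul_comm, ← hn]; exact A.pow_t
  refine ⟨m.factorization p, n.factorization p, s.factorization p, M, Nat.gcd m₁ (τ - 1), n₁,
    ordCompl[p] s, τ, hp, by rw [← hm2]; exact hm, hn,
    (Nat.ordProj_mul_ordCompl_eq_self s p).symm, hcm.coprime_dvd_right ⟨_, hm2⟩,
    hcm.coprime_dvd_right (Nat.gcd_dvd_left _ _),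
    by rw [hn₁]; exact Nat.coprime_ordCompl hp A.n_pos.ne', Nat.coprime_ordCompl hp hs, hτ, ?_,
    (modEq_one_iff_dvd hτ1).2 (Nat.gcd_dvd_right _ _)⟩
  intro ℓ hℓ hℓM h1
  have hℓp : ¬ ℓ ∣ p ^ n.factorization p := by
    intro h
    have h2 := (Nat.prime_dvd_prime_iff_eq hℓ hp).1 (hℓ.dvd_of_dvd_pow h)
    rw [h2] at hℓM
    exact (Nat.Prime.coprime_iff_not_dvd hp).1 hcm (hm2 ▸ hℓM.mul_right _)
  have hm1' : m₁ ≠ 0 := by rw [hm₁]; exact hm1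
  have hd : ℓ ^ m₁.factorization ℓ ∣ m₁ := Nat.ordProj_dvd _ _
  have h3 : ℓ ^ m₁.factorization ℓ ∣ τ - 1 := by
    refine pow_dvd_pred_of_dvd_pow_pred hℓ hℓp hτ1 ((modEq_one_iff_dvd hτ1).1 h1) ?_
    rw [← modEq_one_iff_dvd (Nat.one_le_pow _ _ hτ1)]
    exact hpow.of_dvd (hd.trans ⟨_, by rw [mul_comm]; exact hm⟩)
  have h4 : ℓ ^ (m₁.factorization ℓ + 1) ∣ m₁ := by
    rw [pow_succ']
    have := mul_dvd_mul hℓM (Nat.dvd_gcd hd h3)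
    rwa [← hm2] at this
  have := (Nat.Prime.pow_dvd_iff_le_factorization hℓ hm1').1 h4
  omega

section Split
variable {p m n s t v w x M L n₁ s₁ τ : ℕ}

lemma Split.factorization_m (S : Split p m n s t v w x M L n₁ s₁ τ) (hm : 0 < m) :
    m.factorization p = v := by
  have h := S.hm
  have h0 : M * L ≠ 0 := fun h0 => by rw [h0] at h; simp at h; omega
  rw [h, Nat.factorization_mul (pow_ne_zero _ S.prime.ne_zero) h0]
  simp [S.prime.factorization_self,
    Nat.factorization_eq_zero_of_not_dvd
      ((Nat.Prime.coprime_iff_not_dvd S.prime).1 (S.cM.mul_right S.cL))]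

lemma Split.factorization_n (S : Split p m n s t v w x M L n₁ s₁ τ) (hn : 0 < n) :
    n.factorization p = w := by
  have h := S.hn
  have h0 : n₁ ≠ 0 := fun h0 => by rw [h0] at h; simp at h; omega
  rw [h, Nat.factorization_mul (pow_ne_zero _ S.prime.ne_zero) h0]
  simp [S.prime.factorization_self,
    Nat.factorization_eq_zero_of_not_dvd ((Nat.Prime.coprime_iff_not_dvd S.prime).1 S.cn)]

lemma Split.factorization_s (S : Split p m n s t v w x M L n₁ s₁ τ) (hs : 0 < s) :
    s.factorization p = x := by
  have h := S.hs
  have h0 : s₁ ≠ 0 := fun h0 => by rw [h0] at h; simp at h; omega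
  rw [h, Nat.factorization_mul (pow_ne_zero _ S.prime.ne_zero) h0]
  simp [S.prime.factorization_self,
    Nat.factorization_eq_zero_of_not_dvd ((Nat.Prime.coprime_iff_not_dvd S.prime).1 S.cs)]

/-- Away from `p`, the moving part `M` contains full primary parts of `m`. -/
lemma Split.pow_dvd_M (S : Split p m n s t v w x M L n₁ s₁ τ) {q i : ℕ}
    (hqM : q ∣ M) (h : q ^ i ∣ m) : q ^ i ∣ M := by
  have h1 : Nat.Coprime q L := Nat.Coprime.coprime_dvd_left hqM S.cML
  have h2 : Nat.Coprime q (p ^ v) :=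
    (Nat.Coprime.coprime_dvd_left hqM S.cM.symm).pow_right v
  rw [S.hm] at h
  exact Nat.Coprime.dvd_of_dvd_mul_right (h1.pow_left i)
    (Nat.Coprime.dvd_of_dvd_mul_left (h2.pow_left i) h)

lemma Split.pow_dvd_L (S : Split p m n s t v w x M L n₁ s₁ τ) {q i : ℕ} (hq : q.Prime)
    (hqp : q ≠ p) (hqM : ¬ q ∣ M) (h : q ^ i ∣ m) : q ^ i ∣ L := by
  have h1 : Nat.Coprime q M := (Nat.Prime.coprime_iff_not_dvd hq).2 hqM
  have h2 : Nat.Coprime q (p ^ v) := ((Nat.coprime_primes hq S.prime).2 hqp).pow_right v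
  rw [S.hm] at h
  exact Nat.Coprime.dvd_of_dvd_mul_left (h1.pow_left i)
    (Nat.Coprime.dvd_of_dvd_mul_left (h2.pow_left i) h)

lemma Split.not_modEq_one (S : Split p m n s t v w x M L n₁ s₁ τ) {q : ℕ} (hq : q.Prime)
    (hqM : q ∣ M) : ¬ t ≡ 1 [MOD q] := fun h =>
  S.move q hq hqM (by rw [S.hτ]; simpa using h.pow n₁)

end Split

/-- A prime `q ∣ m` on which `t` acts nontrivially divides the moving part at some prime. -/
lemma Arith.exists_split_dvd {q m n s t : ℕ} (A : Arith m n s t) (hq : q.Prime) (hqm : q ∣ m)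
    (ht : ¬ t ≡ 1 [MOD q]) :
    ∃ p v w x M L n₁ s₁ τ, Split p m n s t v w x M L n₁ s₁ τ ∧ q ∣ M := by
  obtain ⟨f, hf⟩ := exists_isPer (A.cop.coprime_dvd_right hqm)
  have hf1 : f ≠ 1 := fun h => ht (by simpa using (hf 1).2 (by rw [h]))
  have hfn : f ∣ n := (hf n).1 (A.pow_t.of_dvd hqm)
  have hfq : f ∣ q - 1 := by
    rw [← hf]
    have := Nat.ModEq.pow_totient (A.cop.coprime_dvd_right hqm)
    rwa [Nat.totient_prime hq] at this
  obtain ⟨p, hp, hpf⟩ := Nat.exists_prime_and_dvd hf1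
  obtain ⟨v, w, x, M, L, n₁, s₁, τ, S⟩ := A.exists_split hp
  refine ⟨p, v, w, x, M, L, n₁, s₁, τ, S, ?_⟩
  have hqp : q ≠ p := by
    rintro rfl
    have := Nat.le_of_dvd (Nat.sub_pos_of_lt hq.one_lt) (hpf.trans hfq)
    have := hq.one_lt
    omega
  by_contra hM
  have h1 := S.pow_dvd_L (i := 1) hq hqp hM (by simpa using hqm)
  rw [pow_one] at h1
  have h2 := S.triv.of_dvd h1
  rw [S.hτ, hf] at h2
  exact (Nat.Prime.coprime_iff_not_dvd hp).1 S.cn (hpf.trans h2)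

/-- The arithmetic content of minimality, with `μ` the modulus attached to the invariants. -/
structure MinArith (m n s t μ : ℕ) : Prop where
  dvd : μ ∣ m
  moving : ∀ q, q.Prime → q ∣ m → ¬ t ≡ 1 [MOD q] → μ.factorization q = m.factorization q
  one : ∀ {p v w x M L n₁ s₁ τ ρ κ}, Split p m n s t v w x M L n₁ s₁ τ → (p ∣ m → t ≡ 1 [MOD p]) →
    E1 p v τ ρ → (p = 2 → 2 ≤ v → 2 ≤ ρ) → IsPer τ M (p ^ κ) →
    x ≤ w ∧ (ρ ≤ x ∨ w < x + κ) ∧ μ.factorization p = expOne v w x ρ κ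
  two : ∀ {v w x M L n₁ s₁ τ ρ κ}, Split 2 m n s t v w x M L n₁ s₁ τ → E2 v τ ρ →
    IsPer τ M (2 ^ κ) → ¬ (x = v ∧ v = w + ρ) ∧
    (x + 1 = v → max κ 1 + 1 ≤ w → 3 ≤ v → ρ ≠ v) ∧ μ.factorization 2 = expTwo v w x ρ κ

section Assembly

variable {p m n s t v w x M L n₁ s₁ τ : ℕ} {m' n' s' t' v' w' x' M' L' n₁' s₁' τ' : ℕ}

lemma SameW.moving_iff_aux (h : SameW m n s t m' n' s' t') (A : Arith m n s t)
    (A' : Arith m' n' s' t') {q : ℕ} (hq : q.Prime) (hqm : q ∣ m) (ht : ¬ t ≡ 1 [MOD q]) :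
    q ∣ m' ∧ ¬ t' ≡ 1 [MOD q] ∧ ∀ i, q ^ i ∣ m → q ^ i ∣ m' := by
  obtain ⟨p, v, w, x, M, L, n₁, s₁, τ, S, hqM⟩ := A.exists_split_dvd hq hqm ht
  obtain ⟨v', w', x', M', L', n₁', s₁', τ', S'⟩ := A'.exists_split S.prime
  obtain ⟨rfl, -⟩ := S.locEq A S' A' h
  have hM : M ∣ m' := ⟨p ^ v' * L', by rw [S'.hm]; ring⟩
  exact ⟨hqM.trans hM, S'.not_modEq_one hq hqM, fun i hi => (S.pow_dvd_M hqM hi).trans hM⟩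

lemma SameW.moving_iff (h : SameW m n s t m' n' s' t') (A : Arith m n s t)
    (A' : Arith m' n' s' t') {q : ℕ} (hq : q.Prime) :
    (q ∣ m ∧ ¬ t ≡ 1 [MOD q]) ↔ (q ∣ m' ∧ ¬ t' ≡ 1 [MOD q]) :=
  ⟨fun g => ⟨(h.moving_iff_aux A A' hq g.1 g.2).1, (h.moving_iff_aux A A' hq g.1 g.2).2.1⟩,
    fun g => ⟨(h.symm.moving_iff_aux A' A hq g.1 g.2).1,
      (h.symm.moving_iff_aux A' A hq g.1 g.2).2.1⟩⟩

lemma SameW.factorization_eq (h : SameW m n s t m' n' s' t') (A : Arith m n s t)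
    (A' : Arith m' n' s' t') {q : ℕ} (hq : q.Prime) (hqm : q ∣ m) (ht : ¬ t ≡ 1 [MOD q]) :
    m.factorization q = m'.factorization q := by
  have h1 := h.moving_iff_aux A A' hq hqm ht
  have h2 := h.symm.moving_iff_aux A' A hq h1.1 h1.2.1
  refine le_antisymm ?_ ?_
  · exact (hq.pow_dvd_iff_le_factorization A'.m_pos.ne').1 (h1.2.2 _ (Nat.ordProj_dvd _ _))
  · exact (hq.pow_dvd_iff_le_factorization A.m_pos.ne').1 (h2.2.2 _ (Nat.ordProj_dvd _ _))

lemma Split.x_eq_v (S : Split p m n s t v w x M L n₁ s₁ τ) (A : Arith m n s t)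
    (ht : ¬ t ≡ 1 [MOD p]) : x = v := by
  refine le_antisymm (S.loc A).x_le ?_
  have h1 : p ^ v ∣ s * (t - 1) := by
    have h2 : s ≤ s * t := Nat.le_mul_of_pos_right _ (by linarith [A.two_le])
    have := (Nat.modEq_iff_dvd' h2).1 A.fix.symm
    rw [Nat.mul_sub, mul_one]
    exact (Dvd.intro _ S.hm.symm).trans this
  have h3 : Nat.Coprime (p ^ v) (t - 1) := by
    refine Nat.Coprime.pow_left _ ((Nat.Prime.coprime_iff_not_dvd S.prime).2 fun h => ht ?_)
    exact (modEq_one_iff_dvd (by linarith [A.two_le])).2 h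
  have h4 := h3.dvd_of_dvd_mul_right h1
  rw [S.hs] at h4
  exact (Nat.pow_dvd_pow_iff_le_right S.prime.one_lt).1
    (Nat.Coprime.dvd_of_dvd_mul_right (Nat.Coprime.pow_left _ S.cs) h4)

lemma SameW.local_eq (h : SameW m n s t m' n' s' t') (A : Arith m n s t) (A' : Arith m' n' s' t')
    {μ μ' : ℕ} (N : MinArith m n s t μ) (N' : MinArith m' n' s' t' μ')
    (S : Split p m n s t v w x M L n₁ s₁ τ) (S' : Split p m' n' s' t' v' w' x' M' L' n₁' s₁' τ') :
    μ.factorization p = μ'.factorization p ∧ ∃ z, τ ≡ τ' ^ z [MOD M * p ^ μ.factorization p] := by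
  obtain ⟨rfl, H⟩ := S.locEq A S' A' h
  obtain ⟨κ, -, hκ⟩ := H.left.exists_per (dvd_mul_right _ _)
  have hκ' := (H.isPer_iff_left dvd_rfl).1 hκ
  have hv := S.factorization_m A.m_pos
  have hv' := S'.factorization_m A'.m_pos
  have hdvd : v ≠ 0 → p ∣ m := fun h0 => by
    rw [S.hm]; exact (dvd_pow_self p h0).mul_right _
  have hdvd' : v' ≠ 0 → p ∣ m' := fun h0 => by
    rw [S'.hm]; exact (dvd_pow_self p h0).mul_right _
  by_cases hmov : p ∣ m ∧ ¬ t ≡ 1 [MOD p]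
  · have hmov' := (h.moving_iff A A' S.prime).1 hmov
    have hvv := h.factorization_eq A A' S.prime hmov.1 hmov.2
    rw [N.moving p S.prime hmov.1 hmov.2, N'.moving p S.prime hmov'.1 hmov'.2, ← hvv]
    rw [hv, hv'] at hvv
    subst hvv
    rw [hv]
    have hp2 : p ≠ 2 := by
      rintro rfl
      have h1 : ¬ 2 ∣ t := fun h2 =>
        Nat.not_coprime_of_dvd_of_dvd one_lt_two h2 hmov.1 A.cop
      apply hmov.2
      rw [Nat.ModEq]; omega
    obtain ⟨ρ, E⟩ := H.left.exists_E1_of_odd hp2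
    obtain ⟨ρ', E'⟩ := H.right.exists_E1_of_odd hp2
    have h1 := H.E1_gcd E E'
    obtain rfl : ρ = ρ' := by omega
    obtain rfl : w = w' := by omega
    exact ⟨rfl, H.E1_full E E' hκ (S.x_eq_v A hmov.2)⟩
  · have hmov' := fun h' => hmov ((h.moving_iff A A' S.prime).2 h')
    have ht : p ∣ m → t ≡ 1 [MOD p] := fun h1 => by_contra fun h2 => hmov ⟨h1, h2⟩
    have ht' : p ∣ m' → t' ≡ 1 [MOD p] := fun h1 => by_contra fun h2 => hmov' ⟨h1, h2⟩
    have typeOne : ∀ ρ ρ', E1 p v τ ρ → (p = 2 → 2 ≤ v → 2 ≤ ρ) → E1 p v' τ' ρ' →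
        (p = 2 → 2 ≤ v' → 2 ≤ ρ') → μ.factorization p = μ'.factorization p ∧
        ∃ z, τ ≡ τ' ^ z [MOD M * p ^ μ.factorization p] := by
      intro ρ ρ' E h2 E' h2'
      obtain ⟨h3, h4, h5⟩ := N.one S ht E h2 hκ
      obtain ⟨h3', h4', h5'⟩ := N'.one S' ht' E' h2' hκ'
      obtain ⟨rfl, rfl, rfl⟩ := H.E1_rho E E' h3 h3' h4 h4' hκ
      rw [h5, h5']
      exact H.E1_final E E' hκ
    by_cases hp2 : p = 2
    · subst hp2
      by_cases c : 2 ≤ v → τ % 4 = 1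
      · obtain ⟨ρ, E, hρ⟩ := H.left.exists_E1_two c
        by_cases c' : 2 ≤ v' → τ' % 4 = 1
        · obtain ⟨ρ', E', hρ'⟩ := H.right.exists_E1_two c'
          exact typeOne ρ ρ' E (fun _ => hρ) E' (fun _ => hρ')
        · push Not at c'
          obtain ⟨ρ', E'⟩ := H.right.exists_E2 c'.1 c'.2
          obtain ⟨h3, h4, -⟩ := N.one S ht E (fun _ => hρ) hκ
          exact (H.symm.not_mixed E' E hρ hκ' h3 h4).elim
      · push Not at c
        obtain ⟨ρ, E⟩ := H.left.exists_E2 c.1 c.2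
        by_cases c' : 2 ≤ v' → τ' % 4 = 1
        · obtain ⟨ρ', E', hρ'⟩ := H.right.exists_E1_two c'
          obtain ⟨h3, h4, -⟩ := N'.one S' ht' E' (fun _ => hρ') hκ'
          exact (H.not_mixed E E' hρ' hκ h3 h4).elim
        · push Not at c'
          obtain ⟨ρ', E'⟩ := H.right.exists_E2 c'.1 c'.2
          obtain ⟨h3, h4, h5⟩ := N.two S E hκ
          obtain ⟨h3', h4', h5'⟩ := N'.two S' E' hκ'
          obtain ⟨rfl, rfl⟩ := H.E2_vw E E'
          obtain rfl : ρ = ρ' := le_antisymm (H.symm.E2_rho_not_lt E' E hκ' h4)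
            (H.E2_rho_not_lt E E' hκ h4')
          rw [h5, h5']
          exact H.E2_final E E' hκ h3 h3'
    · obtain ⟨ρ, E⟩ := H.left.exists_E1_of_odd hp2
      obtain ⟨ρ', E'⟩ := H.right.exists_E1_of_odd hp2
      exact typeOne ρ ρ' E (fun h => absurd h hp2) E' (fun h => absurd h hp2)

lemma modEq_of_forall_prime_pow {a b N : ℕ} (hN : N ≠ 0)
    (h : ∀ q, q.Prime → a ≡ b [MOD q ^ N.factorization q]) : a ≡ b [MOD N] := by
  rw [Nat.modEq_iff_dvd]
  have key : N ∣ ((b : ℤ) - a).natAbs := by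
    refine (Nat.dvd_iff_prime_pow_dvd_dvd _ _).2 fun q k hq hk => ?_
    have h1 := (Nat.modEq_iff_dvd.1 (h q hq))
    rw [← Int.natAbs_dvd_natAbs, Int.natAbs_natCast] at h1
    exact (pow_dvd_pow q ((hq.pow_dvd_iff_le_factorization hN).1 hk)).trans h1
  exact Int.natCast_dvd.2 key

lemma Split.modEq_glue (S : Split p m n s t v w x M L n₁ s₁ τ)
    (S' : Split p m' n' s' t' v' w' x' M L' n₁' s₁' τ') {μ z : ℕ} (hμ : μ ∣ m) (hμ' : μ ∣ m')
    (h0 : μ ≠ 0) (hz : τ ≡ τ' ^ z [MOD M * p ^ μ.factorization p]) : τ ≡ τ' ^ z [MOD μ] := by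
  refine modEq_of_forall_prime_pow h0 fun q hq => ?_
  have h1 : q ^ μ.factorization q ∣ μ := Nat.ordProj_dvd _ _
  by_cases hqp : q = p
  · subst hqp; exact hz.of_dvd (dvd_mul_left _ _)
  by_cases hqM : q ∣ M
  · exact hz.of_dvd ((S.pow_dvd_M hqM (h1.trans hμ)).mul_right _)
  · have h2 := S.triv.of_dvd (S.pow_dvd_L hq hqp hqM (h1.trans hμ))
    have h3 := S'.triv.of_dvd (S'.pow_dvd_L hq hqp hqM (h1.trans hμ'))
    exact h2.trans (by simpa using (h3.pow z).symm)

theorem SameW.modulus_eq (h : SameW m n s t m' n' s' t') (A : Arith m n s t)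
    (A' : Arith m' n' s' t') {μ μ' : ℕ} (N : MinArith m n s t μ) (N' : MinArith m' n' s' t' μ') :
    μ = μ' := by
  have h0 : μ ≠ 0 := fun h => A.m_pos.ne' (by simpa [h] using N.dvd)
  have h0' : μ' ≠ 0 := fun h => A'.m_pos.ne' (by simpa [h] using N'.dvd)
  refine Nat.eq_of_factorization_eq h0 h0' fun p => ?_
  by_cases hp : p.Prime
  · obtain ⟨v, w, x, M, L, n₁, s₁, τ, S⟩ := A.exists_split hp
    obtain ⟨v', w', x', M', L', n₁', s₁', τ', S'⟩ := A'.exists_split hp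
    exact (h.local_eq A A' N N' S S').1
  · rw [Nat.factorization_eq_zero_of_not_prime _ hp, Nat.factorization_eq_zero_of_not_prime _ hp]

lemma SameW.exists_pow (h : SameW m n s t m' n' s' t') (A : Arith m n s t)
    (A' : Arith m' n' s' t') {μ : ℕ} (N : MinArith m n s t μ) (N' : MinArith m' n' s' t' μ) :
    ∃ z, t ≡ t' ^ z [MOD μ] := by
  have h0 : μ ≠ 0 := fun h => A.m_pos.ne' (by simpa [h] using N.dvd)
  have : NeZero μ := ⟨h0⟩
  have c := A.cop.coprime_dvd_right N.dvd
  have c' := A'.cop.coprime_dvd_right N'.dvd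
  obtain ⟨u, hu⟩ : ∃ u : (ZMod μ)ˣ, (u : ZMod μ) = t := ⟨ZMod.unitOfCoprime t c, by simp⟩
  obtain ⟨u', hu'⟩ : ∃ u : (ZMod μ)ˣ, (u : ZMod μ) = t' := ⟨ZMod.unitOfCoprime t' c', by simp⟩
  have hn : u ^ n = 1 := by
    have := A.pow_t.of_dvd N.dvd
    rw [← ZMod.natCast_eq_natCast_iff] at this
    ext
    push_cast at this ⊢
    rw [hu]; exact this
  let f := QuotientGroup.mk' (Subgroup.zpowers u')
  have key : orderOf (f u) = 1 := by
    by_contra h1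
    obtain ⟨p, hp, hpd⟩ := Nat.exists_prime_and_dvd h1
    obtain ⟨v, w, x, M, L, n₁, s₁, τ, S⟩ := A.exists_split hp
    obtain ⟨v', w', x', M', L', n₁', s₁', τ', S'⟩ := A'.exists_split hp
    obtain ⟨-, z, hz⟩ := h.local_eq A A' N N' S S'
    obtain ⟨rfl, -⟩ := S.locEq A S' A' h
    have h2 := S.modEq_glue S' N.dvd N'.dvd h0 hz
    rw [S.hτ, S'.hτ, ← pow_mul, ← ZMod.natCast_eq_natCast_iff] at h2
    have h3 : u ^ n₁ = u' ^ (n₁' * z) := by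
      ext
      push_cast at h2 ⊢
      rw [hu, hu']; exact h2
    have h4 : f u ^ n₁ = 1 := by
      rw [← map_pow, h3]
      exact (QuotientGroup.eq_one_iff _).2 (pow_mem (Subgroup.mem_zpowers _) _)
    exact (Nat.Prime.coprime_iff_not_dvd hp).1 S.cn (hpd.trans (orderOf_dvd_of_pow_eq_one h4))
  rw [orderOf_eq_one_iff] at key
  have h5 : u ∈ Subgroup.zpowers u' := (QuotientGroup.eq_one_iff _).1 key
  rw [← mem_powers_iff_mem_zpowers] at h5
  obtain ⟨z, hz⟩ := h5
  refine ⟨z, ?_⟩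
  rw [← ZMod.natCast_eq_natCast_iff]
  push_cast
  rw [← hu, ← hu', ← hz]
  simp

theorem SameW.powers_eq (h : SameW m n s t m' n' s' t') (A : Arith m n s t)
    (A' : Arith m' n' s' t') {μ : ℕ} (N : MinArith m n s t μ) (N' : MinArith m' n' s' t' μ)
    (y : ℕ) : (∃ i, y ≡ t ^ i [MOD μ]) ↔ ∃ i, y ≡ t' ^ i [MOD μ] := by
  obtain ⟨z, hz⟩ := h.exists_pow A A' N N'
  obtain ⟨z', hz'⟩ := h.symm.exists_pow A' A N' N
  constructor
  · rintro ⟨i, hi⟩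
    exact ⟨z * i, hi.trans (by rw [pow_mul]; exact hz.pow i)⟩
  · rintro ⟨i, hi⟩
    exact ⟨z' * i, hi.trans (by rw [pow_mul]; exact hz'.pow i)⟩

end Assembly

lemma zpowers_pow_coprime {G : Type*} [Group G] {a : G} {c : ℕ} (hc : Nat.Coprime c (orderOf a)) :
    Subgroup.zpowers (a ^ c) = Subgroup.zpowers a := by
  refine le_antisymm (Subgroup.zpowers_le.2 (Subgroup.npow_mem_zpowers a c)) ?_
  refine Subgroup.zpowers_le.2 ?_
  obtain ⟨k, hk⟩ := exists_pow_eq_self_of_coprime hc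
  rw [Subgroup.mem_zpowers_iff]
  exact ⟨k, by exact_mod_cast hk⟩

lemma mem_zpowers_iff_pow {G : Type*} [Group G] [Finite G] {a g : G} : g ∈ Subgroup.zpowers a ↔ ∃ i : ℕ, a ^ i = g := by
  rw [← mem_powers_iff_mem_zpowers]; rfl

section Presentation

variable {G : Type*} [Group G] [Finite G]

lemma exists_pow_coprime_generator {a : G} {s u : ℕ}
    (hu : Nat.Coprime u (orderOf (a ^ s))) :
    ∃ c, Nat.Coprime c (orderOf a) ∧ (a ^ c) ^ s = (a ^ s) ^ u := by
  have hpos := orderOf_pos a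
  have : NeZero (orderOf a) := ⟨hpos.ne'⟩
  obtain ⟨c, hc⟩ := ZMod.unitsMap_surjective (orderOf_dvd_of_mem_zpowers
    (Subgroup.npow_mem_zpowers a s)) (ZMod.unitOfCoprime u hu)
  refine ⟨(c : ZMod (orderOf a)).val, ZMod.val_coe_unit_coprime c, ?_⟩
  rw [← pow_mul, mul_comm, pow_mul, pow_eq_pow_iff_modEq, ← ZMod.natCast_eq_natCast_iff]
  have h1 := congrArg Units.val hc
  rw [ZMod.unitsMap_val, ZMod.coe_unitOfCoprime] at h1
  rw [← h1, ZMod.cast_eq_val]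

theorem MetacyclicFact.exists_pres (f : MetacyclicFact G) :
    ∃ a b t, Subgroup.zpowers a = f.A ∧ Subgroup.zpowers b = f.B ∧
      Pres a b (mOf f) (nOf f) (sOf f) t ∧ Arith (mOf f) (nOf f) (sOf f) t := by
  obtain ⟨A, B, hN, hA, hB, hcov⟩ := f
  simp only [mOf, nOf, sOf]
  obtain ⟨a₀, rfl⟩ := (Subgroup.isCyclic_iff_exists_zpowers_eq_top A).1 hA
  obtain ⟨b, rfl⟩ := (Subgroup.isCyclic_iff_exists_zpowers_eq_top B).1 hB
  obtain ⟨m, hm⟩ : ∃ m, m = Nat.card (Subgroup.zpowers a₀) := ⟨_, rfl⟩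
  obtain ⟨n, hn⟩ : ∃ n, n = (Subgroup.zpowers a₀).index := ⟨_, rfl⟩
  obtain ⟨s, hs⟩ : ∃ s, s = (Subgroup.zpowers b).index := ⟨_, rfl⟩
  rw [← hm, ← hn, ← hs]
  have hma : orderOf a₀ = m := by rw [hm, Nat.card_zpowers]
  have hm0 : 0 < m := hma ▸ orderOf_pos a₀
  have hn0 : 0 < n := hn ▸ Nat.pos_of_ne_zero Subgroup.index_ne_zero_of_finite
  have hs0 : 0 < s := hs ▸ Nat.pos_of_ne_zero Subgroup.index_ne_zero_of_finite
  have hcard : Nat.card G = m * n := by rw [hm, hn, Subgroup.card_mul_index]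
  have hmem : ∀ y : ℕ, b ^ y ∈ Subgroup.zpowers a₀ ↔ n ∣ y := by
    intro y
    let q := QuotientGroup.mk' (Subgroup.zpowers a₀)
    have h1 : ∀ z, z ∈ Subgroup.zpowers (q b) := by
      intro z
      obtain ⟨g, rfl⟩ := QuotientGroup.mk'_surjective _ z
      obtain ⟨x, hx, y, hy, rfl⟩ := hcov g
      have : q x = 1 := (QuotientGroup.eq_one_iff x).2 hx
      obtain ⟨i, rfl⟩ := Subgroup.mem_zpowers_iff.1 hy
      change q (x * b ^ i) ∈ _
      rw [map_mul, this, one_mul, map_zpow]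
      exact Subgroup.zpow_mem_zpowers _ _
    have h2 : orderOf (q b) = n := by
      rw [orderOf_eq_card_of_forall_mem_zpowers h1, hn]; rfl
    rw [← h2, orderOf_dvd_iff_pow_eq_one, ← map_pow]
    exact (QuotientGroup.eq_one_iff _).symm
  have hnb : n ∣ orderOf b := (hmem _).1 (by rw [pow_orderOf_eq_one]; exact one_mem _)
  obtain ⟨o, ho⟩ := hnb
  have hbn : orderOf (b ^ n) = o := by
    rw [orderOf_pow, ho, Nat.gcd_mul_right_left, Nat.mul_div_cancel_left _ hn0]
  have hbs : orderOf b * s = m * n := by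
    rw [← Nat.card_zpowers, hs, Subgroup.card_mul_index, hcard]
  have hso : m = s * o := by
    rw [ho] at hbs
    exact Nat.eq_of_mul_eq_mul_right hn0 (by rw [← hbs]; ring)
  have hsm : s ∣ m := ⟨o, hso⟩
  have h3 : orderOf (a₀ ^ s) = o := by
    rw [orderOf_pow, hma, hso, Nat.gcd_mul_right_left, Nat.mul_div_cancel_left _ hs0]
  have ho0 : 0 < o := Nat.pos_of_ne_zero fun h => by rw [h] at hso; simp at hso; omega
  have h5 : b ^ n ∈ Subgroup.zpowers (a₀ ^ s) := by
    obtain ⟨j, hj⟩ := mem_zpowers_iff_pow.1 ((hmem n).2 dvd_rfl)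
    have h6 := congrArg orderOf hj
    rw [orderOf_pow, hbn, hma] at h6
    have h7 := Nat.div_mul_cancel (Nat.gcd_dvd_left m j)
    rw [h6, mul_comm] at h7
    obtain ⟨e, rfl⟩ : s ∣ j := Nat.eq_of_mul_eq_mul_right ho0 (h7.trans hso) ▸ Nat.gcd_dvd_right m j
    rw [← hj, pow_mul]
    exact Subgroup.npow_mem_zpowers _ _
  obtain ⟨u, hu⟩ := mem_zpowers_iff_pow.1 h5
  have hucop : Nat.Coprime u (orderOf (a₀ ^ s)) := by
    have h6 := congrArg orderOf hu
    rw [orderOf_pow, hbn, h3] at h6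
    rw [h3, Nat.coprime_comm]
    have := Nat.div_mul_cancel (Nat.gcd_dvd_left o u)
    rw [h6] at this
    exact Nat.eq_of_mul_eq_mul_left ho0 (by rw [this, mul_one])
  obtain ⟨c, hc, hcs⟩ := exists_pow_coprime_generator hucop
  rw [hu] at hcs
  have hz := zpowers_pow_coprime hc
  obtain ⟨a, ha⟩ : ∃ a, a = a₀ ^ c := ⟨_, rfl⟩
  rw [← ha] at hcs hz
  have hao : orderOf a = m := by rw [← Nat.card_zpowers, hz, hm]
  have hconj : b⁻¹ * a * b ∈ Subgroup.zpowers a := by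
    rw [hz]
    have := hN.conj_mem a (by rw [← hz]; exact Subgroup.mem_zpowers a) b⁻¹
    simpa using this
  obtain ⟨t₀, ht₀⟩ := mem_zpowers_iff_pow.1 hconj
  have ht : a ^ (t₀ + m * 2) = b⁻¹ * a * b := by
    rw [pow_add, pow_mul, ← hao, pow_orderOf_eq_one, one_pow, mul_one, ht₀]
  have hcomm : a * b = b * a ^ (t₀ + m * 2) := by rw [ht]; group
  refine ⟨a, b, t₀ + m * 2, hz, rfl, ?_⟩
  have hcop : Nat.Coprime (t₀ + m * 2) m := by
    have h6 : orderOf (a ^ (t₀ + m * 2)) = m := by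
      rw [ht, ← hao]
      have := (MulAut.conj b⁻¹).orderOf_eq a
      simpa [MulAut.conj_apply] using this
    rw [orderOf_pow, hao] at h6
    rw [Nat.coprime_comm]
    have := Nat.div_mul_cancel (Nat.gcd_dvd_left m (t₀ + m * 2))
    rw [h6] at this
    exact Nat.eq_of_mul_eq_mul_left hm0 (by rw [this, mul_one])
  have hpt : (t₀ + m * 2) ^ n ≡ 1 [MOD m] := by
    have h6 := pow_mul_pow_comm hcomm 1 n
    rw [← hcs, ← pow_add, ← pow_add, pow_eq_pow_iff_modEq, hao, one_mul, add_comm] at h6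
    exact (Nat.ModEq.add_left_cancel' s h6).symm
  have hfix : s * (t₀ + m * 2) ≡ s [MOD m] := by
    have h6 := pow_mul_pow_comm hcomm s 1
    rw [hcs, pow_one, pow_mul, hcs, ← pow_succ, pow_succ'] at h6
    have h7 := mul_left_cancel h6
    rw [← hcs, ← pow_mul, pow_eq_pow_iff_modEq, hao] at h7
    rw [pow_one] at h7
    exact h7.symm
  refine ⟨⟨hn0, hm0, hao, hcomm, hcs.symm, hcard, ?_, fun y => by rw [hz]; exact hmem y, hsm,
    hcop, hpt, hfix⟩, ⟨hn0, hm0, hsm, hcop, hpt, hfix, by omega⟩⟩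
  intro g
  obtain ⟨x, hx, y, hy, hg⟩ := hcov g⁻¹
  rw [← hz] at hx
  obtain ⟨i, hi⟩ := mem_zpowers_iff_pow.1 (inv_mem hx)
  obtain ⟨j, hj⟩ := mem_zpowers_iff_pow.1 (inv_mem hy)
  refine ⟨i, j, ?_⟩
  rw [hi, hj, ← mul_inv_rev, ← hg, inv_inv]

end Presentation

/-- The conjugation action of `G` on the cyclic normal subgroup generated by `g` is given by the
powers of `T`. -/
structure Acts {G : Type*} [Group G] (g : G) (T : ℕ) : Prop where
  cop : Nat.Coprime T (orderOf g)
  left : ∀ h : G, ∃ i : ℕ, h⁻¹ * g * h = g ^ T ^ i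
  right : ∀ i : ℕ, ∃ h : G, h⁻¹ * g * h = g ^ T ^ i

section Acts

variable {G : Type*} [Group G] {a b g : G} {m n s t T d q : ℕ}

lemma conj_pow' (h g : G) (i : ℕ) : h⁻¹ * g ^ i * h = (h⁻¹ * g * h) ^ i := by
  have := conj_pow (i := i) (a := h⁻¹) (b := g)
  simpa using this.symm

lemma Pres.forall_of_gen (P : Pres a b m n s t) {p : G → Prop} (h1 : p 1) (ha : p a) (hb : p b)
    (hmul : ∀ x y, p x → p y → p (x * y)) (g : G) : p g := by
  have hpow : ∀ x, p x → ∀ i : ℕ, p (x ^ i) := by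
    intro x hx i
    induction i with
    | zero => simpa using h1
    | succ k ih => rw [pow_succ]; exact hmul _ _ ih hx
  obtain ⟨x, y, rfl⟩ := P.cover g
  exact hmul _ _ (hpow b hb y) (hpow a ha x)

lemma Pres.acts [Finite G] (P : Pres a b m n s t) (ha : a⁻¹ * g * a = g) (hb : b⁻¹ * g * b = g ^ T) :
    Acts g T where
  cop := by
    have h6 : orderOf (g ^ T) = orderOf g := by
      rw [← hb]
      have := (MulAut.conj b⁻¹).orderOf_eq g
      simpa [MulAut.conj_apply] using this
    rw [orderOf_pow] at h6
    rw [Nat.coprime_comm]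
    have := Nat.div_mul_cancel (Nat.gcd_dvd_left (orderOf g) T)
    rw [h6] at this
    exact Nat.eq_of_mul_eq_mul_left (orderOf_pos g) (by rw [this, mul_one])
  left := by
    refine P.forall_of_gen ⟨0, by simp⟩ ⟨0, by simpa using ha⟩ ⟨1, by simpa using hb⟩ ?_
    rintro x y ⟨i, hi⟩ ⟨j, hj⟩
    refine ⟨i + j, ?_⟩
    have : (x * y)⁻¹ * g * (x * y) = y⁻¹ * (x⁻¹ * g * x) * y := by group
    rw [this, hi, conj_pow', hj, ← pow_mul]
    congr 1
    ring
  right := by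
    intro i
    induction i with
    | zero => exact ⟨1, by simp⟩
    | succ k ih =>
      obtain ⟨h, hh⟩ := ih
      refine ⟨b * h, ?_⟩
      have : (b * h)⁻¹ * g * (b * h) = h⁻¹ * (b⁻¹ * g * b) * h := by group
      rw [this, hb, conj_pow', hh, ← pow_mul]
      rfl

lemma Acts.normal (h : Acts g T) : (Subgroup.zpowers g).Normal where
  conj_mem := by
    intro x hx y
    obtain ⟨k, rfl⟩ := Subgroup.mem_zpowers_iff.1 hx
    obtain ⟨i, hi⟩ := h.left y⁻¹
    rw [inv_inv] at hi
    rw [← conj_zpow, hi]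
    exact zpow_mem (Subgroup.npow_mem_zpowers g _) k

variable [Finite G]

lemma Acts.mem_TGmod (h : Acts g T) (hd : d ∣ orderOf g) {u : (ZMod d)ˣ} :
    u ∈ TGmod (Subgroup.zpowers g) d ↔ ∃ i : ℕ, (u : ZMod d) = (T : ZMod d) ^ i := by
  have hd0 : d ≠ 0 := fun h0 => (orderOf_pos g).ne' (by simpa [h0] using hd)
  have : NeZero d := ⟨hd0⟩
  have hc := h.cop.coprime_dvd_right hd
  have key : TGmod (Subgroup.zpowers g) d = Subgroup.zpowers (ZMod.unitOfCoprime T hc) := by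
    refine le_antisymm ((Subgroup.closure_le _).2 ?_) ?_
    · rintro u ⟨x, t', ht', hx⟩
      obtain ⟨i, hi⟩ := h.left x
      rw [hx g (Subgroup.mem_zpowers g), pow_eq_pow_iff_modEq] at hi
      have h1 := (ZMod.natCast_eq_natCast_iff _ _ _).2 (hi.of_dvd hd)
      refine Subgroup.mem_zpowers_iff.2 ⟨i, ?_⟩
      ext
      rw [← ht', h1]
      simp
    · rw [Subgroup.zpowers_le]
      obtain ⟨x, hx⟩ := h.right 1
      refine Subgroup.subset_closure ⟨x, T, by simp, ?_⟩
      intro y hy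
      obtain ⟨i, rfl⟩ := mem_zpowers_iff_pow.1 hy
      rw [conj_pow', hx, pow_one, ← pow_mul, ← pow_mul, mul_comm]
  rw [key, ← mem_powers_iff_mem_zpowers, Submonoid.mem_powers_iff]
  constructor
  · rintro ⟨i, rfl⟩
    exact ⟨i, by simp⟩
  · rintro ⟨i, hi⟩
    exact ⟨i, by ext; simp [hi]⟩

lemma Acts.exists_unit (h : Acts g T) (hd : d ∣ orderOf g) (i : ℕ) :
    ∃ u ∈ TGmod (Subgroup.zpowers g) d, (u : ZMod d) = (T : ZMod d) ^ i := by
  have hc := h.cop.coprime_dvd_right hd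
  exact ⟨ZMod.unitOfCoprime T hc ^ i, (h.mem_TGmod hd).2 ⟨i, by simp⟩, by simp⟩

lemma Acts.mem_liftSet (h : Acts g T) (hd : d ∣ orderOf g) {x : ℕ} :
    x ∈ liftSet (TGmod (Subgroup.zpowers g) d) ↔ ∃ i, x ≡ T ^ i [MOD d] := by
  simp only [← ZMod.natCast_eq_natCast_iff, Nat.cast_pow]
  constructor
  · rintro ⟨u, hu, hx⟩
    obtain ⟨i, hi⟩ := (h.mem_TGmod hd).1 hu
    exact ⟨i, hx.trans hi⟩
  · rintro ⟨i, hi⟩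
    obtain ⟨u, hu, hu'⟩ := h.exists_unit hd i
    exact ⟨u, hu, hi.trans hu'.symm⟩

lemma Acts.forall_TG (h : Acts g T) (hq : q ∣ orderOf g) {p : ZMod q → Prop} :
    (∀ u ∈ TG (Subgroup.zpowers g), ∀ x : ℕ, ((x : ZMod (Nat.card (Subgroup.zpowers g))) = u) →
      p (x : ZMod q)) ↔ ∀ i, p ((T : ZMod q) ^ i) := by
  have hcard : Nat.card (Subgroup.zpowers g) = orderOf g := Nat.card_zpowers g
  have hd : Nat.card (Subgroup.zpowers g) ∣ orderOf g := by rw [hcard]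
  constructor
  · intro hp i
    obtain ⟨u, hu, hu'⟩ := h.exists_unit hd i
    have := hp u hu (T ^ i) (by rw [hu']; push_cast; rfl)
    simpa using this
  · intro hp u hu x hx
    obtain ⟨i, hi⟩ := (h.mem_TGmod hd).1 hu
    have h1 : x ≡ T ^ i [MOD q] := by
      rw [hx.symm, ← Nat.cast_pow, ZMod.natCast_eq_natCast_iff, hcard] at hi
      exact hi.of_dvd hq
    rw [(ZMod.natCast_eq_natCast_iff _ _ _).2 h1]
    simpa using hp i

lemma Acts.resTriv_iff (h : Acts g T) (hq : q ∣ orderOf g) :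
    resTriv (Nat.card (Subgroup.zpowers g)) q (TG (Subgroup.zpowers g)) ↔ T ≡ 1 [MOD q] := by
  rw [resTriv, h.forall_TG hq (p := fun y => y = 1), ← ZMod.natCast_eq_natCast_iff, Nat.cast_one]
  exact ⟨fun h => by simpa using h 1, fun h i => by rw [h, one_pow]⟩

lemma Acts.resInPMOne_iff (h : Acts g T) (hq : q ∣ orderOf g) :
    resInPMOne (Nat.card (Subgroup.zpowers g)) q (TG (Subgroup.zpowers g)) ↔
      T ≡ 1 [MOD q] ∨ q ∣ T + 1 := by
  rw [resInPMOne, h.forall_TG hq (p := fun y => y = 1 ∨ y = -1), ← ZMod.natCast_eq_natCast_iff,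
    Nat.cast_one, ← ZMod.natCast_eq_zero_iff, Nat.cast_add, Nat.cast_one, ← eq_neg_iff_add_eq_zero]
  refine ⟨fun h => by simpa using h 1, fun h i => ?_⟩
  rcases h with h | h
  · left; rw [h, one_pow]
  · rw [h]; exact neg_one_pow_eq_or _ i

/-- The condition on `p`-parts defining `r`. -/
def RCond (T p i : ℕ) : Prop := T ≡ 1 [MOD p ^ i] ∨ (p = 2 ∧ 2 ^ i ∣ T + 1)

lemma RCond.mono {p i j : ℕ} (h : RCond T p i) (hj : j ≤ i) : RCond T p j := by
  rcases h with h | ⟨rfl, h⟩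
  · exact Or.inl (h.of_dvd (pow_dvd_pow p hj))
  · exact Or.inr ⟨rfl, (pow_dvd_pow 2 hj).trans h⟩

lemma rcond_iff {r : ℕ} (hr : r ≠ 0) : (T ≡ 1 [MOD ordCompl[2] r] ∧
    (T ≡ 1 [MOD ordProj[2] r] ∨ ordProj[2] r ∣ T + 1)) ↔
    ∀ p, p.Prime → RCond T p (r.factorization p) := by
  constructor
  · rintro ⟨h1, h2⟩ p hp
    by_cases hp2 : p = 2
    · subst hp2
      rcases h2 with h2 | h2
      · exact Or.inl h2
      · exact Or.inr ⟨rfl, h2⟩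
    · refine Or.inl (h1.of_dvd ?_)
      refine Nat.Coprime.dvd_of_dvd_mul_left (m := ordProj[2] r) ?_ ?_
      · exact Nat.Coprime.pow _ _ ((Nat.coprime_primes hp Nat.prime_two).2 hp2)
      · rw [Nat.ordProj_mul_ordCompl_eq_self]; exact Nat.ordProj_dvd _ _
  · intro h
    constructor
    · refine modEq_of_forall_prime_pow (Nat.ordCompl_pos 2 hr).ne' fun q hq => ?_
      by_cases hq2 : q = 2
      · subst hq2
        rw [Nat.factorization_ordCompl, Finsupp.erase_same, pow_zero]
        exact Nat.modEq_one
      · rw [Nat.factorization_ordCompl, Finsupp.erase_ne hq2]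
        exact (h q hq).resolve_right fun h => hq2 h.1
    · rcases h 2 Nat.prime_two with h | h
      · exact Or.inl h
      · exact Or.inr h.2

lemma Acts.rOfA_isGreatest (h : Acts g T) :
    IsGreatest {r | r ∣ orderOf g ∧ ∀ p, p.Prime → RCond T p (r.factorization p)}
      (rOfA (Subgroup.zpowers g)) := by
  have hg := orderOf_pos g
  have hset : {r : ℕ | r ∣ Nat.card (Subgroup.zpowers g) ∧
      resTriv (Nat.card (Subgroup.zpowers g)) (ordCompl[2] r) (TG (Subgroup.zpowers g)) ∧
      resInPMOne (Nat.card (Subgroup.zpowers g)) (ordProj[2] r) (TG (Subgroup.zpowers g))} =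
      {r | r ∣ orderOf g ∧ ∀ p, p.Prime → RCond T p (r.factorization p)} := by
    ext r
    simp only [Set.mem_ofPred_eq]
    refine and_congr_right_iff.2 (fun hr => ?_) |>.trans (and_congr_left' (by rw [Nat.card_zpowers]))
    rw [Nat.card_zpowers] at hr
    rw [h.resTriv_iff ((Nat.ordCompl_dvd r 2).trans hr),
      h.resInPMOne_iff ((Nat.ordProj_dvd r 2).trans hr),
      rcond_iff fun h0 => hg.ne' (by simpa [h0] using hr)]
  rw [rOfA, hset]
  have hbdd : BddAbove {r | r ∣ orderOf g ∧ ∀ p, p.Prime → RCond T p (r.factorization p)} :=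
    ⟨orderOf g, fun r hr => Nat.le_of_dvd hg hr.1⟩
  refine ⟨Nat.sSup_mem ⟨1, one_dvd _, fun p _ => ?_⟩ hbdd, fun r hr => le_csSup hbdd hr⟩
  simp [RCond, Nat.modEq_one]

lemma Acts.rOfA_dvd (h : Acts g T) : rOfA (Subgroup.zpowers g) ∣ orderOf g :=
  h.rOfA_isGreatest.1.1

lemma Acts.rOfA_ne_zero (h : Acts g T) : rOfA (Subgroup.zpowers g) ≠ 0 := fun h0 =>
  (orderOf_pos g).ne' (by simpa [h0] using h.rOfA_dvd)

lemma exists_replace {N r p i : ℕ} (hp : p.Prime) (hr : r ∣ N) (hN : N ≠ 0) (hi : p ^ i ∣ N) :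
    ∃ r', r' ∣ N ∧ r'.factorization p = i ∧ (∀ q, q ≠ p → r'.factorization q = r.factorization q) ∧
      r * p ^ i = r' * p ^ r.factorization p := by
  have hr0 : r ≠ 0 := fun h0 => hN (by simpa [h0] using hr)
  have hc0 := (Nat.ordCompl_pos p hr0).ne'
  have hcop : Nat.Coprime (p ^ i) (ordCompl[p] r) :=
    Nat.Coprime.pow_left _ (Nat.coprime_ordCompl hp hr0)
  refine ⟨p ^ i * ordCompl[p] r, hcop.mul_dvd_of_dvd_of_dvd hi ((Nat.ordCompl_dvd r p).trans hr),
    ?_, fun q hq => ?_, ?_⟩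
  · rw [Nat.factorization_mul (pow_ne_zero _ hp.ne_zero) hc0, Nat.factorization_ordCompl]
    simp [hp.factorization_self]
  · rw [Nat.factorization_mul (pow_ne_zero _ hp.ne_zero) hc0, Nat.factorization_ordCompl]
    simp [hp.factorization, Finsupp.erase_ne hq, hq]
  · conv_lhs => rw [← Nat.ordProj_mul_ordCompl_eq_self r p]
    ring

lemma Acts.pow_dvd_rOfA_iff (h : Acts g T) {p i : ℕ} (hp : p.Prime) :
    p ^ i ∣ rOfA (Subgroup.zpowers g) ↔ p ^ i ∣ orderOf g ∧ RCond T p i := by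
  obtain ⟨r, hr⟩ : ∃ r, r = rOfA (Subgroup.zpowers g) := ⟨_, rfl⟩
  obtain ⟨⟨h1, h2⟩, h3⟩ := hr ▸ h.rOfA_isGreatest
  have h0 : r ≠ 0 := hr ▸ h.rOfA_ne_zero
  rw [← hr]
  constructor
  · intro hi
    exact ⟨hi.trans h1, (h2 p hp).mono ((hp.pow_dvd_iff_le_factorization h0).1 hi)⟩
  · rintro ⟨hi, hc⟩
    obtain ⟨r', g1, g2, g3, g4⟩ := exists_replace hp h1 (orderOf_pos g).ne' hi
    have h4 : r' ≤ r := by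
      refine h3 ⟨g1, fun q hq => ?_⟩
      by_cases hqp : q = p
      · rw [hqp, g2]; exact hc
      · rw [g3 q hqp]; exact h2 q hq
    rw [hp.pow_dvd_iff_le_factorization h0, ← Nat.pow_le_pow_iff_right hp.one_lt]
    refine Nat.le_of_mul_le_mul_left ?_ (Nat.pos_of_ne_zero h0)
    rw [g4]
    exact Nat.mul_le_mul_right _ h4

end Acts

lemma mul_pow_of_comm {M : Type*} [Monoid M] {A B : M} {t : ℕ} (h : A * B = B * A ^ t) (z k : ℕ) :
    (B * A ^ z) ^ k = B ^ k * A ^ (z * ∑ i ∈ Finset.range k, t ^ i) := by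
  induction k with
  | zero => simp
  | succ k ih =>
    have h1 := pow_mul_pow_comm h (z * ∑ i ∈ Finset.range k, t ^ i) 1
    rw [pow_one, pow_one] at h1
    rw [pow_succ, ih, ← mul_assoc, mul_assoc (B ^ k), h1, ← mul_assoc, ← pow_succ, mul_assoc,
      ← pow_add, geom_sum_succ]
    congr 2
    ring

section

variable {G : Type*} [Group G] {a b : G} {m n s t : ℕ}

lemma Pres.comm_pow (P : Pres a b m n s t) (X : ℕ) : a * b ^ X = b ^ X * a ^ t ^ X := by
  simpa using pow_mul_pow_comm P.comm 1 X

lemma Pres.mix_pow (P : Pres a b m n s t) (X W k : ℕ) :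
    (b ^ X * a ^ W) ^ k = b ^ (X * k) * a ^ (W * ∑ i ∈ Finset.range k, (t ^ X) ^ i) := by
  rw [mul_pow_of_comm (P.comm_pow X), pow_mul b]

lemma Pres.mix_pow_eq (P : Pres a b m n s t) {X e : ℕ} (hn : X * e = n) (W : ℕ) :
    (b ^ X * a ^ W) ^ e = a ^ (s + W * ∑ i ∈ Finset.range e, (t ^ X) ^ i) := by
  rw [P.mix_pow, hn, P.pow_n, pow_add]

lemma Pres.orderOf_mix [Finite G] (P : Pres a b m n s t) {X e : ℕ} (hn : X * e = n) (W : ℕ) :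
    orderOf (b ^ X * a ^ W) =
      e * (m / Nat.gcd m (s + W * ∑ i ∈ Finset.range e, (t ^ X) ^ i)) := by
  have hX : 0 < X := Nat.pos_of_ne_zero fun h => by have := P.n_pos; simp [← hn, h] at this
  have he : e ≠ 0 := fun h => by have := P.n_pos; simp [← hn, h] at this
  have h1 : e ∣ orderOf (b ^ X * a ^ W) := by
    have h2 := pow_orderOf_eq_one (b ^ X * a ^ W)
    rw [P.mix_pow] at h2
    have h3 : b ^ (X * orderOf (b ^ X * a ^ W)) ∈ Subgroup.zpowers a := by
      rw [eq_inv_of_mul_eq_one_left h2]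
      exact inv_mem (Subgroup.npow_mem_zpowers a _)
    rw [P.mem, ← hn] at h3
    exact Nat.dvd_of_mul_dvd_mul_left hX h3
  have h2 := orderOf_pow_of_dvd he h1
  rw [P.mix_pow_eq hn, orderOf_pow, P.ord] at h2
  rw [h2, Nat.mul_div_cancel' h1]

lemma Pres.conj_mix (P : Pres a b m n s t) (ht : 1 ≤ t) (X W : ℕ) :
    b⁻¹ * (b ^ X * a ^ W) * b = b ^ X * a ^ W * a ^ (W * (t - 1)) := by
  have h1 := pow_mul_pow_comm P.comm W 1
  rw [pow_one, pow_one] at h1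
  have h2 : b⁻¹ * (b ^ X * a ^ W) * b = b⁻¹ * b ^ X * (a ^ W * b) := by group
  rw [h2, h1, mul_assoc, mul_assoc, ← pow_add, ← mul_assoc (b ^ X), ← pow_succ, pow_succ']
  rw [mul_assoc, inv_mul_cancel_left]
  congr 2
  obtain ⟨t, rfl⟩ := Nat.exists_eq_add_of_le ht
  rw [Nat.add_sub_cancel_left]
  ring

lemma Pres.conj_mix' (P : Pres a b m n s t) (ht : 1 ≤ t) (X W : ℕ) :
    a⁻¹ * (b ^ X * a ^ W) * a = b ^ X * a ^ W * (a ^ (t ^ X - 1))⁻¹ := by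
  have h1 := P.comm_pow X
  have h2 : a ^ t ^ X = a ^ (t ^ X - 1) * a := by
    rw [← pow_succ, Nat.sub_add_cancel (Nat.one_le_pow _ _ ht)]
  rw [eq_mul_inv_iff_mul_eq, mul_assoc, mul_assoc, inv_mul_eq_iff_eq_mul, ← mul_assoc a, h1, h2]
  have h4 : a ^ (t ^ X - 1) * a * a ^ W = a ^ W * (a * a ^ (t ^ X - 1)) := by
    simp only [← pow_succ, ← pow_succ', ← pow_add]
    congr 1
    ring
  rw [mul_assoc, mul_assoc, h4]

lemma Pres.normal_of_conj_mem [Finite G] (P : Pres a b m n s t) {g : G}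
    (ha : a⁻¹ * g * a ∈ Subgroup.zpowers g) (hb : b⁻¹ * g * b ∈ Subgroup.zpowers g) :
    (Subgroup.zpowers g).Normal where
  conj_mem := by
    have key : ∀ h : G, h⁻¹ * g * h ∈ Subgroup.zpowers g := by
      refine P.forall_of_gen (by simp) ha hb fun x y hx hy => ?_
      obtain ⟨i, hi⟩ := mem_zpowers_iff_pow.1 hx
      have : (x * y)⁻¹ * g * (x * y) = y⁻¹ * (x⁻¹ * g * x) * y := by group
      rw [this, ← hi, conj_pow']
      exact pow_mem hy i
    intro x hx y
    obtain ⟨i, rfl⟩ := mem_zpowers_iff_pow.1 hx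
    have := conj_pow' y⁻¹ g i
    rw [inv_inv] at this
    rw [this]
    have := key y⁻¹
    rw [inv_inv] at this
    exact pow_mem this i

/-- A presentation coming from a minimal metacyclic factorization. -/
structure MinPres (a b : G) (m n s t : ℕ) : Prop where
  pres : Pres a b m n s t
  arith : Arith m n s t
  le_gcd : ∀ z, s ≤ Nat.gcd m (s + z * ∑ i ∈ Finset.range n, t ^ i)
  le_orderOf : ∀ g, (Subgroup.zpowers g).Normal → a ∈ Subgroup.zpowers g ⊔ Subgroup.zpowers b →
    m ≤ orderOf g ∧
      (orderOf g = m → rOfA (Subgroup.zpowers a) ≤ rOfA (Subgroup.zpowers g))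

lemma Pres.exists_fact (P : Pres a b m n s t) {g c : G} (hN : (Subgroup.zpowers g).Normal)
    (ha : a ∈ Subgroup.zpowers g ⊔ Subgroup.zpowers c)
    (hb : b ∈ Subgroup.zpowers g ⊔ Subgroup.zpowers c) :
    ∃ f : MetacyclicFact G, f.A = Subgroup.zpowers g ∧ f.B = Subgroup.zpowers c := by
  refine ⟨⟨Subgroup.zpowers g, Subgroup.zpowers c, hN, inferInstance, inferInstance, fun x => ?_⟩,
    rfl, rfl⟩
  have hx : x ∈ Subgroup.zpowers g ⊔ Subgroup.zpowers c :=
    P.forall_of_gen (p := fun x => x ∈ Subgroup.zpowers g ⊔ Subgroup.zpowers c)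
      (one_mem _) ha hb (fun _ _ h h' => mul_mem h h') x
  obtain ⟨y, hy, z, hz, h⟩ := Subgroup.mem_sup_of_normal_left.1 hx
  exact ⟨y, hy, z, hz, h.symm⟩

theorem IsMinimalFact.exists_minPres [Finite G] {f : MetacyclicFact G} (hf : IsMinimalFact f) :
    ∃ a b t, Subgroup.zpowers a = f.A ∧ MinPres a b (mOf f) (nOf f) (sOf f) t := by
  obtain ⟨a, b, t, hA, hB, P, R⟩ := f.exists_pres
  refine ⟨a, b, t, hA, ⟨P, R, fun z => ?_, fun g hN hsup => ?_⟩⟩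
  · have hN : (Subgroup.zpowers a).Normal := hA ▸ f.normalA
    have ha : a ∈ Subgroup.zpowers a ⊔ Subgroup.zpowers (b * a ^ z) :=
      Subgroup.mem_sup_left (Subgroup.mem_zpowers a)
    have hb : b ∈ Subgroup.zpowers a ⊔ Subgroup.zpowers (b * a ^ z) := by
      have h1 := mul_mem (Subgroup.mem_sup_right (S := Subgroup.zpowers a)
        (Subgroup.mem_zpowers (b * a ^ z))) (inv_mem (pow_mem ha z))
      rwa [mul_inv_cancel_right] at h1
    obtain ⟨f', h1, h2⟩ := P.exists_fact hN ha hb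
    have h3 := hf f'
    simp only [lex3, factTriple, h1, h2, ← hA] at h3
    have h4 : f.B.index ≤ (Subgroup.zpowers (b * a ^ z)).index := by omega
    have h5 := P.orderOf_mix (X := 1) (e := nOf f) (one_mul _) z
    simp only [pow_one] at h5
    have h6 := Subgroup.card_mul_index (Subgroup.zpowers (b * a ^ z))
    rw [Nat.card_zpowers, h5, P.card] at h6
    refine h4.trans_eq ?_
    obtain ⟨d, hd⟩ := Nat.gcd_dvd_left (mOf f) (sOf f + z * ∑ i ∈ Finset.range (nOf f), t ^ i)
    have hg : 0 < Nat.gcd (mOf f) (sOf f + z * ∑ i ∈ Finset.range (nOf f), t ^ i) :=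
      Nat.gcd_pos_of_pos_left _ P.m_pos
    have hd0 : 0 < d := Nat.pos_of_ne_zero fun h => by
      have := P.m_pos; rw [h, mul_zero] at hd; omega
    have h7 : mOf f / Nat.gcd (mOf f) (sOf f + z * ∑ i ∈ Finset.range (nOf f), t ^ i) = d :=
      Nat.div_eq_of_eq_mul_right hg hd
    rw [h7] at h6
    refine Nat.eq_of_mul_eq_mul_left (Nat.mul_pos P.n_pos hd0) (h6.trans ?_)
    conv_lhs => rw [hd]
    ring
  · have hb : b ∈ Subgroup.zpowers g ⊔ Subgroup.zpowers b :=
      Subgroup.mem_sup_right (Subgroup.mem_zpowers b)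
    obtain ⟨f', h1, h2⟩ := P.exists_fact hN hsup hb
    have h3 := hf f'
    simp only [lex3, factTriple, h1, h2, ← hA, Nat.card_zpowers] at h3
    rw [← P.ord]
    omega

end

section

variable {G : Type*} [Group G] {a b : G} {p m n s t v w x M L n₁ s₁ τ ρ κ : ℕ}

lemma MinPres.pow_dvd_sum (N : MinPres a b m n s t) (S : Split p m n s t v w x M L n₁ s₁ τ) :
    p ^ x ∣ ∑ i ∈ Finset.range n, t ^ i := by
  by_contra hc
  have hp := S.prime
  obtain ⟨d, hd⟩ : ∃ d, d = Nat.gcd m (s + M * L * ∑ i ∈ Finset.range n, t ^ i) := ⟨_, rfl⟩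
  have hle := N.le_gcd (M * L)
  rw [← hd] at hle
  have h1 : d ∣ m := hd ▸ Nat.gcd_dvd_left _ _
  have h2 : d ∣ s + M * L * ∑ i ∈ Finset.range n, t ^ i := hd ▸ Nat.gcd_dvd_right _ _
  have hd0 : d ≠ 0 := fun h => N.arith.m_pos.ne' (by simpa [h] using h1)
  have hs0 : s₁ ≠ 0 := fun h => by
    have h3 := N.arith.s_dvd
    rw [S.hs, h, mul_zero, zero_dvd_iff] at h3
    exact N.arith.m_pos.ne' h3
  have he : d.factorization p < x := by
    by_contra! he
    refine hc ?_
    have h3 : p ^ x ∣ d := (hp.pow_dvd_iff_le_factorization hd0).2 he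
    have h4 : p ^ x ∣ M * L * ∑ i ∈ Finset.range n, t ^ i :=
      (Nat.dvd_add_right (by rw [S.hs]; exact dvd_mul_right _ _)).1 (h3.trans h2)
    exact (Nat.Coprime.pow_left x (S.cM.mul_right S.cL)).dvd_of_dvd_mul_left h4
  have hcop : Nat.Coprime (ordCompl[p] d) p := (Nat.coprime_ordCompl hp hd0).symm
  have h3 : ordCompl[p] d ∣ M * L := by
    refine (Nat.Coprime.pow_right v hcop).dvd_of_dvd_mul_left ?_
    rw [← S.hm]
    exact (Nat.ordCompl_dvd d p).trans h1
  have h4 : ordCompl[p] d ∣ s₁ := by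
    refine (Nat.Coprime.pow_right x hcop).dvd_of_dvd_mul_left ?_
    rw [← S.hs]
    exact (Nat.dvd_add_left (h3.mul_right _)).1 ((Nat.ordCompl_dvd d p).trans h2)
  have h5 := Nat.ordProj_mul_ordCompl_eq_self d p
  have h6 : p ^ d.factorization p * ordCompl[p] d < p ^ x * s₁ :=
    Nat.mul_lt_mul_of_lt_of_le (Nat.pow_lt_pow_right hp.one_lt he)
      (Nat.le_of_dvd (Nat.pos_of_ne_zero hs0) h4) (Nat.pos_of_ne_zero hs0)
  rw [h5, ← S.hs] at h6
  omega

lemma MinPres.pow_dvd_pow_sub_one (N : MinPres a b m n s t)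
    (S : Split p m n s t v w x M L n₁ s₁ τ) {i : ℕ} (hi : p ^ i ∣ t - 1) :
    p ^ (i + x) ∣ τ ^ p ^ w - 1 := by
  have ht := N.arith.two_le
  have h1 : (∑ i ∈ Finset.range n, t ^ i) * (t - 1) = t ^ n - 1 := by
    zify [show 1 ≤ t by omega, Nat.one_le_pow n t (by omega)]
    exact geom_sum_mul _ _
  rw [S.hτ, ← pow_mul, mul_comm n₁, ← S.hn, ← h1, pow_add, mul_comm]
  exact mul_dvd_mul (N.pow_dvd_sum S) hi

lemma E1.mod_four (E : E1 2 v τ ρ)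
    (h : 2 ≤ v → 2 ≤ ρ) (hv : 2 ≤ v) : τ % 4 = 1 :=
  (by simpa using (E.iff 0 2 hv).2 (by have := h hv; omega) : τ ≡ 1 [MOD 4])

lemma MinPres.x_le_w (N : MinPres a b m n s t) (S : Split p m n s t v w x M L n₁ s₁ τ)
    (ht : p ∣ m → t ≡ 1 [MOD p]) (E : E1 p v τ ρ) (h2 : p = 2 → 2 ≤ v → 2 ≤ ρ) : x ≤ w := by
  by_contra! hlt
  have hp := S.prime
  have H := S.loc N.arith
  have hxv := H.x_le
  have ht2 := N.arith.two_le
  have hτ2 := H.two_le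
  have hpm : p ∣ m := by rw [S.hm]; exact (dvd_pow_self p (by omega)).mul_right _
  have hpt : p ∣ t - 1 := (modEq_one_iff_dvd (by omega)).1 (ht hpm)
  have hpτ : p ∣ τ - 1 := H.dvd_sub_one (by omega)
  obtain ⟨i, hi⟩ : ∃ i, i = (t - 1).factorization p := ⟨_, rfl⟩
  have h0 : t - 1 ≠ 0 := by omega
  have h3 := N.pow_dvd_pow_sub_one S (i := i)
    ((hp.pow_dvd_iff_le_factorization h0).2 hi.le)
  have h4 : p ^ (i + x - w) ∣ τ - 1 := by
    rw [show i + x = i + x - w + w by omega] at h3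
    rcases Nat.eq_zero_or_pos w with rfl | hw
    · simpa using h3
    · rcases hp.eq_two_or_odd' with rfl | hodd
      · exact (two_pow_dvd_pow_sub_one_iff (E.mod_four (h2 rfl) (by omega))).1 h3
      · exact (pow_dvd_pow_sub_one_iff hp hodd hτ2 hpτ).1 h3
  rw [S.hτ] at h4
  have h5 := pow_dvd_pred_of_dvd_pow_pred hp ((Nat.Prime.coprime_iff_not_dvd hp).1 S.cn)
    (by omega) hpt h4
  rw [hp.pow_dvd_iff_le_factorization h0, ← hi] at h5
  omega

lemma MinPres.not_E2_full (N : MinPres a b m n s t) (S : Split 2 m n s t v w x M L n₁ s₁ τ)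
    (E : E2 v τ ρ) : ¬ (x = v ∧ v = w + ρ) := by
  rintro ⟨rfl, h⟩
  have H := S.loc N.arith
  have hw := E.one_le_w H
  have hρ := E.two_le
  have h4 := E.mod_four
  have ht2 := N.arith.two_le
  have hm : 2 ∣ m := by rw [S.hm]; exact (dvd_pow_self 2 (by omega)).mul_right _
  have h5 : 2 ∣ t - 1 := by
    have := N.arith.cop.coprime_dvd_right hm
    rw [Nat.coprime_two_right] at this
    have := Nat.odd_iff.1 this
    omega
  have h3 := N.pow_dvd_pow_sub_one S (i := 1) (by simpa using h5)
  obtain ⟨w, rfl⟩ := Nat.exists_eq_add_of_le hw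
  have h6 : (τ ^ 2) % 4 = 1 := by
    rw [Nat.pow_mod, h4]
  rw [show 1 + x = ρ + 2 + w by omega, pow_add 2 1 w, pow_one, pow_mul,
    two_pow_dvd_pow_sub_one_iff h6] at h3
  have h7 : τ ^ 2 - 1 = (τ - 1) * (τ + 1) := by
    have := H.two_le
    zify [show 1 ≤ τ by omega, Nat.one_le_pow 2 τ (by omega)]
    ring
  obtain ⟨k, hk⟩ : ∃ k, τ - 1 = 2 * k := ⟨(τ - 1) / 2, by omega⟩
  have hk2 : Nat.Coprime 2 k := by
    rw [Nat.coprime_two_left, Nat.odd_iff]; omega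
  rw [h7, hk, show ρ + 2 = (ρ + 1) + 1 by ring, pow_succ', mul_assoc] at h3
  have h8 := (Nat.Coprime.pow_left (ρ + 1) hk2).dvd_of_dvd_mul_left
    (Nat.dvd_of_mul_dvd_mul_left two_pos h3)
  exact E.ndvd (by omega) h8

end

section

variable {G : Type*} [Group G] {a b : G} {p m n s t v w x M L n₁ s₁ τ ρ κ : ℕ}

lemma Split.pow_eq (S : Split p m n s t v w x M L n₁ s₁ τ) (k : ℕ) :
    t ^ (p ^ k * n₁) = τ ^ p ^ k := by
  rw [S.hτ, ← pow_mul, mul_comm]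

lemma Split.pow_modEq_one_of_le (S : Split p m n s t v w x M L n₁ s₁ τ)
    (hκ : IsPer τ M (p ^ κ)) {k : ℕ} (hk : κ ≤ k) : τ ^ p ^ k ≡ 1 [MOD M * L] := by
  rw [← Nat.modEq_and_modEq_iff_modEq_mul S.cML]
  exact ⟨(hκ _).2 (pow_dvd_pow p hk), by simpa using S.triv.pow (p ^ k)⟩

lemma geom_sum_modEq {U d e : ℕ} (h : U ≡ 1 [MOD d]) : ∑ i ∈ Finset.range e, U ^ i ≡ e [MOD d] := by
  have h1 := Nat.ModEq.sum (s := Finset.range e) (f := fun i => U ^ i) (g := fun _ => 1) (n := d)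
    fun i _ => by simpa using h.pow i
  simpa using h1

lemma Split.pow_dvd_t_sub_one (S : Split p m n s t v w x M L n₁ s₁ τ) (ht1 : 1 ≤ t)
    (ht : t ≡ 1 [MOD p]) {i : ℕ} : t ≡ 1 [MOD p ^ i] ↔ τ ≡ 1 [MOD p ^ i] := by
  constructor
  · intro h
    simpa [S.hτ] using h.pow n₁
  · intro h
    rw [S.hτ, modEq_one_iff_dvd (Nat.one_le_pow _ _ ht1)] at h
    rw [modEq_one_iff_dvd ht1] at ht ⊢
    exact pow_dvd_pred_of_dvd_pow_pred S.prime ((Nat.Prime.coprime_iff_not_dvd S.prime).1 S.cn)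
      ht1 ht h

lemma MinPres.rho_le_x [Finite G] (N : MinPres a b m n s t)
    (S : Split p m n s t v w x M L n₁ s₁ τ) (ht : p ∣ m → t ≡ 1 [MOD p]) (E : E1 p v τ ρ)
    (hκ : IsPer τ M (p ^ κ)) : ρ ≤ x ∨ w < x + κ := by
  by_contra! hlt
  obtain ⟨hx, hw⟩ := hlt
  have hp := S.prime
  have P := N.pres
  have ht2 := N.arith.two_le
  have hρv := E.le
  have hpm : ∀ {i}, i ≤ v → p ^ i ∣ m := fun hi => by
    rw [S.hm]; exact (pow_dvd_pow p hi).mul_right _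
  have htp : t ≡ 1 [MOD p] := ht (by simpa using hpm (i := 1) (by omega))
  have hτρ : τ ≡ 1 [MOD p ^ ρ] := by simpa using (E.iff 0 ρ hρv).2 le_rfl
  have htρ : p ^ ρ ∣ t - 1 :=
    (modEq_one_iff_dvd (by omega)).1 ((S.pow_dvd_t_sub_one (by omega) htp).2 hτρ)
  obtain ⟨X, hX⟩ : ∃ X, X = p ^ (w - x) * n₁ := ⟨_, rfl⟩
  have hXn : X * p ^ x = n := by
    rw [hX, S.hn, mul_right_comm, ← pow_add, Nat.sub_add_cancel (by omega)]
  have hU1 : t ^ X ≡ 1 [MOD M * L] := by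
    rw [hX, S.pow_eq]; exact S.pow_modEq_one_of_le hκ (by omega)
  have hU2 : t ^ X ≡ 1 [MOD p ^ ρ] := by
    rw [hX, S.pow_eq]; simpa using hτρ.pow (p ^ (w - x))
  obtain ⟨Q, hQ⟩ : ∃ y, y = ∑ i ∈ Finset.range (p ^ x), (t ^ X) ^ i := ⟨_, rfl⟩
  have hQ1 : Q ≡ p ^ x [MOD M * L] := hQ ▸ geom_sum_modEq hU1
  have hQ2 : Q ≡ p ^ x [MOD p ^ ρ] := hQ ▸ geom_sum_modEq hU2
  have hgcd : Nat.gcd Q m ∣ p ^ x := by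
    have h1 : Nat.Coprime Q (M * L) := by
      rw [Nat.Coprime, hQ1.gcd_eq]
      exact Nat.Coprime.pow_left _ (S.cM.mul_right S.cL)
    rw [S.hm, Nat.Coprime.gcd_mul_right_cancel_right _ h1.symm]
    obtain ⟨j, hj, hj'⟩ := (Nat.dvd_prime_pow hp).1 (Nat.gcd_dvd_right Q (p ^ v))
    rw [hj']
    refine pow_dvd_pow p ?_
    by_contra! hlt
    have h2 : p ^ (x + 1) ∣ Q :=
      (pow_dvd_pow p hlt).trans (hj' ▸ Nat.gcd_dvd_left Q (p ^ v))
    have h3 := ((hQ2.of_dvd (pow_dvd_pow p hx)).dvd_iff dvd_rfl).1 h2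
    have := (Nat.pow_dvd_pow_iff_le_right hp.one_lt).1 h3
    omega
  have hsx : p ^ x ∣ s := by rw [S.hs]; exact dvd_mul_right _ _
  obtain ⟨W, hW⟩ := exists_mul_modEq_of_gcd_dvd (i := p ^ ρ + s * (m - 1)) P.m_pos
    (hgcd.trans (dvd_add (pow_dvd_pow p hx.le) (hsx.mul_right _)))
  have hsum : s + W * Q ≡ p ^ ρ [MOD m] := by
    have h1 := Nat.ModEq.add_left s hW
    rw [mul_comm Q] at h1
    refine h1.trans ?_
    have h2 : s + (p ^ ρ + s * (m - 1)) = p ^ ρ + m * s := by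
      have := P.m_pos
      obtain ⟨m', rfl⟩ : ∃ m', m = m' + 1 := ⟨m - 1, by omega⟩
      rw [Nat.add_sub_cancel]; ring
    rw [h2]
    exact Nat.ModEq.symm (by simp [Nat.ModEq])
  have hWp : Nat.Coprime W (p ^ ρ) := by
    refine Nat.Coprime.pow_right _ ((Nat.Prime.coprime_iff_not_dvd hp).2 fun hd => ?_).symm
    have h1 : p ^ x ∣ Q := ((hQ2.of_dvd (pow_dvd_pow p hx.le)).dvd_iff dvd_rfl).2 dvd_rfl
    have h2 : p ^ (x + 1) ∣ W * Q := by rw [pow_succ']; exact mul_dvd_mul hd h1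
    have h3 : p ^ (x + 1) ∣ s + W * Q :=
      ((hsum.of_dvd (hpm (i := x + 1) (by omega))).dvd_iff dvd_rfl).2 (pow_dvd_pow p hx)
    have h4 := (Nat.dvd_add_left h2).1 h3
    rw [S.hs, pow_succ] at h4
    exact (Nat.Prime.coprime_iff_not_dvd hp).1 S.cs
      (Nat.dvd_of_mul_dvd_mul_left (pow_pos hp.pos x) h4)
  obtain ⟨g, hg⟩ : ∃ g, g = b ^ X * a ^ W := ⟨_, rfl⟩
  have hag : a ^ p ^ ρ ∈ Subgroup.zpowers g := by
    have h1 := P.mix_pow_eq hXn W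
    have h2 : a ^ (s + W * Q) = a ^ p ^ ρ := pow_eq_pow_iff_modEq.2 (by rw [P.ord]; exact hsum)
    rw [← hQ, ← hg, h2] at h1
    rw [← h1]
    exact Subgroup.npow_mem_zpowers g _
  have hag' : ∀ {y}, p ^ ρ ∣ y → a ^ y ∈ Subgroup.zpowers g := by
    rintro _ ⟨y, rfl⟩
    rw [pow_mul]
    exact pow_mem hag y
  have hgg := Subgroup.mem_zpowers g
  have hN : (Subgroup.zpowers g).Normal := by
    refine P.normal_of_conj_mem ?_ ?_
    · have hc := P.conj_mix' (by omega) X W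
      rw [← hg] at hc
      rw [hc]
      exact mul_mem hgg (inv_mem (hag'
        ((modEq_one_iff_dvd (Nat.one_le_pow _ _ (by omega))).1 hU2)))
    · have hc := P.conj_mix (by omega) X W
      rw [← hg] at hc
      rw [hc]
      exact mul_mem hgg (hag' (htρ.mul_left W))
  have hsup : a ∈ Subgroup.zpowers g ⊔ Subgroup.zpowers b := by
    have h1 : a ^ p ^ ρ ∈ Subgroup.zpowers g ⊔ Subgroup.zpowers b := Subgroup.mem_sup_left hag
    have h2 : a ^ W ∈ Subgroup.zpowers g ⊔ Subgroup.zpowers b := by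
      have h3 := mul_mem (Subgroup.mem_sup_right (S := Subgroup.zpowers g)
        (inv_mem (Subgroup.npow_mem_zpowers b X)))
        (Subgroup.mem_sup_left (T := Subgroup.zpowers b) hgg)
      rwa [hg, inv_mul_cancel_left, ← hg] at h3
    have h3 := Nat.gcd_eq_gcd_ab W (p ^ ρ)
    rw [hWp] at h3
    rw [← zpow_one a, ← Nat.cast_one, h3, zpow_add, zpow_mul, zpow_mul, zpow_natCast,
      zpow_natCast]
    exact mul_mem (zpow_mem h2 _) (zpow_mem h1 _)
  have hord := P.orderOf_mix hXn W
  rw [← hQ, ← hg, Nat.gcd_comm, hsum.gcd_eq, Nat.gcd_eq_left (hpm hρv)] at hord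
  have hle := (N.le_orderOf g hN hsup).1
  rw [hord] at hle
  obtain ⟨c, hc⟩ := hpm hρv
  have hc0 : 0 < c := Nat.pos_of_ne_zero fun h => by
    have := P.m_pos; rw [h, mul_zero] at hc; omega
  rw [hc, Nat.mul_div_cancel_left _ (pow_pos hp.pos ρ)] at hle
  have := Nat.mul_lt_mul_of_pos_right (Nat.pow_lt_pow_right hp.one_lt hx) hc0
  omega

lemma two_pow_dvd_pow_add_one_iff {i N : ℕ} (hN : Odd N) (ht : Odd t) :
    2 ^ i ∣ t ^ N + 1 ↔ 2 ^ i ∣ t + 1 := by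
  constructor
  · intro h
    rcases Nat.eq_zero_or_pos i with rfl | hi
    · simp
    obtain ⟨c, hc⟩ : ∃ c, 2 ^ i = 2 * c := ⟨2 ^ (i - 1), by rw [← pow_succ']; congr 1; omega⟩
    have hc0 : 0 < c := by have := Nat.two_pow_pos i; omega
    have ht1 : 1 ≤ t := ht.pos
    have h1 : 1 ≤ (2 ^ i - 1) * t := Nat.mul_pos (by omega) ht1
    have h2 : (((2 ^ i - 1) * t : ℕ) : ZMod (2 ^ i)) = -t := by
      have : ((2 ^ i : ℕ) : ZMod (2 ^ i)) = 0 := ZMod.natCast_self _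
      rw [Nat.cast_mul, Nat.cast_sub (by omega), this]
      simp
    have h3 : 2 ^ i ∣ ((2 ^ i - 1) * t) ^ N - 1 := by
      rw [← modEq_one_iff_dvd (Nat.one_le_pow _ _ h1), ← ZMod.natCast_eq_natCast_iff,
        Nat.cast_pow, h2, hN.neg_pow, neg_eq_iff_add_eq_zero, Nat.cast_one]
      have := (ZMod.natCast_eq_zero_iff _ _).2 h
      simpa using this
    have h4 : 2 ∣ (2 ^ i - 1) * t - 1 := by
      have : Odd ((2 ^ i - 1) * t) := Odd.mul (by rw [Nat.odd_iff]; omega) ht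
      rw [Nat.odd_iff] at this
      omega
    have h5 := pow_dvd_pred_of_dvd_pow_pred Nat.prime_two hN.not_two_dvd_nat h1 h4 h3
    rw [← modEq_one_iff_dvd h1, ← ZMod.natCast_eq_natCast_iff, h2, neg_eq_iff_add_eq_zero] at h5
    rw [← ZMod.natCast_eq_zero_iff]
    simpa using h5
  · intro h
    have := hN.nat_add_dvd_pow_add_pow t 1
    rw [one_pow] at this
    exact h.trans this

lemma Arith.odd_of_two_dvd (A : Arith m n s t) (h : 2 ∣ m) : Odd t :=
  Nat.coprime_two_right.1 (A.cop.coprime_dvd_right h)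

lemma Split.two_pow_dvd_add_one_iff (S : Split 2 m n s t v w x M L n₁ s₁ τ) (ht : Odd t) {i : ℕ} :
    2 ^ i ∣ t + 1 ↔ 2 ^ i ∣ τ + 1 := by
  rw [S.hτ, two_pow_dvd_pow_add_one_iff (Nat.coprime_two_left.1 S.cn) ht]

lemma MinPres.rho_ne_v [Finite G] (N : MinPres a b m n s t)
    (S : Split 2 m n s t v w x M L n₁ s₁ τ) (E : E2 v τ ρ)
    (hκ : IsPer τ M (2 ^ κ)) (hx : x + 1 = v) (hw : max κ 1 + 1 ≤ w) (hv : 3 ≤ v) : ρ ≠ v := by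
  rintro rfl
  have P := N.pres
  have ht2 := N.arith.two_le
  have hm0 := P.m_pos
  have hvm : 2 ^ ρ ∣ m := by rw [S.hm]; exact dvd_mul_right _ _
  have h8 : 2 ^ 3 ∣ 2 ^ ρ := pow_dvd_pow 2 hv
  have h2m : 2 ∣ m := ((by norm_num : 2 ∣ 2 ^ 3).trans h8).trans hvm
  have htodd := N.arith.odd_of_two_dvd h2m
  have ht1 : 2 ^ ρ ∣ t + 1 := (S.two_pow_dvd_add_one_iff htodd).2 E.dvd
  obtain ⟨X, hX⟩ : ∃ X, X = 2 ^ (w - 1) * n₁ := ⟨_, rfl⟩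
  have hXn : X * 2 = n := by
    rw [hX, S.hn, mul_right_comm, ← pow_succ, Nat.sub_add_cancel (by omega)]
  have hU : t ^ X ≡ 1 [MOD m] := by
    rw [hX, S.pow_eq, S.hm,
      ← Nat.modEq_and_modEq_iff_modEq_mul (Nat.Coprime.pow_left _ (S.cM.mul_right S.cL))]
    refine ⟨?_, S.pow_modEq_one_of_le hκ (by omega)⟩
    have h1 : Even (2 ^ (w - 1)) := (Nat.even_pow.2 ⟨even_two, by omega⟩)
    rw [← ZMod.natCast_eq_natCast_iff, Nat.cast_pow]
    have h2 : (τ : ZMod (2 ^ ρ)) = -1 := by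
      rw [eq_neg_iff_add_eq_zero]
      have := (ZMod.natCast_eq_zero_iff _ _).2 E.dvd
      simpa using this
    rw [h2, h1.neg_one_pow, Nat.cast_one]
  obtain ⟨s', hs'⟩ : ∃ s', s' = 2 ^ (x - 1) * s₁ := ⟨_, rfl⟩
  have hss : s = 2 * s' := by
    rw [hs', S.hs, ← mul_assoc, ← pow_succ', Nat.sub_add_cancel (by omega)]
  obtain ⟨W, hW⟩ : ∃ W, W = 1 + s' * (m - 1) := ⟨_, rfl⟩
  obtain ⟨T, hT⟩ : ∃ T, T = 1 + W * (t - 1) := ⟨_, rfl⟩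
  obtain ⟨Z, hZ⟩ : ∃ Z, Z = s' * (m - 1) * (t - 1) := ⟨_, rfl⟩
  have hTZ : T = t + Z := by
    rw [hT, hW, hZ, add_mul]
    omega
  have hsum : s + W * (∑ i ∈ Finset.range 2, (t ^ X) ^ i) ≡ 2 [MOD m] := by
    have h1 : ∑ i ∈ Finset.range 2, (t ^ X) ^ i ≡ 2 [MOD m] := geom_sum_modEq hU
    refine (Nat.ModEq.add_left s (h1.mul_left W)).trans ?_
    have h2 : s + W * 2 = 2 + m * s := by
      rw [hW, hss]
      obtain ⟨m', rfl⟩ : ∃ m', m = m' + 1 := ⟨m - 1, by omega⟩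
      rw [Nat.add_sub_cancel]; ring
    rw [h2]
    simp [Nat.ModEq]
  obtain ⟨g, hg⟩ : ∃ g, g = b ^ X * a ^ W := ⟨_, rfl⟩
  have hg2 : g ^ 2 = a ^ 2 := by
    have h1 := P.mix_pow_eq hXn W
    rw [hg, h1]
    exact pow_eq_pow_iff_modEq.2 (by rw [P.ord]; exact hsum)
  have hord : orderOf g = m := by
    rw [hg, P.orderOf_mix hXn W, Nat.gcd_comm, hsum.gcd_eq, Nat.gcd_eq_left h2m,
      Nat.mul_div_cancel' h2m]
  have hca : a⁻¹ * g * a = g := by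
    have h1 := P.conj_mix' (by omega) X W
    have h2 : a ^ (t ^ X - 1) = 1 := orderOf_dvd_iff_pow_eq_one.1 (by
      rw [P.ord]; exact (modEq_one_iff_dvd (Nat.one_le_pow _ _ (by omega))).1 hU)
    rw [h2, inv_one, mul_one, ← hg] at h1
    exact h1
  have hcb : b⁻¹ * g * b = g ^ T := by
    have h1 := P.conj_mix (by omega) X W
    rw [← hg] at h1
    obtain ⟨k, hk⟩ : 2 ∣ W * (t - 1) := by
      refine Dvd.dvd.mul_left ?_ W
      rw [Nat.odd_iff] at htodd
      omega
    rw [h1, hT, hk, pow_add, pow_one, pow_mul g, hg2, ← pow_mul]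
  have hA : Acts a t := P.acts (by group) (by
    have h1 := P.comm
    rw [mul_assoc, h1, inv_mul_cancel_left])
  have hAg : Acts g T := P.acts hca hcb
  have hsup : a ∈ Subgroup.zpowers g ⊔ Subgroup.zpowers b := by
    obtain ⟨c, hc⟩ : ∃ c, W = 2 * c + 1 := by
      have h3 : 2 ∣ s' := by
        rw [hs']; exact (dvd_pow_self 2 (by omega)).mul_right _
      obtain ⟨c, hc⟩ := h3
      exact ⟨c * (m - 1), by rw [hW, hc]; ring⟩
    have h1 : a ^ 2 ∈ Subgroup.zpowers g ⊔ Subgroup.zpowers b :=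
      Subgroup.mem_sup_left (hg2 ▸ Subgroup.npow_mem_zpowers g 2)
    have h3 := mul_mem (Subgroup.mem_sup_right (S := Subgroup.zpowers g)
      (inv_mem (Subgroup.npow_mem_zpowers b X)))
      (Subgroup.mem_sup_left (T := Subgroup.zpowers b) (Subgroup.mem_zpowers g))
    have h4 : (b ^ X)⁻¹ * g = (a ^ 2) ^ c * a := by
      rw [hg, inv_mul_cancel_left, hc, pow_succ, pow_mul]
    rw [h4] at h3
    exact (Subgroup.mul_mem_cancel_left _ (pow_mem h1 c)).1 h3
  have hle := (N.le_orderOf g hAg.normal hsup).2 hord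
  have hZodd : ¬ 2 ^ ρ ∣ Z := by
    intro hd
    obtain ⟨c, hc⟩ : ∃ c, t - 1 = 2 * c := ⟨(t - 1) / 2, by rw [Nat.odd_iff] at htodd; omega⟩
    have hcodd : Nat.Coprime 2 c := by
      rw [Nat.coprime_two_left, Nat.odd_iff]
      have : 2 ^ 2 ∣ t + 1 := (pow_dvd_pow 2 (by omega)).trans ht1
      omega
    have hm1 : Nat.Coprime 2 (m - 1) := by
      rw [Nat.coprime_two_left, Nat.odd_iff]
      omega
    have h1 : Z = 2 ^ x * (s₁ * ((m - 1) * c)) := by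
      rw [hZ, hs', hc, show 2 ^ x = 2 ^ (x - 1) * 2 by
        rw [← pow_succ, Nat.sub_add_cancel (by omega)]]
      ring
    rw [h1, ← hx, pow_succ] at hd
    have h2 := Nat.dvd_of_mul_dvd_mul_left (Nat.two_pow_pos x) hd
    have h3 := hm1.dvd_of_dvd_mul_left (S.cs.dvd_of_dvd_mul_left h2)
    exact (Nat.Prime.coprime_iff_not_dvd Nat.prime_two).1 hcodd h3
  have h4Z : 4 ∣ Z := by
    obtain ⟨c, hc⟩ : ∃ c, t - 1 = 2 * c := ⟨(t - 1) / 2, by rw [Nat.odd_iff] at htodd; omega⟩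
    have h3 : 2 ∣ s' := by
      rw [hs']; exact (dvd_pow_self 2 (by omega)).mul_right _
    obtain ⟨e, he⟩ := h3
    exact ⟨e * (m - 1) * c, by rw [hZ, he, hc]; ring⟩
  have hnot : ¬ RCond T 2 ρ := by
    have h4 : 2 ^ 2 ∣ t + 1 := (pow_dvd_pow 2 (by omega)).trans ht1
    rintro (h | ⟨-, h⟩)
    · have h5 : T ≡ 1 [MOD 2 ^ 2] := h.of_dvd (pow_dvd_pow 2 (by omega))
      rw [hTZ] at h5
      change (t + Z) % 4 = 1 at h5
      omega
    · rw [hTZ, add_right_comm] at h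
      exact hZodd ((Nat.dvd_add_right ht1).1 h)
  obtain ⟨⟨h1, h2⟩, -⟩ := hAg.rOfA_isGreatest
  have hr0 := hAg.rOfA_ne_zero
  rw [hord] at h1
  obtain ⟨r', g1, g2, g3, g4⟩ := exists_replace Nat.prime_two h1 hm0.ne' hvm
  have hle' : r' ≤ rOfA (Subgroup.zpowers a) := by
    refine hA.rOfA_isGreatest.2 ⟨by rw [P.ord]; exact g1, fun q hq => ?_⟩
    by_cases hq2 : q = 2
    · rw [hq2, g2]
      exact Or.inr ⟨rfl, ht1⟩
    · rw [g3 q hq2]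
      rcases h2 q hq with h | h
      · left
        have h5 : q ^ (rOfA (Subgroup.zpowers g)).factorization q ∣ m :=
          (Nat.ordProj_dvd _ q).trans h1
        have h6 : q ^ (rOfA (Subgroup.zpowers g)).factorization q ∣ Z := by
          refine (Nat.Coprime.pow_left _ ((Nat.coprime_primes hq Nat.prime_two).2 hq2)
            ).dvd_of_dvd_mul_left ?_
          have h7 : m ∣ s * (t - 1) := by
            have h8 := (Nat.modEq_iff_dvd' (Nat.le_mul_of_pos_right s (by omega))).1
              N.arith.fix.symm
            rwa [Nat.mul_sub, mul_one]
          refine (h5.trans h7).trans ⟨m - 1, ?_⟩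
          rw [hZ, hss]; ring
        have h9 : T ≡ t [MOD q ^ (rOfA (Subgroup.zpowers g)).factorization q] := by
          have := Nat.ModEq.add_left t ((Nat.modEq_zero_iff_dvd).2 h6)
          rwa [add_zero, ← hTZ] at this
        exact h9.symm.trans h
      · exact absurd h.1 hq2
  have hlt : (rOfA (Subgroup.zpowers g)).factorization 2 < ρ := by
    by_contra! hc
    exact hnot ((h2 2 Nat.prime_two).mono hc)
  have h3 := hle'.trans hle
  have h5 := Nat.mul_lt_mul_of_le_of_lt h3 (Nat.pow_lt_pow_right one_lt_two hlt)
    (Nat.pos_of_ne_zero hr0)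
  omega

end

lemma factorization_prod_primes_pow {S : Finset ℕ} (hS : ∀ p ∈ S, p.Prime) (E : ℕ → ℕ) (q : ℕ) :
    (∏ p ∈ S, p ^ E p).factorization q = if q ∈ S then E q else 0 := by
  rw [Nat.factorization_prod_apply fun p hp => pow_ne_zero _ (hS p hp).ne_zero]
  have h1 : ∀ p ∈ S, (p ^ E p).factorization q = if p = q then E p else 0 := fun p hp => by
    rw [(hS p hp).factorization_pow, Finsupp.single_apply]
  rw [Finset.sum_congr rfl h1, Finset.sum_ite_eq' S q E]

lemma natPart_eq (m : ℕ) (σ : Set ℕ) :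
    natPart m σ = ∏ p ∈ m.primeFactors, p ^ (if p ∈ σ then m.factorization p else 0) := by
  refine Finset.prod_congr rfl fun p _ => ?_
  split_ifs <;> simp

lemma factorization_natPart {m : ℕ} {σ : Set ℕ} (q : ℕ) :
    (natPart m σ).factorization q = if q ∈ σ then m.factorization q else 0 := by
  rw [natPart_eq, factorization_prod_primes_pow fun p hp => Nat.prime_of_mem_primeFactors hp]
  by_cases h : q ∈ m.primeFactors
  · rw [if_pos h]
  · rw [if_neg h]
    rw [← Nat.support_factorization, Finsupp.notMem_support_iff] at h
    simp [h]

lemma natPart_ne_zero (m : ℕ) (σ : Set ℕ) : natPart m σ ≠ 0 := by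
  rw [natPart_eq]
  exact Finset.prod_ne_zero_iff.2 fun p hp =>
    pow_ne_zero _ (Nat.prime_of_mem_primeFactors hp).ne_zero

lemma dvd_of_factorization_le {d m : ℕ} (hd : d ≠ 0) (hm : m ≠ 0)
    (h : ∀ q, q.Prime → d.factorization q ≤ m.factorization q) : d ∣ m :=
  (Nat.factorization_prime_le_iff_dvd hd hm).1 h

lemma natPart_dvd {m : ℕ} (hm : m ≠ 0) (σ : Set ℕ) : natPart m σ ∣ m :=
  dvd_of_factorization_le (natPart_ne_zero m σ) hm fun q _ => by
    rw [factorization_natPart]; split_ifs <;> omega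

lemma factorization_eq_of_pow_dvd_iff {r p e : ℕ} (hp : p.Prime) (hr : r ≠ 0)
    (h : ∀ i, p ^ i ∣ r ↔ i ≤ e) : r.factorization p = e := by
  have h1 : ∀ i, i ≤ r.factorization p ↔ i ≤ e := fun i => by
    rw [← hp.pow_dvd_iff_le_factorization hr, h]
  exact le_antisymm ((h1 _).1 le_rfl) ((h1 _).2 le_rfl)

section

variable {G : Type*} [Group G] {a b g : G} {p m n s t T v w x M L n₁ s₁ τ ρ κ q k : ℕ}

lemma Acts.isPer_ncard [Finite G] (h : Acts g T) (hq : q ∣ orderOf g) :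
    IsPer T q (resSet (Nat.card (Subgroup.zpowers g)) q (TG (Subgroup.zpowers g))).ncard := by
  have hq0 : q ≠ 0 := fun h0 => (orderOf_pos g).ne' (by simpa [h0] using hq)
  have : NeZero q := ⟨hq0⟩
  have hcard : Nat.card (Subgroup.zpowers g) = orderOf g := Nat.card_zpowers g
  have hd : Nat.card (Subgroup.zpowers g) ∣ orderOf g := by rw [hcard]
  have hc := h.cop.coprime_dvd_right hq
  have key : resSet (Nat.card (Subgroup.zpowers g)) q (TG (Subgroup.zpowers g)) =
      (Subgroup.zpowers (ZMod.unitOfCoprime T hc) : Set (ZMod q)ˣ) := by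
    ext u
    rw [SetLike.mem_coe, mem_zpowers_iff_pow]
    constructor
    · rintro ⟨y, hy, x, hx, hxu⟩
      obtain ⟨i, hi⟩ := (h.mem_TGmod hd).1 hy
      refine ⟨i, ?_⟩
      rw [← hx, ← Nat.cast_pow, ZMod.natCast_eq_natCast_iff, hcard] at hi
      have h1 := (ZMod.natCast_eq_natCast_iff _ _ _).2 (hi.of_dvd hq)
      ext
      rw [← hxu, h1]
      simp
    · rintro ⟨i, rfl⟩
      obtain ⟨y, hy, hy'⟩ := h.exists_unit hd i
      exact ⟨y, hy, T ^ i, by rw [hy']; simp, by simp⟩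
  intro i
  rw [key, ← Nat.card_coe_set_eq, SetLike.coe_sort_coe, Nat.card_zpowers, orderOf_dvd_iff_pow_eq_one,
    ← ZMod.natCast_eq_natCast_iff, Units.ext_iff]
  simp

lemma Pres.acts_self [Finite G] (P : Pres a b m n s t) : Acts a t :=
  P.acts (by group) (by rw [mul_assoc, P.comm, inv_mul_cancel_left])

lemma Acts.prime_dvd_rOfA_iff [Finite G] (h : Acts g T) (hp : p.Prime) (hpg : p ∣ orderOf g) :
    p ∣ rOfA (Subgroup.zpowers g) ↔ T ≡ 1 [MOD p] := by
  have h1 := h.pow_dvd_rOfA_iff (i := 1) hp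
  rw [pow_one] at h1
  rw [h1, RCond, pow_one]
  refine ⟨?_, fun h => ⟨hpg, Or.inl h⟩⟩
  rintro ⟨-, h2 | ⟨rfl, h2⟩⟩
  · exact h2
  · change T % 2 = 1
    rw [pow_one] at h2
    omega

lemma Split.pow_dvd_m_iff (S : Split p m n s t v w x M L n₁ s₁ τ) (hm : 0 < m) {i : ℕ} :
    p ^ i ∣ m ↔ i ≤ v := by
  rw [S.prime.pow_dvd_iff_le_factorization hm.ne', S.factorization_m hm]

lemma MinPres.factorization_r_one [Finite G] (N : MinPres a b m n s t)
    (S : Split p m n s t v w x M L n₁ s₁ τ) (ht : p ∣ m → t ≡ 1 [MOD p]) (E : E1 p v τ ρ)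
    (h2 : p = 2 → 2 ≤ v → 2 ≤ ρ) : (rOfA (Subgroup.zpowers a)).factorization p = ρ := by
  have hA := N.pres.acts_self
  have ht2 := N.arith.two_le
  refine factorization_eq_of_pow_dvd_iff S.prime hA.rOfA_ne_zero fun i => ?_
  rw [hA.pow_dvd_rOfA_iff S.prime, N.pres.ord, S.pow_dvd_m_iff N.pres.m_pos]
  have hE : ∀ {i}, i ≤ v → (t ≡ 1 [MOD p ^ i] ↔ i ≤ ρ) := fun {i} hi => by
    rcases Nat.eq_zero_or_pos v with h0 | hv
    · rw [show i = 0 by omega]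
      simp [Nat.modEq_one]
    · have hpm := (S.pow_dvd_m_iff N.pres.m_pos (i := 1)).2 hv
      rw [pow_one] at hpm
      have := E.iff 0 i hi
      rw [S.pow_dvd_t_sub_one (by omega) (ht hpm)]
      simpa using this
  have hle := E.le
  constructor
  · rintro ⟨hi, h | ⟨rfl, h⟩⟩
    · exact (hE hi).1 h
    · by_contra! hc
      have hpos := E.pos (by omega)
      have h3 := h2 rfl (by omega)
      have h4 : t % 2 ^ 2 = 1 := (hE (by omega)).2 h3
      have h5 : 2 ^ 2 ∣ t + 1 := (pow_dvd_pow 2 (by omega)).trans h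
      omega
  · intro hi
    exact ⟨hi.trans hle, Or.inl ((hE (hi.trans hle)).2 hi)⟩

lemma MinPres.t_odd (N : MinPres a b m n s t) (S : Split 2 m n s t v w x M L n₁ s₁ τ)
    (hv : v ≠ 0) : Odd t :=
  N.arith.odd_of_two_dvd (by
    simpa using (S.pow_dvd_m_iff N.arith.m_pos (i := 1)).2 (by omega))

lemma MinPres.factorization_r_two [Finite G] (N : MinPres a b m n s t)
    (S : Split 2 m n s t v w x M L n₁ s₁ τ) (E : E2 v τ ρ) :
    (rOfA (Subgroup.zpowers a)).factorization 2 = ρ := by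
  have hA := N.pres.acts_self
  have h2 := E.two_le
  have hle := E.le
  have hodd := N.t_odd S (by omega)
  refine factorization_eq_of_pow_dvd_iff S.prime hA.rOfA_ne_zero fun i => ?_
  rw [hA.pow_dvd_rOfA_iff S.prime, N.pres.ord, S.pow_dvd_m_iff N.pres.m_pos]
  constructor
  · rintro ⟨hi, h | ⟨-, h⟩⟩
    · by_contra! hc
      have h3 : t % 2 ^ 2 = 1 := h.of_dvd (pow_dvd_pow 2 (by omega))
      have h4 : 2 ^ 2 ∣ t + 1 := (S.two_pow_dvd_add_one_iff hodd).2 ((E.dvd_iff (by omega)).2 h2)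
      omega
    · exact (E.dvd_iff hi).1 ((S.two_pow_dvd_add_one_iff hodd).1 h)
  · intro hi
    exact ⟨hi.trans hle, Or.inr ⟨rfl, (S.two_pow_dvd_add_one_iff hodd).2
      ((E.dvd_iff (hi.trans hle)).2 hi)⟩⟩

lemma Acts.epsOfA_eq [Finite G] (h : Acts g T) :
    epsOfA (Subgroup.zpowers g) =
      if T ≡ 1 [MOD ordProj[2] (rOfA (Subgroup.zpowers g))] then 1 else -1 := by
  rw [epsOfA]
  have := h.resTriv_iff ((Nat.ordProj_dvd _ 2).trans h.rOfA_dvd)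
  by_cases h1 : T ≡ 1 [MOD ordProj[2] (rOfA (Subgroup.zpowers g))]
  · rw [if_pos h1, if_pos (this.2 h1)]
  · rw [if_neg h1, if_neg (fun h2 => h1 (this.1 h2))]

lemma MinPres.eps_one [Finite G] (N : MinPres a b m n s t)
    (S : Split p m n s t v w x M L n₁ s₁ τ) (ht : p ∣ m → t ≡ 1 [MOD p]) (E : E1 p v τ ρ)
    (h2 : p = 2 → 2 ≤ v → 2 ≤ ρ) : epsOfA (Subgroup.zpowers a) ^ (p - 1) = 1 := by
  have hA := N.pres.acts_self
  rcases S.prime.eq_two_or_odd' with rfl | hodd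
  · rw [show 2 - 1 = 1 by rfl, pow_one, hA.epsOfA_eq, if_pos]
    rw [N.factorization_r_one S ht E h2]
    have h3 := (hA.pow_dvd_rOfA_iff S.prime (i := ρ)).1 (by
      rw [S.prime.pow_dvd_iff_le_factorization hA.rOfA_ne_zero, N.factorization_r_one S ht E h2])
    rcases Nat.eq_zero_or_pos v with h0 | hv
    · have := E.le
      rw [show ρ = 0 by omega]
      simp [Nat.modEq_one]
    · have hpm : 2 ∣ m := by simpa using (S.pow_dvd_m_iff N.pres.m_pos (i := 1)).2 hv
      rw [S.pow_dvd_t_sub_one (by have := N.arith.two_le; omega) (ht hpm)]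
      simpa using (E.iff 0 ρ E.le).2 le_rfl
  · have h1 : Even (p - 1) := by
      obtain ⟨c, rfl⟩ := hodd
      simp
    rw [hA.epsOfA_eq]
    split_ifs
    · simp
    · exact h1.neg_one_pow

lemma MinPres.eps_two [Finite G] (N : MinPres a b m n s t)
    (S : Split 2 m n s t v w x M L n₁ s₁ τ) (E : E2 v τ ρ) :
    epsOfA (Subgroup.zpowers a) = -1 := by
  have h2 := E.two_le
  have hle := E.le
  have hodd := N.t_odd S (by omega)
  rw [N.pres.acts_self.epsOfA_eq, if_neg]
  rw [N.factorization_r_two S E]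
  intro h
  have h3 : t % 2 ^ 2 = 1 := h.of_dvd (pow_dvd_pow 2 h2)
  have h4 : 2 ^ 2 ∣ t + 1 := (S.two_pow_dvd_add_one_iff hodd).2 ((E.dvd_iff (by omega)).2 h2)
  omega

lemma Split.factorization_isPer (S : Split p m n s t v w x M L n₁ s₁ τ) (A : Arith m n s t)
    (hMq : M ∣ q) (hqm : q ∣ M * L) (hκ : IsPer τ M (p ^ κ)) (hk : IsPer t q k) (hk0 : k ≠ 0) :
    k.factorization p = κ := by
  have hp := S.prime
  have hn1 := S.n₁_pos A
  have key : ∀ K, k ∣ p ^ K * n₁ ↔ κ ≤ K := fun K => by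
    rw [← hk, S.pow_eq, ← Nat.pow_dvd_pow_iff_le_right hp.one_lt, ← hκ]
    refine ⟨fun h => h.of_dvd hMq, fun h => Nat.ModEq.of_dvd hqm ?_⟩
    rw [← Nat.modEq_and_modEq_iff_modEq_mul S.cML]
    exact ⟨h, by simpa using S.triv.pow (p ^ K)⟩
  have hkn : k ∣ p ^ w * n₁ := by
    rw [← S.hn, ← hk]
    refine A.pow_t.of_dvd (hqm.trans ?_)
    rw [S.hm]
    exact dvd_mul_left _ _
  have key2 : ∀ K, k ∣ p ^ K * n₁ ↔ k.factorization p ≤ K := fun K => by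
    constructor
    · intro h
      have h1 := (Nat.ordProj_dvd k p).trans h
      exact (Nat.pow_dvd_pow_iff_le_right hp.one_lt).1
        ((Nat.Coprime.pow_left _ S.cn).dvd_of_dvd_mul_right h1)
    · intro h
      conv_lhs => rw [← Nat.ordProj_mul_ordCompl_eq_self k p]
      refine mul_dvd_mul (pow_dvd_pow p h) ?_
      exact (Nat.Coprime.pow_right w (Nat.coprime_ordCompl hp hk0).symm).dvd_of_dvd_mul_left
        ((Nat.ordCompl_dvd k p).trans hkn)
  have h3 : ∀ K, κ ≤ K ↔ k.factorization p ≤ K := fun K => by rw [← key, key2]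
  exact le_antisymm ((h3 _).1 le_rfl) ((h3 _).2 le_rfl)

lemma MinPres.factorization_k [Finite G] (N : MinPres a b m n s t)
    (S : Split p m n s t v w x M L n₁ s₁ τ) (ht : p ∣ m → t ≡ 1 [MOD p])
    (hκ : IsPer τ M (p ^ κ)) : (kOfA (Subgroup.zpowers a)).factorization p = κ := by
  have hp := S.prime
  have hA := N.pres.acts_self
  have hcard : Nat.card (Subgroup.zpowers a) = m := by rw [Nat.card_zpowers, N.pres.ord]
  have hm0 := N.pres.m_pos
  obtain ⟨q, hq'⟩ : ∃ q, q = natPart (Nat.card (Subgroup.zpowers a))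
    {p | ¬ p ∣ rOfA (Subgroup.zpowers a)} := ⟨_, rfl⟩
  have hq : q = natPart m {p | ¬ p ∣ rOfA (Subgroup.zpowers a)} := by rw [hq', hcard]
  have hk : IsPer t q (kOfA (Subgroup.zpowers a)) := by
    rw [kOfA, ← hq']
    exact hA.isPer_ncard (by rw [hq, N.pres.ord]; exact natPart_dvd hm0.ne' _)
  have hq0 : q ≠ 0 := hq ▸ natPart_ne_zero _ _
  have hqm : q ∣ m := hq ▸ natPart_dvd hm0.ne' _
  have hfac : ∀ ℓ, ¬ ℓ ∣ rOfA (Subgroup.zpowers a) → q.factorization ℓ = m.factorization ℓ :=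
    fun ℓ h => by rw [hq, factorization_natPart]; exact if_pos h
  have hfac' : ∀ ℓ, ℓ ∣ rOfA (Subgroup.zpowers a) → q.factorization ℓ = 0 :=
    fun ℓ h => by rw [hq, factorization_natPart]; exact if_neg (not_not.2 h)
  have hMm : M ∣ m := by rw [S.hm]; exact (dvd_mul_right M L).mul_left _
  have hM0 := S.M_pos N.arith
  have hL0 := S.L_pos N.arith
  refine S.factorization_isPer N.arith ?_ ?_ hκ hk ?_
  · refine dvd_of_factorization_le hM0.ne' hq0 fun ℓ hℓ => ?_
    by_cases hℓM : ℓ ∣ M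
    · rw [hfac]
      · exact (Nat.factorization_le_iff_dvd hM0.ne' hm0.ne').2 hMm ℓ
      · rw [hA.prime_dvd_rOfA_iff hℓ (by rw [N.pres.ord]; exact hℓM.trans hMm)]
        exact S.not_modEq_one hℓ hℓM
    · rw [Nat.factorization_eq_zero_of_not_dvd hℓM]
      exact Nat.zero_le _
  · have hcop : Nat.Coprime q (p ^ v) := by
      refine Nat.Coprime.pow_right v ((Nat.Prime.coprime_iff_not_dvd hp).2 fun hpq => ?_).symm
      have hpm := hpq.trans hqm
      have h1 := hfac' p ((hA.prime_dvd_rOfA_iff hp (by rw [N.pres.ord]; exact hpm)).2 (ht hpm))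
      have := hp.factorization_pos_of_dvd hq0 hpq
      omega
    exact hcop.dvd_of_dvd_mul_left (S.hm ▸ hqm)
  · intro h0
    rw [h0] at hk
    have := (hk n).1 (N.arith.pow_t.of_dvd hqm)
    rw [zero_dvd_iff] at this
    exact N.pres.n_pos.ne' this

end

lemma card_sup_dvd_of_normal {G : Type*} [Group G] (K L : Subgroup G) [K.Normal] :
    Nat.card (K ⊔ L : Subgroup G) ∣ Nat.card K * Nat.card L := by
  have h := Subgroup.relIndex_mul_relIndex ⊥ K (K ⊔ L) bot_le le_sup_left
  rw [Subgroup.relIndex_bot_left, Subgroup.relIndex_bot_left, Subgroup.relIndex_sup_left] at h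
  rw [← h]
  exact mul_dvd_mul_left _ (Subgroup.relIndex_dvd_card K L)

lemma coprime_orderOf_pow {G : Type*} [Group G] [Finite G] {p k : ℕ} (hp : p.Prime) (g : G)
    (hk : (orderOf g).factorization p ≤ k) : Nat.Coprime p (orderOf (g ^ p ^ k)) := by
  have h0 := (orderOf_pos g).ne'
  have h1 : orderOf (g ^ p ^ k) ∣ ordCompl[p] (orderOf g) := by
    refine orderOf_dvd_of_pow_eq_one ?_
    rw [← pow_mul]
    refine orderOf_dvd_iff_pow_eq_one.1 ?_
    conv_lhs => rw [← Nat.ordProj_mul_ordCompl_eq_self (orderOf g) p]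
    exact mul_dvd_mul_right (pow_dvd_pow p hk) _
  exact (Nat.coprime_ordCompl hp h0).coprime_dvd_right h1

section

variable {G : Type*} [Group G] {a b : G} {p m n s t : ℕ}

lemma Pres.modEq_one_of_complement [Finite G] (P : Pres a b m n s t) (hp : p.Prime) (hpm : p ∣ m)
    {N : Subgroup G} (hN : N.Normal) (hcard : Nat.card N = ordCompl[p] (Nat.card G)) :
    t ≡ 1 [MOD p] := by
  have hG : Nat.card G ≠ 0 := Nat.card_pos.ne'
  obtain ⟨c, hc⟩ : ∃ c, c = a ^ (m / p) := ⟨_, rfl⟩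
  have hoc : orderOf c = p := by
    rw [hc, orderOf_pow_of_dvd (Nat.div_pos (Nat.le_of_dvd P.m_pos hpm) hp.pos).ne'
      (by rw [P.ord]; exact Nat.div_dvd_of_dvd hpm), P.ord, Nat.div_div_self hpm P.m_pos.ne']
  have hcb : b⁻¹ * c * b = c ^ t := by
    rw [hc, conj_pow', mul_assoc, P.comm, inv_mul_cancel_left, ← pow_mul, ← pow_mul, mul_comm]
  have hca : a⁻¹ * c * a = c := by
    rw [hc, mul_assoc, ← pow_succ, pow_succ', inv_mul_cancel_left]
  have hcN := (P.acts hca hcb).normal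
  have hdis : Disjoint (Subgroup.zpowers c) N := by
    refine Subgroup.disjoint_of_coprime_natCard ?_
    rw [Nat.card_zpowers, hoc, hcard]
    exact Nat.coprime_ordCompl hp hG
  have hind : N.index = p ^ (Nat.card G).factorization p := by
    have h1 := N.card_mul_index
    rw [hcard, ← Nat.ordProj_mul_ordCompl_eq_self (Nat.card G) p] at h1
    refine Nat.eq_of_mul_eq_mul_left (Nat.ordCompl_pos p hG) ?_
    convert h1 using 1
    · rw [Nat.ordProj_mul_ordCompl_eq_self]
    · rw [mul_comm, Nat.ordProj_mul_ordCompl_eq_self]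
  have hcomm := Subgroup.commute_of_normal_of_disjoint _ _ hcN hN hdis c (b ^ N.index)
    (Subgroup.mem_zpowers c) (N.pow_index_mem b)
  have h3 : c * b ^ N.index = b ^ N.index * c ^ t ^ N.index := by
    have h4 : c * b = b * c ^ t := by rw [← hcb]; group
    simpa using pow_mul_pow_comm h4 1 N.index
  have h5 : c ^ 1 = c ^ t ^ N.index := by
    rw [pow_one]
    exact mul_left_cancel (hcomm.eq.symm.trans h3)
  rw [pow_eq_pow_iff_modEq, hoc, hind] at h5
  exact modEq_one_of_pow_prime hp h5.symm

lemma Pres.exists_complement [Finite G] (P : Pres a b m n s t) (hp : p.Prime)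
    (ht1 : 1 ≤ t) (ht : t ≡ 1 [MOD p]) :
    ∃ N : Subgroup G, N.Normal ∧ Nat.card N = ordCompl[p] (Nat.card G) := by
  have := Fact.mk hp
  have hG : Nat.card G ≠ 0 := Nat.card_pos.ne'
  obtain ⟨β, hβ⟩ : ∃ β, β = (Nat.card G).factorization p := ⟨_, rfl⟩
  have hle : ∀ g : G, (orderOf g).factorization p ≤ β := fun g => by
    rw [hβ]
    exact (Nat.factorization_le_iff_dvd (orderOf_pos g).ne' hG).2 (orderOf_dvd_natCard g) p
  have hU : p ^ β ∣ t ^ p ^ β - 1 := by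
    have h1 : (p : ℤ) ∣ (t : ℤ) - 1 := by
      have := (Nat.modEq_iff_dvd.1 ht.symm)
      simpa using this
    have h2 := dvd_sub_pow_of_dvd_sub h1 β
    rw [one_pow] at h2
    have h3 : ((p ^ β : ℕ) : ℤ) ∣ ((t ^ p ^ β - 1 : ℕ) : ℤ) := by
      rw [Nat.cast_sub (Nat.one_le_pow _ _ ht1)]
      push_cast
      exact (pow_dvd_pow (p : ℤ) (Nat.le_succ β)).trans h2
    exact_mod_cast h3
  obtain ⟨A, hA⟩ : ∃ A, A = Subgroup.zpowers (a ^ p ^ β) := ⟨_, rfl⟩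
  obtain ⟨B, hB⟩ : ∃ B, B = Subgroup.zpowers (b ^ p ^ β) := ⟨_, rfl⟩
  have hAn : A.Normal := by
    rw [hA]
    refine (P.acts (T := t) ?_ ?_).normal
    · rw [mul_assoc, ← pow_succ, pow_succ', inv_mul_cancel_left]
    · rw [conj_pow', mul_assoc, P.comm, inv_mul_cancel_left, ← pow_mul, ← pow_mul, mul_comm]
  have haA : a ^ p ^ β ∈ A := hA ▸ Subgroup.mem_zpowers _
  have hbB : b ^ p ^ β ∈ B := hB ▸ Subgroup.mem_zpowers _
  have hN : (A ⊔ B).Normal := by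
    have key : ∀ h g : G, g ∈ A ⊔ B → h⁻¹ * g * h ∈ A ⊔ B := by
      have red : ∀ h : G, h⁻¹ * b ^ p ^ β * h ∈ A ⊔ B → ∀ g ∈ A ⊔ B, h⁻¹ * g * h ∈ A ⊔ B := by
        intro h hb
        have hle : A ⊔ B ≤ (A ⊔ B).comap (MulAut.conj h⁻¹).toMonoidHom := by
          refine sup_le (fun g hg => ?_) ?_
          · have := hAn.conj_mem g hg h⁻¹
            rw [inv_inv] at this
            have h1 : h⁻¹ * g * h ∈ A ⊔ B := Subgroup.mem_sup_left this
            exact Subgroup.mem_comap.2 (by simpa [MulAut.conj_apply] using h1)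
          · rw [hB, Subgroup.zpowers_le, ← hB]
            exact Subgroup.mem_comap.2 (by simpa [MulAut.conj_apply] using hb)
        intro g hg
        simpa [MulAut.conj_apply] using hle hg
      refine P.forall_of_gen (by simp) (red a ?_) (red b ?_) fun x y hx hy g hg => ?_
      · have h1 := P.conj_mix' ht1 (p ^ β) 0
        rw [pow_zero, mul_one] at h1
        rw [h1]
        refine mul_mem (Subgroup.mem_sup_right hbB) (inv_mem (Subgroup.mem_sup_left ?_))
        obtain ⟨c, hc⟩ := hU
        rw [hc, pow_mul]
        exact pow_mem haA c
      · rw [mul_assoc, ← pow_succ, pow_succ', inv_mul_cancel_left]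
        exact Subgroup.mem_sup_right hbB
      · have := hy _ (hx g hg)
        rwa [show y⁻¹ * (x⁻¹ * g * x) * y = (x * y)⁻¹ * g * (x * y) by group] at this
    refine ⟨fun g hg h => ?_⟩
    simpa using key h⁻¹ g hg
  have hcop : Nat.Coprime p (Nat.card (A ⊔ B : Subgroup G)) := by
    refine Nat.Coprime.coprime_dvd_right (card_sup_dvd_of_normal A B) (Nat.Coprime.mul_right ?_ ?_)
    · rw [hA, Nat.card_zpowers]
      exact coprime_orderOf_pow hp a (hle a)
    · rw [hB, Nat.card_zpowers]
      exact coprime_orderOf_pow hp b (hle b)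
  have hpg : IsPGroup p (G ⧸ (A ⊔ B)) := by
    intro x
    induction x using QuotientGroup.induction_on with
    | H g =>
      obtain ⟨x, y, rfl⟩ := P.cover g
      refine ⟨β + β, ?_⟩
      rw [← QuotientGroup.mk_pow, QuotientGroup.eq_one_iff, pow_add, pow_mul, P.mix_pow, mul_comm y,
        pow_mul b]
      rw [← QuotientGroup.eq_one_iff, QuotientGroup.mk_pow, QuotientGroup.mk_mul,
        (QuotientGroup.eq_one_iff _).2
          (pow_mem (Subgroup.mem_sup_right hbB : b ^ p ^ β ∈ A ⊔ B) y), one_mul,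
        ← QuotientGroup.mk_pow, QuotientGroup.eq_one_iff, ← pow_mul, mul_comm _ (p ^ β), pow_mul]
      exact pow_mem (Subgroup.mem_sup_left haA) _
  obtain ⟨k, hk⟩ := IsPGroup.iff_card.1 hpg
  refine ⟨A ⊔ B, hN, ?_⟩
  have h1 := (A ⊔ B).card_mul_index
  rw [Subgroup.index_eq_card, hk] at h1
  have hc0 : Nat.card (A ⊔ B : Subgroup G) ≠ 0 := Nat.card_pos.ne'
  have hk' : (Nat.card G).factorization p = k := by
    rw [← h1, Nat.factorization_mul hc0 (pow_ne_zero _ hp.ne_zero), Finsupp.add_apply,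
      hp.factorization_pow, Finsupp.single_eq_same, Nat.factorization_eq_zero_of_not_dvd, zero_add]
    exact (Nat.Prime.coprime_iff_not_dvd hp).1 hcop
  rw [hk', ← h1, Nat.mul_div_cancel _ (pow_pos hp.pos k)]

lemma Pres.mem_piSet'_iff [Finite G] (P : Pres a b m n s t) (hp : p.Prime) (hpm : p ∣ m)
    (ht1 : 1 ≤ t) : p ∈ piSet' G ↔ ¬ t ≡ 1 [MOD p] := by
  have hpG : p ∣ Nat.card G := by rw [P.card]; exact hpm.mul_right n
  constructor
  · rintro ⟨-, h⟩ h1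
    exact h ⟨hp, hpG, P.exists_complement hp ht1 h1⟩
  · intro h
    refine ⟨⟨hp, hpG⟩, ?_⟩
    rintro ⟨-, -, N, hN, hcard⟩
    exact h (P.modEq_one_of_complement hp hpm hN hcard)

end

section Local

variable {p m n s r k v w x ρ κ : ℕ} {ε : ℤ}

lemma mPrimeP_eq_expOne (hp : p.Prime) (hε : ε ^ (p - 1) = 1) (hm : m.factorization p = v)
    (hn : n.factorization p = w) (hs : s.factorization p = x) (hr : r.factorization p = ρ)
    (hk : k.factorization p = κ) : mPrimeP p m n s r k ε = p ^ expOne v w x ρ κ := by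
  have hmono : Monotone fun i : ℕ => p ^ i := pow_right_mono₀ hp.one_lt.le
  have hmin : ∀ i j, p ^ min i j = min (p ^ i) (p ^ j) := fun i j => hmono.map_min
  have hmax : ∀ i j, p ^ max i j = max (p ^ i) (p ^ j) := fun i j => hmono.map_max
  rw [mPrimeP, if_pos hε, expOne, hm, hn, hs, hr, hk, hmin, hmin, pow_add]
  congr 2
  rcases le_or_gt w (ρ + x + κ) with h | h
  · rw [hmax, hmax, ← pow_add, ← pow_add, Nat.pow_div h hp.pos]
  · rw [Nat.sub_eq_zero_of_le h.le, max_eq_left (Nat.zero_le x), hmax, ← pow_add, ← pow_add,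
      Nat.div_eq_of_lt (Nat.pow_lt_pow_right hp.one_lt h), max_eq_left (Nat.zero_le (p ^ x))]

lemma mPrimeP_eq_expTwo (hv : 1 ≤ v) (hm : m.factorization 2 = v)
    (hn : n.factorization 2 = w) (hs : s.factorization 2 = x) (hr : r.factorization 2 = ρ)
    (hk : k.factorization 2 = κ) : mPrimeP 2 m n s r k (-1) = 2 ^ expTwo v w x ρ κ := by
  have hle : ∀ i j : ℕ, 2 ^ i ≤ 2 ^ j ↔ i ≤ j := fun i j => Nat.pow_le_pow_iff_right one_lt_two
  have hlt : ∀ i j : ℕ, 2 ^ i < 2 ^ j ↔ i < j := fun i j => Nat.pow_lt_pow_iff_right one_lt_two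
  have heq : ∀ i j : ℕ, 2 ^ i = 2 ^ j ↔ i = j := fun i j => Nat.pow_right_inj one_lt_two
  have c1 : 2 ^ κ ≤ 2 ↔ κ ≤ 1 := by simpa using hle κ 1
  have c2 : 2 ^ v ≤ 2 * 2 ^ ρ ↔ v ≤ ρ + 1 := by rw [← pow_succ', hle]
  have c3 : 4 ≤ 2 ^ κ ↔ 2 ≤ κ := hle 2 κ
  have c4 : 4 * 2 ^ ρ ≤ 2 ^ v ↔ ρ + 2 ≤ v := by
    rw [← hle (ρ + 2), pow_add, mul_comm]; norm_num
  have c5 : 2 ^ x = 2 ^ w * 2 ^ ρ ↔ x = w + ρ := by rw [← pow_add, heq]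
  have c6 : 2 * 2 ^ x = 2 ^ v ↔ x + 1 = v := by rw [← pow_succ', heq]
  have c7 : 2 ^ v < 2 ^ w * 2 ^ ρ ↔ v < w + ρ := by rw [← pow_add, hlt]
  rw [mPrimeP, if_neg (by norm_num)]
  simp only [expTwo, hm, hn, hs, hr, hk, c1, c2, c3, c4, c5, c6, c7, hlt]
  split_ifs
  · rfl
  · exact Nat.div_eq_of_eq_mul_left two_pos (by rw [← pow_succ, Nat.sub_add_cancel hv])
  · rfl

end Local

section

variable {G : Type*} [Group G] {a b : G} {p m n s t v w x M L n₁ s₁ τ ρ κ q : ℕ}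

lemma MinPres.mPrimeP_one [Finite G] (N : MinPres a b m n s t)
    (S : Split p m n s t v w x M L n₁ s₁ τ) (ht : p ∣ m → t ≡ 1 [MOD p]) (E : E1 p v τ ρ)
    (h2 : p = 2 → 2 ≤ v → 2 ≤ ρ) (hκ : IsPer τ M (p ^ κ)) :
    mPrimeP p m n s (rOfA (Subgroup.zpowers a)) (kOfA (Subgroup.zpowers a))
      (epsOfA (Subgroup.zpowers a)) = p ^ expOne v w x ρ κ :=
  mPrimeP_eq_expOne S.prime (N.eps_one S ht E h2) (S.factorization_m N.pres.m_pos)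
    (S.factorization_n N.pres.n_pos)
    (S.factorization_s (Nat.pos_of_dvd_of_pos N.pres.s_dvd N.pres.m_pos))
    (N.factorization_r_one S ht E h2) (N.factorization_k S ht hκ)

lemma MinPres.mPrimeP_two [Finite G] (N : MinPres a b m n s t)
    (S : Split 2 m n s t v w x M L n₁ s₁ τ) (E : E2 v τ ρ) (hκ : IsPer τ M (2 ^ κ)) :
    mPrimeP 2 m n s (rOfA (Subgroup.zpowers a)) (kOfA (Subgroup.zpowers a))
      (epsOfA (Subgroup.zpowers a)) = 2 ^ expTwo v w x ρ κ := by
  have h2 := E.two_le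
  have hle := E.le
  rw [N.eps_two S E]
  refine mPrimeP_eq_expTwo (by omega) (S.factorization_m N.pres.m_pos)
    (S.factorization_n N.pres.n_pos)
    (S.factorization_s (Nat.pos_of_dvd_of_pos N.pres.s_dvd N.pres.m_pos))
    (N.factorization_r_two S E) (N.factorization_k S (fun _ => ?_) hκ)
  have := N.t_odd S (by omega)
  exact Nat.odd_iff.1 this

lemma MinPres.exists_mPrimeP_eq [Finite G] (N : MinPres a b m n s t) (hp : p.Prime)
    (ht : p ∣ m → t ≡ 1 [MOD p]) :
    ∃ e ≤ m.factorization p, mPrimeP p m n s (rOfA (Subgroup.zpowers a))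
      (kOfA (Subgroup.zpowers a)) (epsOfA (Subgroup.zpowers a)) = p ^ e := by
  obtain ⟨v, w, x, M, L, n₁, s₁, τ, S⟩ := N.arith.exists_split hp
  have H := S.loc N.arith
  obtain ⟨κ, -, hκ⟩ := H.exists_per (dvd_mul_right M (p ^ v))
  rw [S.factorization_m N.pres.m_pos]
  have typeOne : ∀ ρ, E1 p v τ ρ → (p = 2 → 2 ≤ v → 2 ≤ ρ) →
      ∃ e ≤ v, mPrimeP p m n s (rOfA (Subgroup.zpowers a))
        (kOfA (Subgroup.zpowers a)) (epsOfA (Subgroup.zpowers a)) = p ^ e := fun ρ E h2 =>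
    ⟨_, by unfold expOne; exact min_le_left _ _, N.mPrimeP_one S ht E h2 hκ⟩
  by_cases hp2 : p = 2
  · subst hp2
    by_cases c : 2 ≤ v → τ % 4 = 1
    · obtain ⟨ρ, E, hρ⟩ := H.exists_E1_two c
      exact typeOne ρ E fun _ => hρ
    · push Not at c
      obtain ⟨ρ, E⟩ := H.exists_E2 c.1 c.2
      have hle := E.le
      exact ⟨_, by unfold expTwo; split_ifs <;> omega, N.mPrimeP_two S E hκ⟩
  · obtain ⟨ρ, E⟩ := H.exists_E1_of_odd hp2
    exact typeOne ρ E fun h => absurd h hp2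

lemma MinPres.exists_factorization_mPrimeOf [Finite G] (N : MinPres a b m n s t) :
    ∃ μ, μ = mPrimeOf (piSet' G) m n s (rOfA (Subgroup.zpowers a)) (kOfA (Subgroup.zpowers a))
        (epsOfA (Subgroup.zpowers a)) ∧ μ ∣ m ∧
      (∀ q, q.Prime → q ∣ m → ¬ t ≡ 1 [MOD q] → μ.factorization q = m.factorization q) ∧
      ∀ q e, q.Prime → q ∣ m → t ≡ 1 [MOD q] → mPrimeP q m n s (rOfA (Subgroup.zpowers a))
        (kOfA (Subgroup.zpowers a)) (epsOfA (Subgroup.zpowers a)) = q ^ e →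
        μ.factorization q = e := by
  obtain ⟨μ, hμ⟩ : ∃ μ, μ = mPrimeOf (piSet' G) m n s (rOfA (Subgroup.zpowers a))
    (kOfA (Subgroup.zpowers a)) (epsOfA (Subgroup.zpowers a)) := ⟨_, rfl⟩
  obtain ⟨r, hr⟩ : ∃ r, r = rOfA (Subgroup.zpowers a) := ⟨_, rfl⟩
  have hA := N.pres.acts_self
  have hm0 := N.pres.m_pos.ne'
  have ht1 : 1 ≤ t := one_le_two.trans N.arith.two_le
  have hr0 : r ≠ 0 := hr ▸ hA.rOfA_ne_zero
  have hrm : r ∣ m := by rw [hr, ← N.pres.ord]; exact hA.rOfA_dvd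
  have hdvd : ∀ q, q.Prime → q ∣ m → (q ∣ r ↔ t ≡ 1 [MOD q]) := fun q hq hqm => by
    rw [hr]; exact hA.prime_dvd_rOfA_iff hq (by rw [N.pres.ord]; exact hqm)
  choose! E hE hE' using fun (q : ℕ) (h : q.Prime ∧ (q ∣ m → t ≡ 1 [MOD q])) =>
    N.exists_mPrimeP_eq h.1 h.2
  have hrE : ∀ q ∈ r.primeFactors, q.Prime ∧ (q ∣ m → t ≡ 1 [MOD q]) := fun q hq => by
    have hq' := Nat.prime_of_mem_primeFactors hq
    exact ⟨hq', fun hqm => (hdvd q hq' hqm).1 (Nat.dvd_of_mem_primeFactors hq)⟩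
  have hprod : μ = natPart m (piSet' G) * ∏ p ∈ r.primeFactors, p ^ E p := by
    rw [hμ, mPrimeOf, ← hr]
    refine congrArg _ (Finset.prod_congr rfl fun q hq => ?_)
    rw [hr]
    exact hE' q (hrE q hq)
  have hprod0 : ∏ p ∈ r.primeFactors, p ^ E p ≠ 0 := Finset.prod_ne_zero_iff.2 fun q hq =>
    pow_ne_zero _ (Nat.prime_of_mem_primeFactors hq).ne_zero
  have hμ0 : μ ≠ 0 := by rw [hprod]; exact mul_ne_zero (natPart_ne_zero _ _) hprod0
  have hfac : ∀ q, μ.factorization q = (if q ∈ piSet' G then m.factorization q else 0) +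
      if q ∈ r.primeFactors then E q else 0 := fun q => by
    rw [hprod, Nat.factorization_mul (natPart_ne_zero _ _) hprod0, Finsupp.add_apply,
      factorization_natPart, factorization_prod_primes_pow fun p hp =>
        Nat.prime_of_mem_primeFactors hp]
  have hmov : ∀ q, q.Prime → q ∣ m → ¬ t ≡ 1 [MOD q] →
      μ.factorization q = m.factorization q := fun q hq hqm ht => by
    rw [hfac, if_pos ((N.pres.mem_piSet'_iff hq hqm ht1).2 ht), if_neg, add_zero]
    exact fun h => ht ((hdvd q hq hqm).1 (Nat.dvd_of_mem_primeFactors h))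
  have hfix : ∀ q, q.Prime → q ∣ m → t ≡ 1 [MOD q] → μ.factorization q = E q :=
    fun q hq hqm ht => by
      rw [hfac, if_neg (fun h => (N.pres.mem_piSet'_iff hq hqm ht1).1 h ht), if_pos, zero_add]
      exact Nat.mem_primeFactors.2 ⟨hq, (hdvd q hq hqm).2 ht, hr0⟩
  refine ⟨μ, hμ, dvd_of_factorization_le hμ0 hm0 fun q hq => ?_, hmov,
    fun q e hq hqm ht he => ?_⟩
  · by_cases hqm : q ∣ m
    · by_cases ht : t ≡ 1 [MOD q]
      · rw [hfix q hq hqm ht]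
        exact hE q ⟨hq, fun _ => ht⟩
      · exact (hmov q hq hqm ht).le
    · rw [hfac, if_neg fun h => hqm ((Nat.dvd_of_mem_primeFactors h).trans hrm),
        Nat.factorization_eq_zero_of_not_dvd hqm]
      split_ifs <;> rfl
  · rw [hfix q hq hqm ht]
    exact Nat.pow_right_injective hq.two_le ((hE' q ⟨hq, fun _ => ht⟩).symm.trans he)

lemma MinPres.minArith [Finite G] (N : MinPres a b m n s t) :
    MinArith m n s t (mPrimeOf (piSet' G) m n s (rOfA (Subgroup.zpowers a))
      (kOfA (Subgroup.zpowers a)) (epsOfA (Subgroup.zpowers a))) := by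
  obtain ⟨μ, hμ, hdvd, hmov, hfix⟩ := N.exists_factorization_mPrimeOf
  rw [← hμ]
  refine ⟨hdvd, hmov, @fun p v w x M L n₁ s₁ τ ρ κ S ht E h2 hκ => ⟨N.x_le_w S ht E h2,
    N.rho_le_x S ht E hκ, ?_⟩, @fun v w x M L n₁ s₁ τ ρ κ S E hκ => ⟨N.not_E2_full S E,
    N.rho_ne_v S E hκ, ?_⟩⟩
  · by_cases hpm : p ∣ m
    · exact hfix p _ S.prime hpm (ht hpm) (N.mPrimeP_one S ht E h2 hκ)
    · have hv : v = 0 := by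
        rw [← S.factorization_m N.pres.m_pos, Nat.factorization_eq_zero_of_not_dvd hpm]
      rw [Nat.factorization_eq_zero_of_not_dvd fun h => hpm (h.trans hdvd), hv, expOne]
      simp
  · have h2 := E.two_le
    have hle := E.le
    have hodd := N.t_odd S (by omega)
    have h2m : 2 ∣ m := by
      have := (S.pow_dvd_m_iff N.pres.m_pos (i := 1)).2 (by omega)
      simpa using this
    exact hfix 2 _ Nat.prime_two h2m (Nat.odd_iff.1 hodd) (N.mPrimeP_two S E hκ)

end

theorem IsMinimalFact.exists_minArith {G : Type*} [Group G] [Finite G] {f : MetacyclicFact G}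
    (hf : IsMinimalFact f) {μ : ℕ}
    (hμ : μ = mPrimeOf (piSet' G) (mOf f) (nOf f) (sOf f) (rOf f) (kOf f) (epsOf f)) :
    ∃ a b t, Pres (G := G) a b (mOf f) (nOf f) (sOf f) t ∧ Arith (mOf f) (nOf f) (sOf f) t ∧
      MinArith (mOf f) (nOf f) (sOf f) t μ ∧
      ∀ y, y ∈ liftSet (TGmod f.A μ) ↔ ∃ i, y ≡ t ^ i [MOD μ] := by
  obtain ⟨a, b, t, hA, N⟩ := hf.exists_minPres
  have hN := N.minArith
  rw [hA] at hN
  have hμN : MinArith (mOf f) (nOf f) (sOf f) t μ := hμ ▸ hN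
  refine ⟨a, b, t, N.pres, N.arith, hμN, fun y => ?_⟩
  rw [← hA]
  exact N.pres.acts_self.mem_liftSet (by rw [N.pres.ord]; exact hμN.dvd)

/-- If `ℚG ≅ ℚH` for finite metacyclic `G, H`, then the moduli `m'` coincide and
`Δ^G = Δ^H` as subgroups of `(ℤ/m'ℤ)ˣ`. -/
theorem Delta_eq_of_qalgebra_iso {G H : Type*} [Group G] [Group H] [Finite G] [Finite H]
    (fG : MetacyclicFact G) (hfG : IsMinimalFact fG)
    (fH : MetacyclicFact H) (hfH : IsMinimalFact fH)
    (h : Nonempty (MonoidAlgebra ℚ G ≃ₐ[ℚ] MonoidAlgebra ℚ H)) :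
    mPrimeOf (piSet' G) (mOf fG) (nOf fG) (sOf fG) (rOf fG) (kOf fG) (epsOf fG) =
      mPrimeOf (piSet' H) (mOf fH) (nOf fH) (sOf fH) (rOf fH) (kOf fH) (epsOf fH) ∧
    liftSet (TGmod fG.A
        (mPrimeOf (piSet' G) (mOf fG) (nOf fG) (sOf fG) (rOf fG) (kOf fG) (epsOf fG))) =
      liftSet (TGmod fH.A
        (mPrimeOf (piSet' H) (mOf fH) (nOf fH) (sOf fH) (rOf fH) (kOf fH) (epsOf fH))) := by
  obtain ⟨e⟩ := h
  generalize hμ : mPrimeOf (piSet' G) (mOf fG) (nOf fG) (sOf fG) (rOf fG) (kOf fG) (epsOf fG) = μ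
  generalize hν : mPrimeOf (piSet' H) (mOf fH) (nOf fH) (sOf fH) (rOf fH) (kOf fH) (epsOf fH) = ν
  obtain ⟨a, b, t, P, A, N, hl⟩ := hfG.exists_minArith hμ.symm
  obtain ⟨a', b', t', P', A', N', hl'⟩ := hfH.exists_minArith hν.symm
  have hW : SameW (mOf fG) (nOf fG) (sOf fG) t (mOf fH) (nOf fH) (sOf fH) t' :=
    W_eq_of_iso P P' e
  obtain rfl := hW.modulus_eq A A' N N'
  exact ⟨rfl, Set.ext fun y => by rw [hl, hl', hW.powers_eq A A' N N']⟩

end ArXiv230800432
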